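/- Let E ∈ 𝓔 and let σ ∈ 𝒮⁻ satisfy: (i) the sequence (σ(−n)/n^α)_{n≥1} is eventually log-concave for some α > 3/2; (ii) the sequence ((log σ(−n))·(log n)^A / n)_{n≥1} is eventually nondecreasing for some A > 0; (iii) Σ_{n≥1} log(σ(−n))/n² = +∞; (iv) limsup_{n→∞} log‖T|_Eⁿ‖ / log(σ(−n)) < 1/200. Set F = E ⊕ H²_{0,σ}(ℂ∖𝔻̄). Then for every closed left-invariant subspace N ≠ {0} of F there exists an integer k ≥ 0 such that 𝐒^k(N) is analytic (i.e., 𝐒^k(N) ∩ E ≠ {0}), and moreover F = 𝐒^k(N) + E and N = [span(∪_{n≥k} 𝐒^{-n}(𝐒^k(N) ∩ E))]⁻ (closure in F). In particular, every nontrivial closed bi-invariant subspace N of F has the form N = [span(∪_{n≥k} 𝐒^{-n}(M))]⁻ where M = N ∩ E is a closed z-invariant subspace of E having the division property. -/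

import Mathlib

noncomputable section

open Metric Set Filter Topology
open scoped Classical

/-- Functions holomorphic on the open unit disc, normalized to vanish outside it.
This is our model of `Hol(𝔻)`. -/
def HolDisc : Set (ℂ → ℂ) :=
  {f | DifferentiableOn ℂ f (Metric.ball (0:ℂ) 1) ∧ ∀ z ∉ Metric.ball (0:ℂ) 1, f z = 0}

/-- The constant function `1` of `Hol(𝔻)` (normalized to vanish outside the disc). -/
def oneD : ℂ → ℂ := fun z => if z ∈ Metric.ball (0:ℂ) 1 then 1 else 0

/-- The shift `S`, `(Sf)(z) = z f(z)`, as a linear map. -/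
def shiftL : (ℂ → ℂ) →ₗ[ℂ] (ℂ → ℂ) where
  toFun f := fun z => z * f z
  map_add' f g := by funext z; simp [mul_add]
  map_smul' c f := by funext z; simp [smul_eq_mul]; ring

/-- Division: `f_λ(z) = (f(z) - f(λ))/(z - λ)` for `z ≠ λ`, `f_λ(λ) = f'(λ)`,
normalized to vanish outside the disc.  `fdivB 0` is the backward shift `T`. -/
def fdivB (lam : ℂ) (f : ℂ → ℂ) : ℂ → ℂ := fun z =>
  if z ∈ Metric.ball (0:ℂ) 1 then
    (if z = lam then deriv f lam else (f z - f lam) / (z - lam))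
  else 0

/-- The reflected model of the shift `S⁻` on `H₀(ℂ ∖ 𝔻̄)`: a function `h` on `{|ζ|>1}`
vanishing at `∞` is represented by `k(w) = h(1/w)` (holomorphic on `𝔻`, `k 0 = 0`);
`S⁻` corresponds to `k ↦ (k(z) - k(0))/z - k'(0)·1`. -/
def negShiftF (k : ℂ → ℂ) : ℂ → ℂ := fun z => fdivB 0 k z - deriv k 0 * oneD z

/-- `n`-th Taylor coefficient at the origin. -/
def tCoeff (n : ℕ) (f : ℂ → ℂ) : ℂ := iteratedDeriv n f 0 / (Nat.factorial n)

/-- The increment of `p n - α log n`. -/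
def logIncr (p : ℕ → ℝ) (α : ℝ) (n : ℕ) : ℝ :=
  p (n + 1) - p n - α * (Real.log (n + 1) - Real.log n)

/-- The logarithm `p` of a weight satisfying the regularity and growth hypotheses. -/
structure GoodWeight (p : ℕ → ℝ) (α A : ℝ) : Prop where
  one_lt : 1 < α
  A_pos : 0 < A
  concave : ∃ K : ℕ, 1 ≤ K ∧ ∀ n, K ≤ n → logIncr p α (n + 1) ≤ logIncr p α n
  mono : ∃ K : ℕ, 1 ≤ K ∧ ∀ n, K ≤ n →
    p n * (Real.log n) ^ A / (n : ℝ) ≤ p (n + 1) * (Real.log ((n : ℝ) + 1)) ^ A / ((n : ℝ) + 1)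
  div : Tendsto (fun N : ℕ => ∑ n ∈ Finset.range N, p (n + 1) / ((n : ℝ) + 1) ^ 2) atTop atTop
  lim : Tendsto (fun n : ℕ => p n / (n : ℝ)) atTop (𝓝 0)

/-- The dyadic averages `p (2 ^ j) / 2 ^ j`. -/
def dyad (p : ℕ → ℝ) (j : ℕ) : ℝ := p (2 ^ j) / 2 ^ j

theorem eventually_linear_mul_pow_le {β γ : ℝ} (hβ : 1 ≤ β) (hβγ : β < γ) (C : ℝ) :
    ∀ᶠ j : ℕ in atTop, C * ((j : ℝ) + 1) * β ^ j ≤ γ ^ j := by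
  have hγ : 0 < γ := by linarith
  have h1 : Tendsto (fun j : ℕ => (j : ℝ) * (β / γ) ^ j) atTop (𝓝 0) :=
    tendsto_self_mul_const_pow_of_lt_one (by positivity) ((div_lt_one hγ).2 hβγ)
  have h2 : Tendsto (fun j : ℕ => (β / γ) ^ j) atTop (𝓝 0) :=
    tendsto_pow_atTop_nhds_zero_of_lt_one (by positivity) ((div_lt_one hγ).2 hβγ)
  have h3 : Tendsto (fun j : ℕ => C * ((j : ℝ) * (β / γ) ^ j + (β / γ) ^ j)) atTop (𝓝 0) := by
    simpa using (h1.add h2).const_mul C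
  filter_upwards [h3.eventually (gt_mem_nhds zero_lt_one)] with j hj
  have : C * ((j : ℝ) + 1) * β ^ j = C * ((j : ℝ) * (β / γ) ^ j + (β / γ) ^ j) * γ ^ j := by
    rw [div_pow]; field_simp
  rw [this]
  nlinarith [pow_pos hγ j]

namespace GoodWeight

variable {p : ℕ → ℝ} {α A : ℝ}

theorem mono_on (h : GoodWeight p α A) : ∃ K : ℕ, 3 ≤ K ∧ ∀ m n, K ≤ m → m ≤ n →
    p m * (Real.log m) ^ A / (m : ℝ) ≤ p n * (Real.log n) ^ A / (n : ℝ) := by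
  obtain ⟨K, hK, h1⟩ := h.mono
  refine ⟨max K 3, le_max_right _ _, fun m n hm hn => ?_⟩
  induction n, hn using Nat.le_induction with
  | base => exact le_rfl
  | succ n hn ih =>
    have := h1 n ((le_max_left _ _).trans (hm.trans hn))
    push_cast
    exact ih.trans this

theorem lower (h : GoodWeight p α A) : ∃ κ : ℝ, 0 < κ ∧ ∃ K : ℕ, 3 ≤ K ∧ ∀ n : ℕ, K ≤ n →
    κ * n / (Real.log n) ^ A ≤ p n := by
  obtain ⟨K, hK, h1⟩ := h.mono_on
  have hlog : ∀ n : ℕ, 3 ≤ n → 0 < (Real.log n) ^ A := fun n hn => by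
    have : (1 : ℝ) < n := by exact_mod_cast (by omega : 1 < n)
    exact Real.rpow_pos_of_pos (Real.log_pos this) _
  have hex : ∃ n, K ≤ n ∧ 0 < p n := by
    by_contra hcon
    push Not at hcon
    have hb : ∀ N : ℕ, ∑ n ∈ Finset.range N, p (n + 1) / ((n : ℝ) + 1) ^ 2 ≤
        ∑ n ∈ Finset.range K, |p (n + 1) / ((n : ℝ) + 1) ^ 2| := by
      intro N
      calc ∑ n ∈ Finset.range N, p (n + 1) / ((n : ℝ) + 1) ^ 2
          ≤ ∑ n ∈ Finset.range N, (if n < K then |p (n + 1) / ((n : ℝ) + 1) ^ 2| else 0) := by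
            refine Finset.sum_le_sum fun n _ => ?_
            split_ifs with hn
            · exact le_abs_self _
            · exact div_nonpos_of_nonpos_of_nonneg (hcon _ (by omega)) (by positivity)
        _ = ∑ n ∈ (Finset.range N).filter (· < K), |p (n + 1) / ((n : ℝ) + 1) ^ 2| := by
            rw [Finset.sum_filter]
        _ ≤ _ := by
            refine Finset.sum_le_sum_of_subset_of_nonneg (fun n hn => ?_) fun _ _ _ => abs_nonneg _
            simp at hn ⊢; exact hn.2
    obtain ⟨N, hN⟩ := (h.div.eventually (eventually_gt_atTop _)).exists
    exact absurd (hb N) (not_le.2 hN)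
  obtain ⟨n₁, hn₁, hp⟩ := hex
  have h3 : (0 : ℝ) < n₁ := by exact_mod_cast (by omega : 0 < n₁)
  refine ⟨p n₁ * (Real.log n₁) ^ A / n₁, ?_, n₁, by omega, fun n hn => ?_⟩
  · have := hlog n₁ (by omega)
    positivity
  · have h4 := h1 n₁ n hn₁ hn
    have h5 := hlog n (by omega)
    have h6 : (0 : ℝ) < n := by exact_mod_cast (by omega : 0 < n)
    rw [div_le_iff₀ h5]
    rwa [le_div_iff₀ h6] at h4

theorem dyad_lower (h : GoodWeight p α A) {γ : ℝ} (hγ0 : 1 ≤ γ) (hγ : γ < 2) :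
    ∀ᶠ j : ℕ in atTop, γ ^ j ≤ p (2 ^ j) := by
  obtain ⟨κ, hκ, K, hK, h1⟩ := h.lower
  obtain ⟨k, hk⟩ := exists_nat_ge A
  have h2 : Tendsto (fun j : ℕ => (j : ℝ) ^ k * (γ / 2) ^ j) atTop (𝓝 0) :=
    tendsto_pow_const_mul_const_pow_of_abs_lt_one k
      (by rw [abs_of_nonneg (by positivity)]; linarith)
  filter_upwards [h2.eventually (gt_mem_nhds hκ), eventually_ge_atTop K, eventually_ge_atTop 1]
    with j hj hjK hj1
  have h3 := h1 (2 ^ j) (hjK.trans (Nat.lt_two_pow_self).le)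
  refine le_trans ?_ h3
  push_cast
  rw [Real.log_pow]
  have hl : 0 < (j : ℝ) * Real.log 2 := by
    have : (0 : ℝ) < j := by exact_mod_cast hj1
    have := Real.log_pos one_lt_two
    positivity
  have hj1' : (1 : ℝ) ≤ j := by exact_mod_cast hj1
  have h4 : ((j : ℝ) * Real.log 2) ^ A ≤ (j : ℝ) ^ k := by
    calc ((j : ℝ) * Real.log 2) ^ A ≤ (j : ℝ) ^ A := by
          refine Real.rpow_le_rpow hl.le ?_ h.A_pos.le
          have := Real.log_two_lt_d9
          nlinarith
      _ ≤ (j : ℝ) ^ (k : ℝ) := Real.rpow_le_rpow_of_exponent_le hj1' hk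
      _ = _ := Real.rpow_natCast _ _
  rw [le_div_iff₀ (Real.rpow_pos_of_pos hl _)]
  calc γ ^ j * ((j : ℝ) * Real.log 2) ^ A ≤ γ ^ j * (j : ℝ) ^ k := by gcongr
    _ = ((j : ℝ) ^ k * (γ / 2) ^ j) * 2 ^ j := by rw [div_pow]; field_simp
    _ ≤ κ * 2 ^ j := by gcongr

theorem antitone_avg (h : GoodWeight p α A) : ∃ K : ℕ, 3 ≤ K ∧ ∀ m n : ℕ, K ≤ m → m ≤ n →
    p n / (n : ℝ) ≤ p m / m := by
  obtain ⟨K, hK, h1⟩ := h.concave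
  set Δ : ℕ → ℝ := fun n => p n - α * Real.log n - n * logIncr p α n with hΔ
  have hmono : ∀ n, K ≤ n → Δ K ≤ Δ n := by
    intro n hn
    induction n, hn using Nat.le_induction with
    | base => exact le_rfl
    | succ n hn ih =>
      refine ih.trans ?_
      have h2 := h1 n hn
      have h3 : ((n : ℝ) + 1) * logIncr p α (n + 1) ≤ ((n : ℝ) + 1) * logIncr p α n := by gcongr
      have h4 : logIncr p α n = p (n + 1) - p n - α * (Real.log (n + 1) - Real.log n) := rfl
      simp only [hΔ]
      push_cast
      linarith
  have ht : Tendsto (fun n : ℕ => Δ K + α * (Real.log n - 1)) atTop atTop := by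
    refine tendsto_atTop_add_const_left _ _ (Tendsto.const_mul_atTop (by linarith [h.one_lt]) ?_)
    exact tendsto_atTop_add_const_right _ _ (Real.tendsto_log_atTop.comp tendsto_natCast_atTop_atTop)
  obtain ⟨K', hK'⟩ := eventually_atTop.1 (ht.eventually (eventually_ge_atTop 0))
  refine ⟨max (max K K') 3, le_max_right _ _, fun m n hm hn => ?_⟩
  induction n, hn using Nat.le_induction with
  | base => exact le_rfl
  | succ n hn ih =>
    refine le_trans ?_ ih
    have hn3 : 3 ≤ n := (le_max_right _ _).trans (hm.trans hn)
    have hnK : K ≤ n := (le_max_left _ _).trans ((le_max_left _ _).trans (hm.trans hn))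
    have hnK' : K' ≤ n := (le_max_right _ _).trans ((le_max_left _ _).trans (hm.trans hn))
    have hn0 : (0 : ℝ) < n := by exact_mod_cast (by omega : 0 < n)
    have h2 := hK' n hnK'
    have h3 := hmono n hnK
    have h4 : Real.log ((n : ℝ) + 1) - Real.log n ≤ 1 / n := by
      rw [← Real.log_div (by positivity) hn0.ne']
      refine (Real.log_le_sub_one_of_pos (by positivity)).trans (le_of_eq ?_)
      field_simp; ring
    have h5 : (n : ℝ) * (Real.log ((n : ℝ) + 1) - Real.log n) ≤ 1 := by
      have := mul_le_mul_of_nonneg_left h4 hn0.le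
      rwa [mul_one_div_cancel hn0.ne'] at this
    have h6 : α * ((n : ℝ) * (Real.log ((n : ℝ) + 1) - Real.log n)) ≤ α * 1 :=
      mul_le_mul_of_nonneg_left h5 (by linarith [h.one_lt])
    have h7 : 0 ≤ p n - n * (p (n + 1) - p n) := by
      simp only [hΔ, logIncr] at h3
      simp only [hΔ, logIncr] at h2
      linarith
    push_cast
    rw [div_le_div_iff₀ (by positivity) hn0]
    linarith

theorem dyad_pos (h : GoodWeight p α A) : ∀ᶠ j : ℕ in atTop, 0 < dyad p j := by
  filter_upwards [h.dyad_lower le_rfl one_lt_two] with j hj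
  unfold dyad
  have : 0 < p (2 ^ j) := by linarith [one_pow (M := ℝ) j]
  positivity

theorem dyad_ge (h : GoodWeight p α A) : ∀ᶠ j : ℕ in atTop, 1 / 2 ^ j ≤ dyad p j := by
  filter_upwards [h.dyad_lower le_rfl one_lt_two] with j hj
  unfold dyad
  rw [one_pow] at hj
  gcongr

theorem dyad_tendsto (h : GoodWeight p α A) : Tendsto (dyad p) atTop (𝓝 0) := by
  have h1 := h.lim.comp (tendsto_pow_atTop_atTop_of_one_lt (r := 2) (by norm_num))
  refine h1.congr fun j => ?_
  simp [dyad]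

theorem dyad_antitone (h : GoodWeight p α A) : ∀ᶠ j : ℕ in atTop, dyad p (j + 1) ≤ dyad p j := by
  obtain ⟨K, hK, h1⟩ := h.antitone_avg
  filter_upwards [eventually_ge_atTop K] with j hj
  have := h1 (2 ^ j) (2 ^ (j + 1)) (hj.trans (Nat.lt_two_pow_self).le)
    (Nat.pow_le_pow_right (by norm_num) (by omega))
  simpa [dyad] using this

theorem dyad_slow (h : GoodWeight p α A) {η : ℝ} (hη : 0 < η) :
    ∀ᶠ j : ℕ in atTop, dyad p j ≤ (1 + η) * dyad p (j + 1) := by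
  obtain ⟨K, hK, h1⟩ := h.mono_on
  have h2 : Tendsto (fun j : ℕ => (1 + 1 / (j : ℝ)) ^ A) atTop (𝓝 1) := by
    have h3 : Tendsto (fun j : ℕ => 1 + 1 / (j : ℝ)) atTop (𝓝 1) := by
      simpa using (tendsto_one_div_atTop_nhds_zero_nat (𝕜 := ℝ)).const_add 1
    simpa using h3.rpow_const (p := A) (Or.inl one_ne_zero)
  have hpos := (tendsto_add_atTop_nat 1).eventually h.dyad_pos
  filter_upwards [h2.eventually (gt_mem_nhds (show (1 : ℝ) < 1 + η by linarith)),
    eventually_ge_atTop K, hpos] with j hj hjK hp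
  have h4 := h1 (2 ^ j) (2 ^ (j + 1)) (hjK.trans (Nat.lt_two_pow_self).le)
    (Nat.pow_le_pow_right (by norm_num) (by omega))
  have hj0 : (0 : ℝ) < j := by exact_mod_cast (by omega : 0 < j)
  have hl2 := Real.log_pos one_lt_two
  have e1 : Real.log ((2 ^ (j + 1) : ℕ) : ℝ) = (1 + 1 / (j : ℝ)) * (j * Real.log 2) := by
    push_cast; rw [Real.log_pow]; push_cast; field_simp
  have e2 : Real.log ((2 ^ j : ℕ) : ℝ) = j * Real.log 2 := by
    push_cast; rw [Real.log_pow]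
  rw [e1, e2, Real.mul_rpow (x := 1 + 1 / (j : ℝ)) (by positivity) (by positivity)] at h4
  have hL : 0 < ((j : ℝ) * Real.log 2) ^ A := Real.rpow_pos_of_pos (by positivity) _
  have h5 : dyad p j * ((j : ℝ) * Real.log 2) ^ A ≤
      ((1 + 1 / (j : ℝ)) ^ A * dyad p (j + 1)) * ((j : ℝ) * Real.log 2) ^ A := by
    calc _ = p (2 ^ j) * ((j : ℝ) * Real.log 2) ^ A / ((2 ^ j : ℕ) : ℝ) := by
          simp [dyad]; ring
      _ ≤ _ := h4
      _ = _ := by simp [dyad]; ring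
  have h6 := le_of_mul_le_mul_right h5 hL
  exact h6.trans (by gcongr)

theorem dyad_not_summable (h : GoodWeight p α A) : ¬ Summable (dyad p) := by
  intro hs
  obtain ⟨K, hK, h1⟩ := h.antitone_avg
  obtain ⟨κ, hκ, K', hK', h2⟩ := h.lower
  set n₃ := max K K' with hn₃
  have hnn : ∀ n, n₃ ≤ n → 0 ≤ p n / (n : ℝ) := fun n hn => by
    refine div_nonneg (le_trans ?_ (h2 n ((le_max_right _ _).trans hn))) (by positivity)
    have : 0 ≤ Real.log n := Real.log_natCast_nonneg n
    positivity
  set f : ℕ → ℝ := fun n => p (max n n₃) / ((max n n₃ : ℕ) : ℝ) / n with hf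
  have hf0 : ∀ n, 0 ≤ f n := fun n => div_nonneg (hnn _ (le_max_right _ _)) (by positivity)
  have hfanti : ∀ ⦃m n : ℕ⦄, 0 < m → m ≤ n → f n ≤ f m := by
    intro m n hm hmn
    have hm' : (0 : ℝ) < m := by exact_mod_cast hm
    have a1 := h1 (max m n₃) (max n n₃) ((le_max_left _ _).trans (le_max_right _ _))
      (max_le_max hmn le_rfl)
    have a2 := hnn (max n n₃) (le_max_right _ _)
    simp only [hf]
    have : (m : ℝ) ≤ n := by exact_mod_cast hmn
    gcongr
    exact hnn _ (le_max_right _ _)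
  have hsum : Summable f := by
    rw [← summable_condensed_iff_of_nonneg hf0 hfanti]
    refine (summable_congr_atTop ?_).2 hs
    filter_upwards [eventually_ge_atTop n₃] with k hk
    have : max (2 ^ k) n₃ = 2 ^ k := max_eq_left (hk.trans (Nat.lt_two_pow_self).le)
    simp only [hf, this, dyad]
    push_cast
    field_simp
  have hsum2 : Summable fun n : ℕ => p (n + 1) / ((n : ℝ) + 1) ^ 2 := by
    have := (summable_nat_add_iff 1).2 hsum
    refine (summable_congr_atTop ?_).2 this
    filter_upwards [eventually_ge_atTop n₃] with k hk
    have : max (k + 1) n₃ = k + 1 := max_eq_left (by omega)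
    simp only [hf, this]
    push_cast
    field_simp
  exact not_tendsto_nhds_of_tendsto_atTop h.div _ hsum2.hasSum.tendsto_sum_nat

theorem logIncr_antitone (h : GoodWeight p α A) : ∃ K : ℕ, 1 ≤ K ∧ ∀ m n, K ≤ m → m ≤ n →
    logIncr p α n ≤ logIncr p α m := by
  obtain ⟨K, hK, h1⟩ := h.concave
  refine ⟨K, hK, fun m n hm hn => ?_⟩
  induction n, hn using Nat.le_induction with
  | base => exact le_rfl
  | succ n hn ih => exact (h1 n (hm.trans hn)).trans ih

theorem sum_logIncr (p : ℕ → ℝ) (α : ℝ) (m k : ℕ) :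
    ∑ i ∈ Finset.range k, logIncr p α (m + i) =
      (p (m + k) - α * Real.log ((m + k : ℕ) : ℝ)) - (p m - α * Real.log m) := by
  induction k with
  | zero => simp
  | succ k ih =>
    rw [Finset.sum_range_succ, ih, logIncr]
    push_cast
    rw [← add_assoc m k 1, add_assoc (m : ℝ) k 1]
    ring

theorem dyad_le_logIncr (h : GoodWeight p α A) :
    ∀ᶠ j : ℕ in atTop, dyad p j / 2 ≤ logIncr p α (2 ^ j) := by
  obtain ⟨K, hK, h1⟩ := h.logIncr_antitone
  have hbig := ((tendsto_pow_atTop_atTop_of_one_lt (r := (3 / 2 : ℝ)) (by norm_num)).eventually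
    (eventually_ge_atTop (10 * (α * Real.log 2))))
  filter_upwards [eventually_ge_atTop K, h.dyad_slow (show (0 : ℝ) < 1 / 4 by norm_num),
    h.dyad_lower (γ := 3 / 2) (by norm_num) (by norm_num), hbig] with j hj hs hl hb
  have hn : K ≤ 2 ^ j := hj.trans (Nat.lt_two_pow_self).le
  have h2 := sum_logIncr p α (2 ^ j) (2 ^ j)
  have h3 : ∑ i ∈ Finset.range (2 ^ j), logIncr p α (2 ^ j + i) ≤
      2 ^ j * logIncr p α (2 ^ j) := by
    refine (Finset.sum_le_card_nsmul _ _ (logIncr p α (2 ^ j)) fun i _ =>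
      h1 _ _ hn (by omega)).trans (le_of_eq ?_)
    simp
  have e1 : 2 ^ j + 2 ^ j = 2 ^ (j + 1) := by ring
  rw [e1] at h2
  have e2 : Real.log ((2 ^ (j + 1) : ℕ) : ℝ) = Real.log ((2 ^ j : ℕ) : ℝ) + Real.log 2 := by
    push_cast; rw [pow_succ, Real.log_mul (by positivity) (by positivity)]
  rw [e2] at h2
  have e3 : p (2 ^ j) = 2 ^ j * dyad p j := by unfold dyad; field_simp
  have e4 : p (2 ^ (j + 1)) = 2 * 2 ^ j * dyad p (j + 1) := by unfold dyad; field_simp; ring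
  have hp : (0 : ℝ) < 2 ^ j := by positivity
  have h5 : 10 * (α * Real.log 2) ≤ 2 ^ j * dyad p j := by rw [← e3]; exact hb.trans hl
  have h6 : 2 ^ j * (dyad p j / 2) ≤ 2 ^ j * logIncr p α (2 ^ j) := by
    refine le_trans ?_ h3
    rw [h2, e3, e4]
    have : 2 ^ j * dyad p j ≤ 2 ^ j * ((1 + 1 / 4) * dyad p (j + 1)) := by gcongr
    linarith
  exact le_of_mul_le_mul_left h6 hp

theorem le_five_mul (h : GoodWeight p α A) : ∃ β : ℝ, 1 < β ∧ β < 2 ∧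
    ∀ᶠ j : ℕ in atTop, ∀ i : ℕ, β ^ j ≤ i → p i ≤ 5 * i * dyad p j := by
  obtain ⟨K, hK, h1⟩ := h.mono_on
  obtain ⟨K', hK', h2⟩ := h.antitone_avg
  set θ : ℝ := (1 / 5 : ℝ) ^ (1 / A) with hθ
  have hA := h.A_pos
  have hθ0 : 0 < θ := Real.rpow_pos_of_pos (by norm_num) _
  have hθ1 : θ < 1 := Real.rpow_lt_one (by norm_num) (by norm_num) (by positivity)
  have hθA : θ ^ A = 1 / 5 := by
    rw [hθ, ← Real.rpow_mul (by norm_num), one_div_mul_cancel hA.ne', Real.rpow_one]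
  refine ⟨2 ^ θ, Real.one_lt_rpow one_lt_two hθ0, ?_, ?_⟩
  · calc (2 : ℝ) ^ θ < 2 ^ (1 : ℝ) := Real.rpow_lt_rpow_of_exponent_lt one_lt_two hθ1
      _ = 2 := Real.rpow_one _
  have hb := (tendsto_pow_atTop_atTop_of_one_lt (r := (2 : ℝ) ^ θ)
    (Real.one_lt_rpow one_lt_two hθ0)).eventually (eventually_ge_atTop (K : ℝ))
  filter_upwards [hb, eventually_ge_atTop K', h.dyad_pos, eventually_ge_atTop 1]
    with j hj hjK hd hj1 i hi
  have hiK : K ≤ i := by exact_mod_cast hj.trans hi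
  have hi0 : (0 : ℝ) < i := by exact_mod_cast (by omega : 0 < i)
  rcases le_total i (2 ^ j) with hij | hij
  · have h3 := h1 i (2 ^ j) hiK hij
    have hj0 : (0 : ℝ) < j := by exact_mod_cast hj1
    have hl2 := Real.log_pos one_lt_two
    have e2 : Real.log ((2 ^ j : ℕ) : ℝ) = j * Real.log 2 := by
      push_cast; rw [Real.log_pow]
    have hlog : θ * (j * Real.log 2) ≤ Real.log i := by
      have := Real.log_le_log (by positivity) hi
      rw [Real.log_pow, Real.log_rpow two_pos] at this
      linarith
    have hL : 0 < ((j : ℝ) * Real.log 2) ^ A := Real.rpow_pos_of_pos (by positivity) _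
    have h4 : 1 / 5 * ((j : ℝ) * Real.log 2) ^ A ≤ (Real.log i) ^ A := by
      rw [← hθA, ← Real.mul_rpow hθ0.le (by positivity)]
      exact Real.rpow_le_rpow (by positivity) hlog hA.le
    rw [e2] at h3
    by_cases hpi : p i ≤ 0
    · exact hpi.trans (by positivity)
    push Not at hpi
    have h5 : p i * (1 / 5 * ((j : ℝ) * Real.log 2) ^ A) / i ≤
        dyad p j * ((j : ℝ) * Real.log 2) ^ A := by
      calc _ ≤ p i * (Real.log i) ^ A / i := by gcongr
        _ ≤ _ := h3
        _ = _ := by simp [dyad]; ring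
    have h6 : (p i / (5 * i)) * ((j : ℝ) * Real.log 2) ^ A ≤
        dyad p j * ((j : ℝ) * Real.log 2) ^ A := by
      refine le_trans (le_of_eq ?_) h5
      field_simp
    have h7 := le_of_mul_le_mul_right h6 hL
    rw [div_le_iff₀ (by positivity)] at h7
    linarith
  · have h3 := h2 (2 ^ j) i (hjK.trans (Nat.lt_two_pow_self).le) hij
    have h4 : p i / i ≤ dyad p j := by simpa [dyad] using h3
    rw [div_le_iff₀ hi0] at h4
    nlinarith

theorem abs_le_linear (h : GoodWeight p α A) : ∃ C : ℝ, 0 < C ∧ ∀ i : ℕ, |p i| ≤ C + i := by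
  obtain ⟨K, hK⟩ := eventually_atTop.1 (h.lim.eventually (Metric.ball_mem_nhds 0 one_pos))
  refine ⟨∑ i ∈ Finset.range (K + 1), |p i| + 1,
    by have := Finset.sum_nonneg (s := Finset.range (K + 1)) fun i _ => abs_nonneg (p i)
       linarith, fun i => ?_⟩
  have hs := Finset.sum_nonneg (s := Finset.range (K + 1)) fun i _ => abs_nonneg (p i)
  rcases lt_or_ge i (K + 1) with hi | hi
  · have := Finset.single_le_sum (f := fun i => |p i|) (fun i _ => abs_nonneg (p i))
      (Finset.mem_range.2 hi)
    have : (0 : ℝ) ≤ i := by positivity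
    linarith
  · have h1 := hK i (by omega)
    have hi0 : (0 : ℝ) < i := by exact_mod_cast (by omega : 0 < i)
    simp only [dist_zero_right, Real.norm_eq_abs, abs_div, abs_of_pos hi0] at h1
    rw [div_lt_one hi0] at h1
    linarith

end GoodWeight

theorem integral_exp_int_mul (k : ℤ) :
    ∫ x in (-Real.pi)..Real.pi, Complex.exp (k * x * Complex.I) = if k = 0 then 2 * Real.pi else 0 := by
  split_ifs with hk
  · subst hk
    simp
    ring
  · have hk' : (k : ℂ) * Complex.I ≠ 0 := by simp [hk]
    have h1 : ∀ x : ℝ, (k : ℂ) * x * Complex.I = (k * Complex.I) * x := fun x => by ring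
    simp only [h1]
    rw [integral_exp_mul_complex hk']
    have : Complex.exp (k * Complex.I * (Real.pi : ℝ)) =
        Complex.exp (k * Complex.I * ((-Real.pi : ℝ) : ℂ)) := by
      rw [Complex.exp_eq_exp_iff_exists_int]
      refine ⟨k, ?_⟩
      push_cast
      ring
    rw [this]
    simp

/-- Cauchy's estimate for the coefficients of an absolutely convergent Dirichlet-type expansion on
a vertical line. -/
theorem norm_coeff_le_of_norm_tsum_le {a : ℕ → ℂ} {y M : ℝ}
    (hs : Summable fun k : ℕ => ‖a k‖ * Real.exp (-(k * y)))
    (hM : ∀ x : ℝ, x ∈ Icc (-Real.pi) Real.pi →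
      ‖∑' k : ℕ, a k * Complex.exp (-(k * (y + x * Complex.I)))‖ ≤ M) (k : ℕ) :
    ‖a k‖ * Real.exp (-(k * y)) ≤ M := by
  have hnorm : ∀ (l : ℕ) (x : ℝ), ‖a l * Complex.exp (-(l * (y + x * Complex.I))) *
      Complex.exp (k * x * Complex.I)‖ = ‖a l‖ * Real.exp (-(l * y)) := by
    intro l x
    rw [norm_mul, norm_mul, Complex.norm_exp, Complex.norm_exp]
    simp
  let F : ℕ → C(ℝ, ℂ) := fun l =>
    ⟨fun x => a l * Complex.exp (-(l * (y + x * Complex.I))) * Complex.exp (k * x * Complex.I),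
      by fun_prop⟩
  have hF : Summable fun l : ℕ => ‖(F l).restrict
      (⟨uIcc (-Real.pi) Real.pi, isCompact_uIcc⟩ : TopologicalSpace.Compacts ℝ)‖ := by
    refine Summable.of_nonneg_of_le (fun _ => norm_nonneg _) (fun l => ?_) hs
    rw [ContinuousMap.norm_le _ (by positivity)]
    intro x
    exact (hnorm l x).le
  have h1 := intervalIntegral.hasSum_intervalIntegral_of_summable_norm hF
  have h2 : ∀ l : ℕ, ∫ x in (-Real.pi)..Real.pi, F l x =
      if l = k then a k * Complex.exp (-(k * y)) * (2 * Real.pi) else 0 := by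
    intro l
    have e1 : ∀ x : ℝ, F l x = (a l * Complex.exp (-(l * y))) *
        Complex.exp (((k - l : ℤ) : ℂ) * x * Complex.I) := by
      intro x
      simp only [F, ContinuousMap.coe_mk]
      rw [mul_assoc (a l), mul_assoc (a l), ← Complex.exp_add, ← Complex.exp_add]
      congr 2
      push_cast
      ring
    simp only [e1]
    rw [intervalIntegral.integral_const_mul, integral_exp_int_mul]
    by_cases hlk : l = k
    · subst hlk; simp
    · have : (k : ℤ) - l ≠ 0 := by omega
      simp [hlk, this]
  simp only [h2] at h1
  have h3 := h1.unique (hasSum_ite_eq k (a k * Complex.exp (-(k * y)) * (2 * Real.pi)))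
  have h4 : ‖∫ x in (-Real.pi)..Real.pi, ∑' l, F l x‖ ≤ M * |Real.pi - -Real.pi| := by
    refine intervalIntegral.norm_integral_le_of_norm_le_const fun x hx => ?_
    have hx' : x ∈ Icc (-Real.pi) Real.pi := by
      rw [uIoc_of_le (by linarith [Real.pi_pos])] at hx
      exact ⟨hx.1.le, hx.2⟩
    simp only [F, ContinuousMap.coe_mk]
    rw [tsum_mul_right, norm_mul]
    have : ‖Complex.exp (k * x * Complex.I)‖ = 1 := by rw [Complex.norm_exp]; simp
    rw [this, mul_one]
    exact hM x hx'
  rw [h3, norm_mul, norm_mul, Complex.norm_exp] at h4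
  have e2 : |Real.pi - -Real.pi| = 2 * Real.pi := by
    rw [abs_of_pos] <;> linarith [Real.pi_pos]
  have e3 : ‖(2 * Real.pi : ℂ)‖ = 2 * Real.pi := by
    rw [norm_mul, Complex.norm_real, Real.norm_of_nonneg Real.pi_pos.le]; simp
  rw [e2, e3] at h4
  have h5 := le_of_mul_le_mul_right h4 (by linarith [Real.pi_pos])
  simpa using h5

/-- A three circles estimate. -/
theorem norm_le_of_three_circles {f : ℂ → ℂ} {c : ℂ} {ρ ε M : ℝ} (hρ : 0 < ρ)
    (hf : ∀ w ∈ closedBall c (2 * ρ), DifferentiableAt ℂ f w) (hε : 0 < ε) (hεM : ε ≤ M)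
    (h1 : ∀ w ∈ closedBall c ρ, ‖f w‖ ≤ ε) (h2 : ∀ w ∈ closedBall c (2 * ρ), ‖f w‖ ≤ M)
    {w : ℂ} (hw : w ∈ closedBall c (11 / 10 * ρ)) :
    ‖f w‖ ≤ ε ^ (17 / 20 : ℝ) * M ^ (3 / 20 : ℝ) := by
  have hMpos : 0 < M := hε.trans_le hεM
  have hl2 : 0 < Real.log 2 := Real.log_pos one_lt_two
  have key : ∀ t : ℝ, 0 ≤ t → t ≤ 3 / 20 →
      ε ^ (1 - t) * M ^ t ≤ ε ^ (17 / 20 : ℝ) * M ^ (3 / 20 : ℝ) := by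
    intro t ht0 ht
    have e1 : ε ^ (1 - t) = ε ^ (17 / 20 : ℝ) * ε ^ (3 / 20 - t) := by
      rw [← Real.rpow_add hε]; congr 1; ring
    have e2 : M ^ (3 / 20 : ℝ) = M ^ (3 / 20 - t) * M ^ t := by
      rw [← Real.rpow_add hMpos]; congr 1; ring
    rw [e1, e2, mul_assoc]
    gcongr
  by_cases hin : w ∈ closedBall c ρ
  · refine (h1 w hin).trans ?_
    have := key 0 le_rfl (by norm_num)
    simpa using this
  · have hd : ρ < ‖w - c‖ := by simpa [dist_eq_norm] using hin
    have hd2 : ‖w - c‖ ≤ 11 / 10 * ρ := by simpa [dist_eq_norm] using hw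
    have hne : (w - c) / ρ ≠ 0 := by
      have : w - c ≠ 0 := norm_pos_iff.1 (hρ.trans hd)
      have : (ρ : ℂ) ≠ 0 := by exact_mod_cast hρ.ne'
      positivity
    set z := Complex.log ((w - c) / ρ) with hz
    have hzre : z.re = Real.log (‖w - c‖ / ρ) := by
      rw [hz, Complex.log_re, norm_div, Complex.norm_real, Real.norm_of_nonneg hρ.le]
    set g : ℂ → ℂ := fun z => f (c + ρ * Complex.exp z) with hg
    have hmem : ∀ z : ℂ, z.re ≤ Real.log 2 → c + ρ * Complex.exp z ∈ closedBall c (2 * ρ) := by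
      intro z hz
      rw [mem_closedBall, dist_eq_norm, add_sub_cancel_left, norm_mul, Complex.norm_exp,
        Complex.norm_real, Real.norm_of_nonneg hρ.le, mul_comm]
      gcongr
      calc Real.exp z.re ≤ Real.exp (Real.log 2) := Real.exp_le_exp.2 hz
        _ = 2 := Real.exp_log two_pos
    have hgd : ∀ z : ℂ, z.re ≤ Real.log 2 → DifferentiableAt ℂ g z := by
      intro z hz
      have := hf _ (hmem z hz)
      exact this.comp z (by fun_prop)
    have hstrip : z ∈ Complex.HadamardThreeLines.verticalClosedStrip 0 (Real.log 2) := by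
      change z.re ∈ Icc 0 (Real.log 2)
      rw [hzre]
      refine ⟨Real.log_nonneg (by rw [le_div_iff₀ hρ]; linarith), ?_⟩
      refine Real.log_le_log (by have := hρ.trans hd; positivity) ?_
      rw [div_le_iff₀ hρ]; linarith
    have hdc : DiffContOnCl ℂ g (Complex.HadamardThreeLines.verticalStrip 0 (Real.log 2)) := by
      refine DifferentiableOn.diffContOnCl fun z hz => (hgd z ?_).differentiableWithinAt
      have hsub : closure (Complex.HadamardThreeLines.verticalStrip 0 (Real.log 2)) ⊆
          {z : ℂ | z.re ≤ Real.log 2} :=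
        closure_minimal (fun z hz => hz.2.le) (isClosed_le Complex.continuous_re continuous_const)
      exact hsub hz
    have hB : BddAbove ((norm ∘ g) ''
        Complex.HadamardThreeLines.verticalClosedStrip 0 (Real.log 2)) := by
      refine ⟨M, ?_⟩
      rintro _ ⟨z, hz, rfl⟩
      exact h2 _ (hmem z hz.2)
    have h3 := Complex.HadamardThreeLines.norm_le_interp_of_mem_verticalClosedStrip' (a := ε)
      (b := M) hl2 hstrip hdc hB
      (fun z hz => by
        refine h1 _ ?_
        have : z.re = 0 := hz
        rw [mem_closedBall, dist_eq_norm, add_sub_cancel_left, norm_mul, Complex.norm_exp,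
          Complex.norm_real, Real.norm_of_nonneg hρ.le, this]
        simp)
      (fun z hz => h2 _ (hmem z (le_of_eq hz)))
    have hgz : g z = f w := by
      simp only [hg, hz]
      rw [Complex.exp_log hne]
      congr 1
      have : (ρ : ℂ) ≠ 0 := by exact_mod_cast hρ.ne'
      field_simp
      ring
    rw [hgz, sub_zero, sub_zero] at h3
    refine h3.trans (key _ (div_nonneg hstrip.1 hl2.le) ?_)
    rw [div_le_iff₀ hl2, hzre]
    have h4 : Real.log (‖w - c‖ / ρ) ≤ Real.log (11 / 10) := by
      refine Real.log_le_log (by have := hρ.trans hd; positivity) ?_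
      rw [div_le_iff₀ hρ]; linarith
    have h5 : 20 * Real.log (11 / 10) ≤ 3 * Real.log 2 := by
      have := Real.log_le_log (x := (11 / 10 : ℝ) ^ 20) (y := 2 ^ 3) (by positivity) (by norm_num)
      rwa [Real.log_pow, Real.log_pow] at this
    linarith

theorem exists_gap {a H : ℝ} (hH : 0 < H) (Z : Finset ℝ) {n : ℕ} (hn : Z.card ≤ n) :
    ∃ u, a ≤ u ∧ u + H / (3 * (n + 1)) ≤ a + H ∧
      ∀ y ∈ Icc u (u + H / (3 * (n + 1))), ∀ z ∈ Z, H / (3 * (n + 1)) ≤ |y - z| := by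
  set D := H / (3 * ((n : ℝ) + 1)) with hD
  have hDpos : 0 < D := by positivity
  have hHD : H = 3 * D * (n + 1) := by rw [hD]; field_simp
  have hcard : (Z.image fun z => ⌊(z - a) / (3 * D)⌋).card < (Finset.range (n + 1)).card := by
    rw [Finset.card_range]
    exact Nat.lt_succ_of_le (Finset.card_image_le.trans hn)
  obtain ⟨k, hk, hk2⟩ : ∃ k ∈ Finset.range (n + 1),
      (k : ℤ) ∉ Z.image fun z => ⌊(z - a) / (3 * D)⌋ := by
    by_contra hcon
    push Not at hcon
    have : ((Finset.range (n + 1)).image (fun k : ℕ => (k : ℤ))).card ≤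
        (Z.image fun z => ⌊(z - a) / (3 * D)⌋).card := by
      refine Finset.card_le_card fun x hx => ?_
      obtain ⟨k, hk, rfl⟩ := Finset.mem_image.1 hx
      exact hcon k hk
    rw [Finset.card_image_of_injective _ Nat.cast_injective] at this
    omega
  have hkn : (k : ℝ) ≤ n := by exact_mod_cast Nat.lt_succ_iff.1 (Finset.mem_range.1 hk)
  have hk0 : (0 : ℝ) ≤ k := by positivity
  refine ⟨a + 3 * D * k + D, by nlinarith, by nlinarith, fun y hy z hz => ?_⟩
  by_contra hlt
  push Not at hlt
  rw [abs_lt] at hlt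
  refine hk2 (Finset.mem_image.2 ⟨z, hz, ?_⟩)
  rw [Int.floor_eq_iff]
  have h3 : 0 < 3 * D := by positivity
  rw [le_div_iff₀ h3, div_lt_iff₀ h3]
  push_cast
  constructor <;> nlinarith [hy.1, hy.2, hlt.1, hlt.2]

theorem exists_log_on_ball {f : ℂ → ℂ} {c : ℂ} {R : ℝ} (hR : 0 < R)
    (hf : DifferentiableOn ℂ f (ball c R)) (h0 : ∀ w ∈ ball c R, f w ≠ 0) :
    ∃ g : ℂ → ℂ, DifferentiableOn ℂ g (ball c R) ∧ g c = 0 ∧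
      ∀ w ∈ ball c R, f w = f c * Complex.exp (g w) := by
  have hd : DifferentiableOn ℂ (fun w => deriv f w / f w) (ball c R) :=
    (hf.deriv isOpen_ball).div hf h0
  obtain ⟨g, hg⟩ := hd.isExactOn_ball
  have hfd : ∀ w ∈ ball c R, HasDerivAt f (deriv f w) w := fun w hw =>
    (hf.differentiableAt (isOpen_ball.mem_nhds hw)).hasDerivAt
  have hc : c ∈ ball c R := mem_ball_self hR
  have hq : ∀ w ∈ ball c R, HasDerivAt (fun w => f w * Complex.exp (-(g w - g c))) 0 w := by
    intro w hw
    have h1 := (hfd w hw).mul (((hg w hw).sub_const (g c)).neg.cexp)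
    have e : deriv f w * Complex.exp (-(g w - g c)) +
        f w * (Complex.exp (-(g w - g c)) * -(deriv f w / f w)) = 0 := by
      have := h0 w hw
      field_simp
      ring
    exact e ▸ h1
  refine ⟨fun w => g w - g c, fun w hw =>
    ((hg w hw).sub_const _).differentiableAt.differentiableWithinAt, by simp, fun w hw => ?_⟩
  have h2 := isOpen_ball.is_const_of_deriv_eq_zero (convex_ball c R).isPreconnected
    (f := fun w => f w * Complex.exp (-(g w - g c)))
    (fun w hw => (hq w hw).differentiableAt.differentiableWithinAt) (fun w hw => (hq w hw).deriv)
    hw hc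
  simp only [sub_self, neg_zero, Complex.exp_zero, mul_one] at h2
  rw [← h2, mul_assoc, ← Complex.exp_add]
  simp

/-- A Harnack type lower bound for zero-free holomorphic functions. -/
theorem norm_ge_of_ne_zero {f : ℂ → ℂ} {c : ℂ} {R M m : ℝ} (hR : 0 < R)
    (hf : DifferentiableOn ℂ f (ball c R)) (h0 : ∀ w ∈ ball c R, f w ≠ 0) (hm : 0 < m)
    (hM : ∀ w ∈ ball c R, ‖f w‖ ≤ M) (hmf : m ≤ ‖f c‖) {w : ℂ} (hw : ‖w - c‖ ≤ 3 / 4 * R) :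
    m * (m / (2 * M)) ^ 6 ≤ ‖f w‖ := by
  obtain ⟨g, hg, hg0, hfg⟩ := exists_log_on_ball hR hf h0
  have hcM : ‖f c‖ ≤ M := hM c (mem_ball_self hR)
  have hMpos : 0 < M := hm.trans_le (hmf.trans hcM)
  have hfc : 0 < ‖f c‖ := hm.trans_le hmf
  have hLpos : 0 < Real.log (2 * M / m) := Real.log_pos (by rw [one_lt_div hm]; linarith)
  have hnorm : ∀ z ∈ ball c R, ‖f z‖ = ‖f c‖ * Real.exp (g z).re := fun z hz => by
    rw [hfg z hz, norm_mul, Complex.norm_exp]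
  have hmaps : MapsTo (fun z => g (c + z)) (ball 0 R) {z | z.re ≤ Real.log (2 * M / m)} := by
    intro z hz
    have hz' : c + z ∈ ball c R := by simpa using hz
    have h1 := hnorm _ hz'
    have h2 := hM _ hz'
    change (g (c + z)).re ≤ _
    rw [Real.le_log_iff_exp_le (by positivity), le_div_iff₀ hm]
    nlinarith [Real.exp_pos (g (c + z)).re]
  have hd : DifferentiableOn ℂ (fun z => g (c + z)) (ball 0 R) := by
    refine hg.comp (by fun_prop) fun z hz => ?_
    simpa using hz
  have hwball : w ∈ ball c R := by rw [mem_ball, dist_eq_norm]; linarith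
  have h3 := Complex.borelCaratheodory_zero hLpos hd hmaps hR (z := w - c)
    (by rw [mem_ball_zero_iff]; linarith) (by simp [hg0])
  rw [add_sub_cancel] at h3
  have h4 : ‖g w‖ ≤ 6 * Real.log (2 * M / m) := by
    refine h3.trans ?_
    rw [div_le_iff₀ (by linarith)]
    nlinarith
  have h5 : -(6 * Real.log (2 * M / m)) ≤ (g w).re := by
    have := (abs_le.1 (Complex.abs_re_le_norm (g w))).1
    linarith
  rw [hnorm w hwball]
  have h6 : (m / (2 * M)) ^ 6 ≤ Real.exp (g w).re := by
    refine le_trans (le_of_eq ?_) (Real.exp_le_exp.2 h5)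
    have : m / (2 * M) = Real.exp (-Real.log (2 * M / m)) := by
      rw [Real.exp_neg, Real.exp_log (by positivity), inv_div]
    rw [this, ← Real.exp_nat_mul]
    congr 1
    push_cast
    ring
  gcongr

/-- A minimum modulus estimate away from finitely many points. -/
theorem exists_finset_norm_ge {w₀ w₁ : ℂ} {r : ℝ} (hr : 0 < r) {U : Set ℂ} (hU : IsOpen U)
    (hsub : closedBall w₀ (4 * r) ⊆ U) (hw₁ : ‖w₁ - w₀‖ ≤ r / 5) (n : ℕ) :
    ∀ (f : ℂ → ℂ) (M m : ℝ), DifferentiableOn ℂ f U → 0 < m →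
      (∀ w ∈ closedBall w₀ (4 * r), ‖f w‖ ≤ M) → m ≤ ‖f w₁‖ → M < m * (5 / 2) ^ n →
      ∃ Z : Finset ℂ, Z.card ≤ n ∧ ∀ w ∈ closedBall w₀ (2 / 5 * r), ∀ D : ℝ, 0 < D → D ≤ 2 * r →
        (∀ u ∈ Z, D ≤ ‖w - u‖) → m * (m / (2 * M)) ^ 6 * (D / (2 * r)) ^ n ≤ ‖f w‖ := by
  have hw₁mem : w₁ ∈ closedBall w₀ (4 * r) := by
    rw [mem_closedBall, dist_eq_norm]; linarith
  induction n with
  | zero =>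
    intro f M m _ _ hM hm h
    exact absurd (hM w₁ hw₁mem) (not_le.2 (by linarith [h.trans_le (by simpa using hm)]))
  | succ n ih =>
    intro f M m hf hm hM hmf h
    have hMpos : 0 < M := hm.trans_le (hmf.trans (hM w₁ hw₁mem))
    by_cases hz : ∃ u ∈ closedBall w₀ r, f u = 0
    · obtain ⟨u, hu, hfu⟩ := hz
      have hu' : ‖u - w₀‖ ≤ r := by simpa [dist_eq_norm] using hu
      have huU : U ∈ 𝓝 u := hU.mem_nhds (hsub (closedBall_subset_closedBall (by linarith) hu))
      set g := dslope f u with hg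
      have hgd : DifferentiableOn ℂ g U := (Complex.differentiableOn_dslope huU).2 hf
      have hfac : ∀ w, f w = (w - u) * g w := by
        intro w
        have := sub_smul_dslope f u w
        rw [hfu, sub_zero, smul_eq_mul] at this
        exact this.symm
      have hgM : ∀ w ∈ closedBall w₀ (4 * r), ‖g w‖ ≤ M / (3 * r) := by
        intro w hw
        have hcl : closure (ball w₀ (4 * r)) = closedBall w₀ (4 * r) :=
          closure_ball _ (by positivity)
        refine Complex.norm_le_of_forall_mem_frontier_norm_le (U := ball w₀ (4 * r))
          isBounded_ball ?_ ?_ (by rwa [hcl])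
        · refine (hgd.mono ?_).diffContOnCl
          rwa [hcl]
        · intro z hz
          rw [frontier_ball _ (by positivity)] at hz
          have hz' : ‖z - w₀‖ = 4 * r := by simpa [dist_eq_norm] using hz
          have h1 : 3 * r ≤ ‖z - u‖ := by
            have := norm_sub_norm_le (z - w₀) (u - w₀)
            rw [sub_sub_sub_cancel_right] at this
            linarith
          have h2 := hM z (sphere_subset_closedBall hz)
          rw [hfac, norm_mul] at h2
          rw [le_div_iff₀ (by positivity)]
          nlinarith [norm_nonneg (g z)]
      have hw₁u : ‖w₁ - u‖ ≤ 6 / 5 * r := by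
        have := norm_sub_le (w₁ - w₀) (u - w₀)
        rw [sub_sub_sub_cancel_right] at this
        linarith
      have hgm : m / (6 / 5 * r) ≤ ‖g w₁‖ := by
        rw [div_le_iff₀ (by positivity)]
        rw [hfac, norm_mul] at hmf
        nlinarith [norm_nonneg (g w₁)]
      obtain ⟨Z, hZ, hlow⟩ := ih g (M / (3 * r)) (m / (6 / 5 * r)) hgd (by positivity) hgM hgm (by
        rw [div_lt_iff₀ (by positivity)]
        refine h.trans_le (le_of_eq ?_)
        rw [pow_succ]
        field_simp
        norm_num)
      refine ⟨insert u Z, (Finset.card_insert_le _ _).trans (by omega), fun w hw D hD hD2 hdist => ?_⟩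
      have h3 := hlow w hw D hD hD2 fun u' hu' => hdist u' (Finset.mem_insert_of_mem hu')
      have h4 := hdist u (Finset.mem_insert_self _ _)
      rw [hfac, norm_mul]
      have h5 : m / (2 * M) ≤ m / (6 / 5 * r) / (2 * (M / (3 * r))) := by
        rw [div_div, div_le_div_iff₀ (by positivity) (by positivity)]
        field_simp
        norm_num
      calc m * (m / (2 * M)) ^ 6 * (D / (2 * r)) ^ (n + 1)
          = D * (m / (2 * r) * (m / (2 * M)) ^ 6 * (D / (2 * r)) ^ n) := by
            rw [pow_succ (D / (2 * r))]; field_simp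
        _ ≤ ‖w - u‖ * (m / (6 / 5 * r) * (m / (6 / 5 * r) / (2 * (M / (3 * r)))) ^ 6 *
              (D / (2 * r)) ^ n) := by
            gcongr
            linarith
        _ ≤ _ := by gcongr
    · push Not at hz
      refine ⟨∅, by simp, fun w hw D hD hD2 _ => ?_⟩
      have hsub' : ball w₁ (4 / 5 * r) ⊆ closedBall w₀ r := by
        intro z hz
        rw [mem_ball, dist_eq_norm] at hz
        rw [mem_closedBall, dist_eq_norm]
        have := norm_add_le (z - w₁) (w₁ - w₀)
        rw [sub_add_sub_cancel] at this
        linarith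
      have hsub4 : closedBall w₀ r ⊆ closedBall w₀ (4 * r) :=
        closedBall_subset_closedBall (by linarith)
      have h1 := norm_ge_of_ne_zero (c := w₁) (R := 4 / 5 * r) (w := w) (by positivity)
        (hf.mono ((hsub'.trans hsub4).trans hsub)) (fun z hz' => hz z (hsub' hz')) hm
        (fun z hz' => hM z (hsub4 (hsub' hz'))) hmf (by
          have := norm_sub_le (w - w₀) (w₁ - w₀)
          rw [sub_sub_sub_cancel_right] at this
          have : ‖w - w₀‖ ≤ 2 / 5 * r := by simpa [dist_eq_norm] using hw
          linarith)
      refine le_trans ?_ h1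
      refine mul_le_of_le_one_right (by positivity) (pow_le_one₀ (by positivity) ?_)
      rw [div_le_one (by positivity)]
      exact hD2

theorem slope_le {p : ℕ → ℝ} {α : ℝ} {y : ℝ} {m n : ℕ} (hmn : m ≤ n)
    (h : ∀ i, m ≤ i → i < n → y ≤ logIncr p α i) :
    p m - p n + ((n : ℝ) - m) * y ≤ α * (Real.log m - Real.log n) := by
  obtain ⟨k, rfl⟩ := Nat.exists_eq_add_of_le hmn
  have h1 := GoodWeight.sum_logIncr p α m k
  have h2 : (k : ℝ) * y ≤ ∑ i ∈ Finset.range k, logIncr p α (m + i) := by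
    have := Finset.card_nsmul_le_sum (Finset.range k) (fun i => logIncr p α (m + i)) y
      (fun i hi => h _ (by omega) (by have := Finset.mem_range.1 hi; omega))
    simpa using this
  push_cast at h1 ⊢
  linarith

theorem slope_ge {p : ℕ → ℝ} {α : ℝ} {y : ℝ} {m n : ℕ} (hmn : m ≤ n)
    (h : ∀ i, m ≤ i → i < n → logIncr p α i ≤ y) :
    p n - p m ≤ ((n : ℝ) - m) * y + α * (Real.log n - Real.log m) := by
  obtain ⟨k, rfl⟩ := Nat.exists_eq_add_of_le hmn
  have h1 := GoodWeight.sum_logIncr p α m k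
  have h2 : ∑ i ∈ Finset.range k, logIncr p α (m + i) ≤ (k : ℝ) * y := by
    have := Finset.sum_le_card_nsmul (Finset.range k) (fun i => logIncr p α (m + i)) y
      (fun i hi => h _ (by omega) (by have := Finset.mem_range.1 hi; omega))
    simpa using this
  push_cast at h1 ⊢
  linarith

theorem exists_slope_const (p : ℕ → ℝ) (α : ℝ) (K : ℕ) (hK1 : 1 ≤ K) : ∃ C : ℝ, 0 < C ∧
    ∀ (N : ℕ) (y : ℝ), 0 ≤ y → y ≤ 1 → K ≤ N → (∀ i, K ≤ i → i < N → y ≤ logIncr p α i) →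
      ∀ l i : ℕ, 1 ≤ l → l ≤ i → i ≤ N →
        p l - p i + ((i : ℝ) - l) * y ≤ C + α * (Real.log l - Real.log i) := by
  set q : ℕ → ℝ := fun n => p n - α * Real.log n with hq
  set B := ∑ n ∈ Finset.range (K + 1), |q n| with hB
  have hB0 : 0 ≤ B := Finset.sum_nonneg fun _ _ => abs_nonneg _
  have hBq : ∀ n, n ≤ K → |q n| ≤ B := fun n hn =>
    Finset.single_le_sum (f := fun n => |q n|) (fun _ _ => abs_nonneg _)
      (Finset.mem_range.2 (by omega))
  have hKr : (1 : ℝ) ≤ K := by exact_mod_cast hK1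
  refine ⟨2 * B + K, by positivity, fun N y hy0 hy1 hKN hsl l i hl hli hiN => ?_⟩
  have hl0 : (0 : ℝ) ≤ l := by positivity
  have key : q l - q i + ((i : ℝ) - l) * y ≤ 2 * B + K := by
    rcases le_total K l with hKl | hlK
    · have := slope_le (p := p) (α := α) (y := y) hli fun j hj hj' => hsl j (by omega) (by omega)
      simp only [hq]
      linarith
    · have b1 := (abs_le.1 (hBq l hlK)).2
      have hlr : (l : ℝ) ≤ K := by exact_mod_cast hlK
      rcases le_total K i with hKi | hiK
      · have := slope_le (p := p) (α := α) (y := y) hKi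
          fun j hj hj' => hsl j (by omega) (by omega)
        have b2 := (abs_le.1 (hBq K le_rfl)).1
        have e : ((K : ℝ) - l) * y ≤ K := by nlinarith
        have e2 : q K - q i + ((i : ℝ) - K) * y ≤ 0 := by
          simp only [hq]; linarith
        linarith
      · have b2 := (abs_le.1 (hBq i hiK)).1
        have hir : (i : ℝ) ≤ K := by exact_mod_cast hiK
        have hlir : (l : ℝ) ≤ i := by exact_mod_cast hli
        have e : ((i : ℝ) - l) * y ≤ K := by nlinarith
        linarith
  simp only [hq] at key
  linarith

theorem exists_tail_const {p : ℕ → ℝ} {α : ℝ} (hα : 1 < α) {K : ℕ} (hK1 : 1 ≤ K) {b : ℕ → ℂ}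
    {C₀ : ℝ} (hC₀ : 0 < C₀) (hb : ∀ i, 1 ≤ i → ‖b i‖ ≤ C₀ * Real.exp (-p i)) :
    ∃ C : ℝ, 0 < C ∧ ∀ (N : ℕ) (y : ℝ), 0 ≤ y → y ≤ 1 → K ≤ N →
      (∀ i, K ≤ i → i < N → y ≤ logIncr p α i) → ∀ l : ℕ, 1 ≤ l →
        ∑ i ∈ Finset.Icc l N, ‖b i‖ * Real.exp (i * y) ≤
          C * (l : ℝ) ^ α * Real.exp (-p l + l * y) := by
  obtain ⟨C, hC, h1⟩ := exists_slope_const p α K hK1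
  have hs : Summable fun i : ℕ => (i : ℝ) ^ (-α) := Real.summable_nat_rpow.2 (by linarith)
  have hZ : 0 ≤ ∑' i : ℕ, (i : ℝ) ^ (-α) := tsum_nonneg fun i => by positivity
  refine ⟨C₀ * Real.exp C * (1 + ∑' i : ℕ, (i : ℝ) ^ (-α)), by positivity,
    fun N y hy0 hy1 hKN hsl l hl => ?_⟩
  have hl0 : (0 : ℝ) < l := by exact_mod_cast hl
  have hterm : ∀ i ∈ Finset.Icc l N, ‖b i‖ * Real.exp (i * y) ≤
      C₀ * Real.exp C * (l : ℝ) ^ α * Real.exp (-p l + l * y) * (i : ℝ) ^ (-α) := by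
    intro i hi
    obtain ⟨hli, hiN⟩ := Finset.mem_Icc.1 hi
    have hi0 : (0 : ℝ) < i := by exact_mod_cast (by omega : 0 < i)
    have h2 := h1 N y hy0 hy1 hKN hsl l i hl hli hiN
    calc ‖b i‖ * Real.exp (i * y) ≤ C₀ * Real.exp (-p i) * Real.exp (i * y) := by
          gcongr; exact hb i (by omega)
      _ = C₀ * Real.exp (-p i + i * y) := by rw [mul_assoc, ← Real.exp_add]
      _ ≤ C₀ * Real.exp (C + Real.log l * α + (-p l + l * y) + Real.log i * (-α)) := by
          refine mul_le_mul_of_nonneg_left (Real.exp_le_exp.2 ?_) hC₀.le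
          linarith
      _ = _ := by
          rw [Real.rpow_def_of_pos hl0, Real.rpow_def_of_pos hi0, Real.exp_add, Real.exp_add,
            Real.exp_add]
          ring
  refine (Finset.sum_le_sum hterm).trans ?_
  rw [← Finset.mul_sum]
  have h3 : ∑ i ∈ Finset.Icc l N, (i : ℝ) ^ (-α) ≤ 1 + ∑' i : ℕ, (i : ℝ) ^ (-α) :=
    (hs.sum_le_tsum _ fun i _ => by positivity).trans (by linarith)
  calc _ ≤ C₀ * Real.exp C * (l : ℝ) ^ α * Real.exp (-p l + l * y) *
        (1 + ∑' i : ℕ, (i : ℝ) ^ (-α)) := by gcongr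
    _ = _ := by ring

theorem tsum_exp_neg_le {x : ℝ} (hx : 0 < x) (hx1 : x ≤ 1) :
    Summable (fun r : ℕ => Real.exp (-(r * x))) ∧ ∑' r : ℕ, Real.exp (-(r * x)) ≤ 2 / x := by
  have e : (fun r : ℕ => Real.exp (-(r * x))) = fun r => (Real.exp (-x)) ^ r := by
    funext r; rw [← Real.exp_nat_mul]; congr 1; ring
  have h1 : Real.exp (-x) < 1 := by rw [Real.exp_lt_one_iff]; linarith
  rw [e]
  refine ⟨summable_geometric_of_lt_one (Real.exp_pos _).le h1, ?_⟩
  rw [tsum_geometric_of_lt_one (Real.exp_pos _).le h1]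
  have h2 : Real.exp (-x) ≤ 1 - x / 2 := by
    have h3 := Real.add_one_le_exp x
    have h4 : Real.exp (-x) ≤ (1 + x)⁻¹ := by
      rw [Real.exp_neg]
      exact inv_anti₀ (by positivity) (by linarith)
    refine h4.trans ?_
    rw [inv_le_iff_one_le_mul₀ (by positivity)]
    nlinarith
  rw [inv_eq_one_div, div_le_div_iff₀ (by linarith) hx]
  linarith

/-- The Laurent polynomial with analytic part, in the coordinate `λ = e ^ (-s)`. -/
def laur (c b : ℕ → ℂ) (N : ℕ) (s : ℂ) : ℂ :=
  ∑' r : ℕ, c r * Complex.exp (-(r * s)) + ∑ i ∈ Finset.Icc 1 N, b i * Complex.exp (i * s)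

namespace GoodWeight

variable {p : ℕ → ℝ} {α A : ℝ}

theorem summable_exp (h : GoodWeight p α A) {y : ℝ} (hy : 0 < y) :
    Summable fun r : ℕ => Real.exp (max (p r) 0) * Real.exp (-(r * y)) := by
  wlog hy1 : y ≤ 1 generalizing y
  · push Not at hy1
    refine Summable.of_nonneg_of_le (fun r => by positivity) (fun r => ?_) (this one_pos le_rfl)
    gcongr
  have h1 : ∀ᶠ r : ℕ in atTop, p r / r < y / 2 :=
    h.lim.eventually (gt_mem_nhds (by positivity))
  have h2 := (tsum_exp_neg_le (x := y / 2) (by positivity) (by linarith)).1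
  refine Summable.of_norm_bounded_eventually_nat h2 ?_
  filter_upwards [h1, eventually_ge_atTop 1] with r hr hr1
  have hr0 : (0 : ℝ) < r := by exact_mod_cast hr1
  rw [← Real.exp_add, Real.norm_of_nonneg (Real.exp_pos _).le]
  rw [div_lt_iff₀ hr0] at hr
  refine Real.exp_le_exp.2 ?_
  have : max (p r) 0 ≤ r * (y / 2) := max_le (by linarith) (by positivity)
  linarith

theorem summable_exp_div (h : GoodWeight p α A) {y : ℝ} (hy : 0 < y) :
    Summable fun r : ℕ => Real.exp (max (p r) 0 / 200) * Real.exp (-(r * y)) := by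
  refine Summable.of_nonneg_of_le (fun r => by positivity) (fun r => ?_) (h.summable_exp hy)
  gcongr
  have : 0 ≤ max (p r) 0 := le_max_right _ _
  linarith

theorem tsum_exp_div_le (h : GoodWeight p α A) (C₀ : ℝ) : ∃ β : ℝ, 1 < β ∧ β < 2 ∧
    ∀ᶠ j : ℕ in atTop, ∀ y : ℝ, dyad p j / 20 ≤ y → y ≤ 1 →
      C₀ * ∑' r : ℕ, Real.exp (max (p r) 0 / 200) * Real.exp (-(r * y)) ≤ Real.exp (β ^ j) := by
  obtain ⟨β, hβ1, hβ2, h1⟩ := h.le_five_mul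
  obtain ⟨C, hC, h2⟩ := h.abs_le_linear
  refine ⟨(β + 2) / 2, by linarith, by linarith, ?_⟩
  filter_upwards [h1, h.dyad_ge, eventually_linear_mul_pow_le hβ1.le
    (show β < (β + 2) / 2 by linarith) (C + |C₀| + 100)] with j hj hd hdom y hy hy1
  have h2j : (0 : ℝ) < 2 ^ j := by positivity
  have hdp : 0 < dyad p j := lt_of_lt_of_le (by positivity) hd
  have hy0 : 0 < y := by linarith
  have hβj : 1 ≤ β ^ j := one_le_pow₀ hβ1.le
  have hterm : ∀ r : ℕ, Real.exp (max (p r) 0 / 200) * Real.exp (-(r * y)) ≤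
      Real.exp (C + β ^ j) * Real.exp (-(r * (y / 2))) := by
    intro r
    rw [← Real.exp_add, ← Real.exp_add]
    refine Real.exp_le_exp.2 ?_
    have hr0 : (0 : ℝ) ≤ r := by positivity
    have hry : 0 ≤ (r : ℝ) * y := by positivity
    rcases le_total (β ^ j) r with hr | hr
    · have h3 := hj r hr
      have h4 : 5 * (r : ℝ) * dyad p j ≤ 100 * (r * y) := by nlinarith
      have : max (p r) 0 ≤ 100 * (r * y) := max_le (by linarith) (by positivity)
      linarith
    · have h3 := (le_abs_self _).trans (h2 r)
      have : max (p r) 0 ≤ C + β ^ j := max_le (by linarith) (by positivity)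
      linarith
  obtain ⟨hs, hsum⟩ := tsum_exp_neg_le (x := y / 2) (by positivity) (by linarith)
  have h5 : ∑' r : ℕ, Real.exp (max (p r) 0 / 200) * Real.exp (-(r * y)) ≤
      Real.exp (C + β ^ j) * (80 * 2 ^ j) := by
    calc _ ≤ ∑' r : ℕ, Real.exp (C + β ^ j) * Real.exp (-(r * (y / 2))) :=
          (h.summable_exp_div hy0).tsum_le_tsum hterm (hs.mul_left _)
      _ = Real.exp (C + β ^ j) * ∑' r : ℕ, Real.exp (-(r * (y / 2))) := tsum_mul_left
      _ ≤ Real.exp (C + β ^ j) * (2 / (y / 2)) := by gcongr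
      _ ≤ _ := by
        gcongr
        rw [div_le_iff₀ (by positivity)]
        have : 1 ≤ dyad p j * 2 ^ j := by rwa [div_le_iff₀ h2j] at hd
        nlinarith
  have h6 : C₀ ≤ Real.exp |C₀| := (le_abs_self _).trans (by linarith [Real.add_one_le_exp |C₀|])
  have h7 : (80 : ℝ) ≤ Real.exp 80 := by linarith [Real.add_one_le_exp (80 : ℝ)]
  have h8 : (2 : ℝ) ^ j ≤ Real.exp j := by
    rw [← mul_one (j : ℝ), Real.exp_nat_mul]
    gcongr
    linarith [Real.add_one_le_exp (1 : ℝ)]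
  calc _ ≤ Real.exp |C₀| * (Real.exp (C + β ^ j) * (Real.exp 80 * Real.exp j)) := by
        have h0 : 0 ≤ ∑' r : ℕ, Real.exp (max (p r) 0 / 200) * Real.exp (-(r * y)) :=
          tsum_nonneg fun r => by positivity
        refine mul_le_mul h6 (h5.trans ?_) h0 (Real.exp_pos _).le
        gcongr
    _ = Real.exp (|C₀| + (C + β ^ j + (80 + j))) := by simp only [Real.exp_add]
    _ ≤ _ := by
      refine Real.exp_le_exp.2 (le_trans ?_ hdom)
      have hj0 : (0 : ℝ) ≤ j := by positivity
      have : 0 ≤ |C₀| := abs_nonneg _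
      nlinarith [mul_nonneg hj0 (by linarith : (0 : ℝ) ≤ β ^ j)]

theorem le_logIncr_of_le_dyad (h : GoodWeight p α A) {K : ℕ}
    (hK : ∀ m n, K ≤ m → m ≤ n → logIncr p α n ≤ logIncr p α m) :
    ∀ᶠ j : ℕ in atTop, K ≤ 2 ^ j ∧ ∀ y, y ≤ dyad p j / 2 → ∀ i, K ≤ i → i ≤ 2 ^ j →
      y ≤ logIncr p α i := by
  filter_upwards [h.dyad_le_logIncr, eventually_ge_atTop K] with j hj hjK
  exact ⟨hjK.trans Nat.lt_two_pow_self.le, fun y hy i hi hi2 => (hy.trans hj).trans (hK _ _ hi hi2)⟩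

end GoodWeight

/-- The size conditions on the coefficients of a fixed element. -/
structure CoeffBound (p : ℕ → ℝ) (c b : ℕ → ℂ) (C₀ : ℝ) : Prop where
  pos : 0 < C₀
  c_le : ∀ r, ‖c r‖ ≤ C₀ * Real.exp (max (p r) 0 / 200)
  b_le : ∀ i, 1 ≤ i → ‖b i‖ ≤ C₀ * Real.exp (-p i)

namespace CoeffBound

variable {p : ℕ → ℝ} {α A : ℝ} {c b : ℕ → ℂ} {C₀ : ℝ}

theorem norm_term_le (H : CoeffBound p c b C₀) (s : ℂ) (r : ℕ) :
    ‖c r * Complex.exp (-(r * s))‖ ≤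
      C₀ * (Real.exp (max (p r) 0 / 200) * Real.exp (-(r * s.re))) := by
  rw [norm_mul, Complex.norm_exp, ← mul_assoc]
  have : (-((r : ℂ) * s)).re = -(r * s.re) := by simp
  rw [this]
  gcongr
  exact H.c_le r

theorem summable_norm (H : CoeffBound p c b C₀) (h : GoodWeight p α A) {s : ℂ} (hs : 0 < s.re) :
    Summable fun r : ℕ => ‖c r * Complex.exp (-(r * s))‖ :=
  Summable.of_nonneg_of_le (fun _ => norm_nonneg _) (H.norm_term_le s)
    ((h.summable_exp_div hs).mul_left _)

theorem norm_tsum_le (H : CoeffBound p c b C₀) (h : GoodWeight p α A) {s : ℂ} (hs : 0 < s.re) :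
    ‖∑' r : ℕ, c r * Complex.exp (-(r * s))‖ ≤
      C₀ * ∑' r : ℕ, Real.exp (max (p r) 0 / 200) * Real.exp (-(r * s.re)) := by
  rw [← tsum_mul_left]
  exact tsum_of_norm_bounded ((h.summable_exp_div hs).mul_left _).hasSum (H.norm_term_le s)

theorem differentiableOn_laur (H : CoeffBound p c b C₀) (h : GoodWeight p α A) (N : ℕ) :
    DifferentiableOn ℂ (laur c b N) {s | 0 < s.re} := by
  intro s hs
  have hs' : 0 < s.re := hs
  have hopen : IsOpen {w : ℂ | s.re / 2 < w.re} := isOpen_lt continuous_const Complex.continuous_re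
  have h1 : DifferentiableOn ℂ (fun s : ℂ => ∑' r : ℕ, c r * Complex.exp (-(r * s)))
      {w : ℂ | s.re / 2 < w.re} := by
    refine Complex.differentiableOn_tsum_of_summable_norm
      ((h.summable_exp_div (y := s.re / 2) (by positivity)).mul_left C₀)
      (fun r => by fun_prop) hopen fun r w hw => ?_
    refine (H.norm_term_le w r).trans ?_
    have := H.pos
    have hw' : s.re / 2 < w.re := hw
    gcongr
  have h2 : DifferentiableAt ℂ (fun s : ℂ => ∑' r : ℕ, c r * Complex.exp (-(r * s))) s :=
    h1.differentiableAt (hopen.mem_nhds (by change s.re / 2 < s.re; linarith))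
  have h3 : DifferentiableAt ℂ
      (fun s : ℂ => ∑ i ∈ Finset.Icc 1 N, b i * Complex.exp (i * s)) s := by fun_prop
  exact (h2.add h3).differentiableWithinAt

theorem norm_sum_le (b : ℕ → ℂ) (s : ℂ) (t : Finset ℕ) :
    ‖∑ i ∈ t, b i * Complex.exp (i * s)‖ ≤ ∑ i ∈ t, ‖b i‖ * Real.exp (i * s.re) := by
  refine (_root_.norm_sum_le _ _).trans (le_of_eq (Finset.sum_congr rfl fun i _ => ?_))
  rw [norm_mul, Complex.norm_exp]
  simp

theorem laur_sub (c b : ℕ → ℂ) {N N' : ℕ} (hN : N ≤ N') (s : ℂ) :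
    laur c b N' s - laur c b N s = ∑ i ∈ Finset.Icc (N + 1) N', b i * Complex.exp (i * s) := by
  unfold laur
  have : Finset.Icc 1 N' = Finset.Icc 1 N ∪ Finset.Icc (N + 1) N' := by
    ext i; simp; omega
  rw [this, Finset.sum_union]
  · ring
  · rw [Finset.disjoint_left]
    intro i hi; simp at hi ⊢; omega

theorem norm_laur_le (H : CoeffBound p c b C₀) (h : GoodWeight p α A) {K : ℕ} (hK : 1 ≤ K) :
    ∃ β : ℝ, 1 < β ∧ β < 2 ∧ ∀ᶠ j : ℕ in atTop, ∀ (N : ℕ) (s : ℂ), dyad p j / 20 ≤ s.re →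
      s.re ≤ 1 → K ≤ N → (∀ i, K ≤ i → i < N → s.re ≤ logIncr p α i) →
        ‖laur c b N s‖ ≤ Real.exp (β ^ j) := by
  obtain ⟨β, hβ1, hβ2, h1⟩ := h.tsum_exp_div_le C₀
  obtain ⟨C, hC, h2⟩ := exists_tail_const h.one_lt hK H.pos H.b_le
  set C' := C * Real.exp (-p 1 + 1) with hC'
  have hC'0 : 0 < C' := by positivity
  refine ⟨(β + 2) / 2, by linarith, by linarith, ?_⟩
  filter_upwards [h1, h.dyad_pos, eventually_linear_mul_pow_le hβ1.le
    (show β < (β + 2) / 2 by linarith) (C' + 1)] with j hj hd hdom N s hs1 hs2 hKN hsl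
  have hs0 : 0 < s.re := by linarith
  have hβj : 1 ≤ β ^ j := one_le_pow₀ hβ1.le
  have e1 := (H.norm_tsum_le h hs0).trans (hj _ hs1 hs2)
  have e2 : ‖∑ i ∈ Finset.Icc 1 N, b i * Complex.exp (i * s)‖ ≤ C' := by
    refine (norm_sum_le b s _).trans ((h2 N s.re hs0.le hs2 hKN hsl 1 le_rfl).trans ?_)
    simp only [Nat.cast_one, Real.one_rpow, mul_one, one_mul, hC']
    gcongr
  calc ‖laur c b N s‖ ≤ Real.exp (β ^ j) + C' := (norm_add_le _ _).trans (add_le_add e1 e2)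
    _ ≤ Real.exp (β ^ j) * (C' + 1) := by
      have : 1 ≤ Real.exp (β ^ j) := Real.one_le_exp (by linarith)
      nlinarith
    _ ≤ Real.exp (β ^ j) * Real.exp C' := by gcongr; exact Real.add_one_le_exp _
    _ = Real.exp (β ^ j + C') := (Real.exp_add _ _).symm
    _ ≤ _ := by
      refine Real.exp_le_exp.2 (le_trans ?_ hdom)
      have hj0 : (0 : ℝ) ≤ j := by positivity
      nlinarith [mul_nonneg hj0 (by linarith : (0 : ℝ) ≤ β ^ j), mul_nonneg
        (mul_nonneg hj0 (by linarith : (0 : ℝ) ≤ β ^ j)) hC'0.le]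

theorem norm_laur_sub_le (H : CoeffBound p c b C₀) (h : GoodWeight p α A) {K : ℕ} (hK : 1 ≤ K)
    {γ : ℝ} (hγ1 : 1 ≤ γ) (hγ2 : γ < 2) :
    ∀ᶠ j : ℕ in atTop, ∀ (N : ℕ) (s : ℂ), 0 ≤ s.re → s.re ≤ 3 / 10 * dyad p j → 2 ^ j ≤ N →
      (∀ i, K ≤ i → i < N → s.re ≤ logIncr p α i) →
        ‖laur c b N s - laur c b (2 ^ j) s‖ ≤ Real.exp (-γ ^ j) := by
  obtain ⟨C, hC, h2⟩ := exists_tail_const h.one_lt hK H.pos H.b_le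
  have hα := h.one_lt
  have hd1 : ∀ᶠ j : ℕ in atTop, dyad p j < 1 := h.dyad_tendsto.eventually (gt_mem_nhds one_pos)
  filter_upwards [hd1, eventually_ge_atTop K, eventually_linear_mul_pow_le hγ1
    (show γ < (γ + 2) / 2 by linarith) (2 * (C + α + 1)),
    h.dyad_lower (show 1 ≤ (γ + 2) / 2 by linarith) (by linarith)]
    with j hd hjK hdom hlow N s hs0 hs1 hN hsl
  have h2j : (0 : ℝ) < 2 ^ j := by positivity
  have hγj : 1 ≤ γ ^ j := one_le_pow₀ hγ1
  have hKN : K ≤ N := hjK.trans (Nat.lt_two_pow_self.le.trans hN)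
  have hpd : p (2 ^ j) = 2 ^ j * dyad p j := by unfold dyad; field_simp
  rw [laur_sub c b hN]
  refine (norm_sum_le b s _).trans ?_
  have e1 : ∑ i ∈ Finset.Icc (2 ^ j + 1) N, ‖b i‖ * Real.exp (i * s.re) ≤
      ∑ i ∈ Finset.Icc (2 ^ j) N, ‖b i‖ * Real.exp (i * s.re) :=
    Finset.sum_le_sum_of_subset_of_nonneg (Finset.Icc_subset_Icc_left (by omega))
      fun _ _ _ => by positivity
  have hp0 : 0 ≤ p (2 ^ j) := le_trans (by positivity) hlow
  have hs3 : s.re ≤ 1 := by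
    have : 0 ≤ dyad p j := by unfold dyad; positivity
    linarith
  refine (e1.trans (h2 N s.re hs0 hs3 hKN hsl (2 ^ j) Nat.one_le_two_pow)).trans ?_
  push_cast
  have e2 : ((2 : ℝ) ^ j) ^ α ≤ Real.exp (j * α) := by
    rw [Real.exp_mul]
    gcongr
    rw [← mul_one (j : ℝ), Real.exp_nat_mul]
    gcongr
    linarith [Real.add_one_le_exp (1 : ℝ)]
  calc _ ≤ Real.exp C * Real.exp (j * α) * Real.exp (-p (2 ^ j) + 2 ^ j * s.re) := by
        gcongr; linarith [Real.add_one_le_exp C]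
    _ = Real.exp (C + j * α + (-p (2 ^ j) + 2 ^ j * s.re)) := by simp only [Real.exp_add]
    _ ≤ _ := by
      refine Real.exp_le_exp.2 ?_
      have hj0 : (0 : ℝ) ≤ j := by positivity
      have e3 : 2 ^ j * s.re ≤ 3 / 10 * p (2 ^ j) := by rw [hpd]; nlinarith
      have e4 : C + j * α + γ ^ j ≤ (C + α + 1) * ((j : ℝ) + 1) * γ ^ j := by
        have a1 : 0 ≤ (j : ℝ) * α := by positivity
        have a2 : C ≤ C * γ ^ j := by nlinarith
        have a3 : j * α ≤ j * α * γ ^ j := by nlinarith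
        have a4 : 0 ≤ γ ^ j * (j * C + α + j) := by positivity
        nlinarith
      linarith

/-- Smallness of the Laurent sum on a disc whose size is the dyadic average. -/
def SmallAt (p : ℕ → ℝ) (c b : ℕ → ℂ) (β : ℝ) (j : ℕ) (x : ℝ) : Prop :=
  ∀ s ∈ closedBall ((dyad p j / 4 : ℝ) + x * Complex.I : ℂ) (dyad p j / 100),
    ‖laur c b (2 ^ j) s‖ ≤ Real.exp (-β ^ j)

theorem re_im_of_mem_closedBall {y x r : ℝ} {s : ℂ}
    (hs : s ∈ closedBall ((y : ℂ) + x * Complex.I) r) : |s.re - y| ≤ r ∧ |s.im - x| ≤ r := by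
  rw [mem_closedBall, dist_eq_norm] at hs
  have h1 := (Complex.abs_re_le_norm (s - (y + x * Complex.I))).trans hs
  have h2 := (Complex.abs_im_le_norm (s - (y + x * Complex.I))).trans hs
  simp at h1 h2
  exact ⟨h1, h2⟩

theorem mem_closedBall_of_re_im {y x r : ℝ} {s : ℂ} (h : |s.re - y| + |s.im - x| ≤ r) :
    s ∈ closedBall ((y : ℂ) + x * Complex.I) r := by
  rw [mem_closedBall, dist_eq_norm]
  refine (Complex.norm_le_abs_re_add_abs_im _).trans ?_
  simpa using h

theorem smallAt_step (H : CoeffBound p c b C₀) (h : GoodWeight p α A) {β₁ β : ℝ} {K : ℕ}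
    (hK : 1 ≤ K) (hKa : ∀ m n, K ≤ m → m ≤ n → logIncr p α n ≤ logIncr p α m)
    (hβ₁ : 1 < β₁) (hβ : β₁ ≤ β) (hβ32 : 3 / 2 ≤ β) (hβ2 : β < 2)
    (hle : ∀ᶠ j : ℕ in atTop, ∀ (N : ℕ) (s : ℂ), dyad p j / 20 ≤ s.re →
      s.re ≤ 1 → K ≤ N → (∀ i, K ≤ i → i < N → s.re ≤ logIncr p α i) →
        ‖laur c b N s‖ ≤ Real.exp (β₁ ^ j)) :
    ∀ᶠ j : ℕ in atTop, ∀ x x' : ℝ, |x' - x| ≤ dyad p (j + 1) / 2000 →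
      SmallAt p c b β (j + 1) x → SmallAt p c b β j x' := by
  have hd1 : ∀ᶠ j : ℕ in atTop, dyad p j < 1 := h.dyad_tendsto.eventually (gt_mem_nhds one_pos)
  have hβ1 : 1 < β := by linarith
  have hpow : ∀ᶠ j : ℕ in atTop, (10 : ℝ) ≤ β ^ j :=
    (tendsto_pow_atTop_atTop_of_one_lt hβ1).eventually_ge_atTop 10
  have hsl := h.le_logIncr_of_le_dyad hKa
  filter_upwards [hle, hd1, h.dyad_antitone, h.dyad_slow (show (0 : ℝ) < 1 / 1000 by norm_num),
    (tendsto_add_atTop_nat 1).eventually h.dyad_pos, hpow, hsl,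
    (tendsto_add_atTop_nat 1).eventually hsl,
    H.norm_laur_sub_le h hK (γ := (β + 2) / 2) (by linarith) (by linarith),
    eventually_linear_mul_pow_le hβ1.le (show β < (β + 2) / 2 by linarith) 2]
    with j hle hd1 hanti hslow hpos hpow hsl hsl' hjump hdom x x' hx hS
  set δ := dyad p (j + 1) with hδ
  set δ' := dyad p j with hδ'
  have hpowle : β₁ ^ j ≤ β ^ j := by gcongr
  have hreg : ∀ {s : ℂ}, s ∈ closedBall ((δ / 4 : ℝ) + x * Complex.I : ℂ) (2 * (δ / 100)) →
      23 / 100 * δ ≤ s.re ∧ s.re ≤ 27 / 100 * δ := fun {s} hs => by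
    have := abs_le.1 (re_im_of_mem_closedBall hs).1
    constructor <;> linarith [this.1, this.2]
  intro w hw
  have hball : w ∈ closedBall ((δ / 4 : ℝ) + x * Complex.I : ℂ) (11 / 10 * (δ / 100)) := by
    rw [mem_closedBall] at hw ⊢
    have e : dist ((δ' / 4 : ℝ) + x' * Complex.I : ℂ) ((δ / 4 : ℝ) + x * Complex.I : ℂ) ≤
        (δ' - δ) / 4 + δ / 2000 := by
      rw [dist_eq_norm]
      refine (Complex.norm_le_abs_re_add_abs_im _).trans ?_
      simp
      have : |δ' / 4 - δ / 4| ≤ (δ' - δ) / 4 := by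
        rw [abs_of_nonneg (by linarith)]; linarith
      linarith
    have := dist_triangle w ((δ' / 4 : ℝ) + x' * Complex.I : ℂ) ((δ / 4 : ℝ) + x * Complex.I : ℂ)
    linarith
  have key := norm_le_of_three_circles (f := laur c b (2 ^ j)) (ρ := δ / 100)
    (c := ((δ / 4 : ℝ) + x * Complex.I : ℂ)) (ε := 2 * Real.exp (-β ^ (j + 1)))
    (M := Real.exp (β₁ ^ j)) (by linarith) ?_ (by positivity) ?_ ?_ ?_ hball
  · refine key.trans ?_
    rw [Real.mul_rpow (by norm_num) (Real.exp_pos _).le, ← Real.exp_mul, ← Real.exp_mul]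
    have e2 : (2 : ℝ) ^ (17 / 20 : ℝ) ≤ Real.exp (17 / 20) := by
      calc (2 : ℝ) ^ (17 / 20 : ℝ) ≤ (Real.exp 1) ^ (17 / 20 : ℝ) := by
            gcongr; linarith [Real.add_one_le_exp (1 : ℝ)]
        _ = _ := by rw [← Real.exp_mul, one_mul]
    calc _ ≤ Real.exp (17 / 20) * Real.exp (-β ^ (j + 1) * (17 / 20)) *
          Real.exp (β₁ ^ j * (3 / 20)) := by gcongr
      _ = Real.exp (17 / 20 + -β ^ (j + 1) * (17 / 20) + β₁ ^ j * (3 / 20)) := by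
        simp only [Real.exp_add]
      _ ≤ _ := by
        refine Real.exp_le_exp.2 ?_
        rw [pow_succ]
        have : β ^ j * (3 / 2) ≤ β ^ j * β := by gcongr
        linarith
  · intro s hs
    have := hreg hs
    exact (H.differentiableOn_laur h (2 ^ j)).differentiableAt
      ((isOpen_lt continuous_const Complex.continuous_re).mem_nhds
        (by change 0 < s.re; linarith))
  · have e1 : 2 * Real.exp (-β ^ (j + 1)) ≤ 1 := by
      have : Real.exp (-β ^ (j + 1)) ≤ Real.exp (-1) :=
        Real.exp_le_exp.2 (neg_le_neg (one_le_pow₀ hβ1.le))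
      have h3 : Real.exp (-1) ≤ 1 / 2 := by
        rw [Real.exp_neg, inv_le_comm₀ (Real.exp_pos _) (by norm_num)]
        linarith [Real.add_one_le_exp (1 : ℝ)]
      linarith
    exact e1.trans (Real.one_le_exp (by positivity))
  · intro s hs
    have hs' := hreg (closedBall_subset_closedBall (by linarith) hs)
    have e1 := hS s hs
    have e2 := hjump (2 ^ (j + 1)) s (by linarith) (by linarith)
      (Nat.pow_le_pow_right (by norm_num) (by omega))
      fun i hi hi2 => hsl'.2 _ (by linarith) i hi hi2.le
    have e3 : Real.exp (-((β + 2) / 2) ^ j) ≤ Real.exp (-β ^ (j + 1)) := by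
      refine Real.exp_le_exp.2 (neg_le_neg (le_trans ?_ hdom))
      rw [pow_succ]
      have hj0 : (0 : ℝ) ≤ j := by positivity
      nlinarith [mul_nonneg hj0 (by linarith : (0 : ℝ) ≤ β ^ j)]
    have e4 : laur c b (2 ^ j) s = laur c b (2 ^ (j + 1)) s -
      (laur c b (2 ^ (j + 1)) s - laur c b (2 ^ j) s) := by ring
    rw [e4]
    refine (norm_sub_le _ _).trans ?_
    linarith
  · intro s hs
    have hs' := hreg hs
    exact hle _ s (by linarith) (by linarith) hsl.1
      fun i hi hi2 => hsl.2 _ (by linarith) i hi hi2.le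

theorem smallAt_propagate {β : ℝ} {j₁ : ℕ} (hpos : ∀ j, j₁ ≤ j → 0 < dyad p j)
    (hstep : ∀ j, j₁ ≤ j → ∀ x x' : ℝ, |x' - x| ≤ dyad p (j + 1) / 2000 →
      SmallAt p c b β (j + 1) x → SmallAt p c b β j x') (k : ℕ) :
    ∀ x x' : ℝ, |x' - x| ≤ ∑ i ∈ Finset.range k, dyad p (j₁ + i + 1) / 2000 →
      SmallAt p c b β (j₁ + k) x → SmallAt p c b β j₁ x' := by
  induction k with
  | zero =>
    intro x x' hx hS
    have : x' = x := by simpa [sub_eq_zero] using hx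
    simpa [this] using hS
  | succ k ih =>
    intro x x' hx hS
    set d := dyad p (j₁ + k + 1) / 2000 with hd
    have hd0 : 0 < d := div_pos (hpos _ (by omega)) (by norm_num)
    rw [Finset.sum_range_succ] at hx
    set R := ∑ i ∈ Finset.range k, dyad p (j₁ + i + 1) / 2000 with hR
    have hR0 : 0 ≤ R := Finset.sum_nonneg fun i _ =>
      div_nonneg (hpos _ (by omega)).le (by norm_num)
    obtain ⟨h1, h2⟩ := abs_le.1 hx
    refine ih (max (x - d) (min x' (x + d))) x' ?_ (hstep (j₁ + k) (by omega) x _ ?_ hS)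
    · rw [abs_le]
      have h3 : max (x - d) (min x' (x + d)) ≤ x' + R :=
        max_le (by linarith) ((min_le_left _ _).trans (by linarith))
      have h4 : x' - R ≤ max (x - d) (min x' (x + d)) :=
        (le_min (by linarith) (by linarith)).trans (le_max_right _ _)
      constructor <;> linarith
    · rw [abs_le]
      constructor
      · linarith [le_max_left (x - d) (min x' (x + d))]
      · have : max (x - d) (min x' (x + d)) ≤ x + d :=
          max_le (by linarith) (min_le_right _ _)
        linarith

theorem exists_not_smallAt (H : CoeffBound p c b C₀) (h : GoodWeight p α A) {β : ℝ} (hβ : 1 < β)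
    (hne : (∃ r, c r ≠ 0) ∨ ∃ i, 1 ≤ i ∧ b i ≠ 0) :
    ∀ᶠ j : ℕ in atTop, ∃ x ∈ Icc (-Real.pi) Real.pi, ¬ SmallAt p c b β j x := by
  have hd1 : ∀ᶠ j : ℕ in atTop, dyad p j < 1 := h.dyad_tendsto.eventually (gt_mem_nhds one_pos)
  have hlim : ∀ C : ℝ, 0 < C → ∀ r : ℝ, ∀ᶠ j : ℕ in atTop, Real.exp (r + -β ^ j) < C := by
    intro C hC r
    have h1 : Tendsto (fun j : ℕ => r + -β ^ j) atTop atBot :=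
      tendsto_atBot_add_const_left _ _
        (tendsto_neg_atTop_atBot.comp (tendsto_pow_atTop_atTop_of_one_lt hβ))
    exact (Real.tendsto_exp_atBot.comp h1).eventually (gt_mem_nhds hC)
  have key : ∀ᶠ j : ℕ in atTop, (∀ x ∈ Icc (-Real.pi) Real.pi, SmallAt p c b β j x) →
      (∀ r, ‖c r‖ ≤ Real.exp (r + -β ^ j)) ∧
      ∀ i, 1 ≤ i → i ≤ 2 ^ j → ‖b i‖ ≤ Real.exp (0 + -β ^ j) := by
    filter_upwards [hd1, h.dyad_pos] with j hd1 hpos hS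
    set N := 2 ^ j with hN
    set y := dyad p j / 4 with hy
    have hy0 : 0 < y := by positivity
    set a : ℕ → ℂ := fun k => if k < N then b (N - k) else c (k - N) with ha
    have hac : ∀ r, a (r + N) = c r := fun r => by simp [ha]
    have hab : ∀ i, 1 ≤ i → i ≤ N → a (N - i) = b i := fun i hi hiN => by
      have : N - i < N := by omega
      simp only [ha, this, if_true]
      congr 1
      omega
    have hsum : ∀ x : ℝ, Summable fun k => ‖a k * Complex.exp (-(k * ((y : ℂ) + x * Complex.I)))‖ := by
      intro x
      refine (summable_nat_add_iff N).1 ?_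
      have h1 := H.summable_norm h (s := (y : ℂ) + x * Complex.I) (by simpa using hy0)
      refine (h1.mul_left (Real.exp (-(N * y)))).congr fun r => ?_
      rw [hac, norm_mul, norm_mul, Complex.norm_exp, Complex.norm_exp, mul_left_comm,
        ← Real.exp_add]
      congr 2
      simp
      ring
    have heq : ∀ x : ℝ, ∑' k, a k * Complex.exp (-(k * ((y : ℂ) + x * Complex.I))) =
        Complex.exp (-(N * ((y : ℂ) + x * Complex.I))) * laur c b N (y + x * Complex.I) := by
      intro x
      rw [← (hsum x).of_norm.sum_add_tsum_nat_add N, laur, mul_add, ← tsum_mul_left,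
        Finset.mul_sum, add_comm]
      congr 1
      · refine tsum_congr fun r => ?_
        rw [hac, mul_left_comm, ← Complex.exp_add]
        congr 2
        push_cast
        ring
      · refine Finset.sum_bij' (fun k _ => N - k) (fun i _ => N - i) ?_ ?_ ?_ ?_ ?_
        · intro k hk; simp at hk ⊢; omega
        · intro k hk; simp at hk ⊢; omega
        · intro k hk; simp at hk ⊢; omega
        · intro k hk; simp at hk ⊢; omega
        · intro k hk
          have hk : k < N := by simpa using hk
          simp only [ha, hk, if_true]
          rw [mul_left_comm, ← Complex.exp_add]
          congr 2
          push_cast [hk.le]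
          ring
    have hcoef := norm_coeff_le_of_norm_tsum_le (a := a) (y := y)
      (M := Real.exp (-(N * y) + -β ^ j)) ?_ ?_
    · constructor
      · intro r
        have h1 := hcoef (r + N)
        rw [hac, ← le_div_iff₀ (Real.exp_pos _), ← Real.exp_sub] at h1
        refine h1.trans (Real.exp_le_exp.2 ?_)
        push_cast
        have hr : (0 : ℝ) ≤ r := by positivity
        have : (r : ℝ) * y ≤ r * 1 := by gcongr; linarith
        linarith
      · intro i hi hiN
        have h1 := hcoef (N - i)
        rw [hab i hi hiN, ← le_div_iff₀ (Real.exp_pos _), ← Real.exp_sub] at h1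
        refine h1.trans (Real.exp_le_exp.2 ?_)
        rw [Nat.cast_sub hiN]
        have hr : (0 : ℝ) ≤ i * y := by positivity
        linarith
    · refine (hsum 0).congr fun k => ?_
      rw [norm_mul, Complex.norm_exp]
      simp
    · intro x hx
      rw [heq x, norm_mul, Complex.norm_exp, Real.exp_add]
      have h1 := hS x hx ((y : ℂ) + x * Complex.I) (mem_closedBall_self (by positivity))
      have h2 : (-((N : ℂ) * ((y : ℂ) + x * Complex.I))).re = -(N * y) := by simp
      rw [h2]
      gcongr
  rcases hne with ⟨r, hr⟩ | ⟨i, hi, hb⟩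
  · filter_upwards [key, hlim ‖c r‖ (norm_pos_iff.2 hr) r] with j hj hl
    by_contra! hcon
    exact absurd ((hj hcon).1 r) (not_le.2 hl)
  · filter_upwards [key, hlim ‖b i‖ (norm_pos_iff.2 hb) 0, eventually_ge_atTop i] with j hj hl hij
    by_contra! hcon
    exact absurd ((hj hcon).2 i hi (hij.trans Nat.lt_two_pow_self.le)) (not_le.2 hl)

theorem eventually_not_smallAt (H : CoeffBound p c b C₀) (h : GoodWeight p α A)
    (hne : (∃ r, c r ≠ 0) ∨ ∃ i, 1 ≤ i ∧ b i ≠ 0) {β₁ β : ℝ} {K : ℕ}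
    (hK : 1 ≤ K) (hKa : ∀ m n, K ≤ m → m ≤ n → logIncr p α n ≤ logIncr p α m)
    (hβ₁ : 1 < β₁) (hβ : β₁ ≤ β) (hβ32 : 3 / 2 ≤ β) (hβ2 : β < 2)
    (hle : ∀ᶠ j : ℕ in atTop, ∀ (N : ℕ) (s : ℂ), dyad p j / 20 ≤ s.re →
      s.re ≤ 1 → K ≤ N → (∀ i, K ≤ i → i < N → s.re ≤ logIncr p α i) →
        ‖laur c b N s‖ ≤ Real.exp (β₁ ^ j)) :
    ∀ᶠ j : ℕ in atTop, ∀ x : ℝ, |x| ≤ 5 → ¬ SmallAt p c b β j x := by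
  have hstep := H.smallAt_step h hK hKa hβ₁ hβ hβ32 hβ2 hle
  obtain ⟨j₁, hj₁⟩ := eventually_atTop.1 ((hstep.and h.dyad_pos).and
    (H.exists_not_smallAt h (show 1 < β by linarith) hne))
  have hdiv : Tendsto (fun k => ∑ i ∈ Finset.range k, dyad p (j₁ + i + 1) / 2000) atTop atTop := by
    refine (not_summable_iff_tendsto_nat_atTop_of_nonneg fun i =>
      div_nonneg (hj₁ _ (by omega)).1.2.le (by norm_num)).1 fun hs => h.dyad_not_summable ?_
    refine (summable_nat_add_iff (j₁ + 1)).1 ((hs.mul_right 2000).congr fun i => ?_)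
    rw [div_mul_cancel₀ _ (by norm_num)]
    congr 1
    omega
  obtain ⟨k₀, hk₀⟩ := eventually_atTop.1 (hdiv.eventually_ge_atTop 10)
  filter_upwards [eventually_ge_atTop (j₁ + k₀)] with j hj x hx hS
  obtain ⟨k, rfl⟩ := Nat.exists_eq_add_of_le (show j₁ ≤ j by omega)
  obtain ⟨x', hx', hnot⟩ := (hj₁ j₁ le_rfl).2
  refine hnot (smallAt_propagate (fun j hj => (hj₁ j hj).1.2) (fun j hj => (hj₁ j hj).1.1) k x x'
    ?_ hS)
  refine le_trans ?_ (hk₀ k (by omega))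
  have hpi := Real.pi_lt_four
  rw [abs_le] at hx ⊢
  constructor <;> linarith [hx'.1, hx'.2]

theorem two_pow_le_exp (j : ℕ) : (2 : ℝ) ^ j ≤ Real.exp j := by
  rw [← mul_one (j : ℝ), Real.exp_nat_mul]
  gcongr
  linarith [Real.add_one_le_exp (1 : ℝ)]

set_option maxHeartbeats 1000000 in
theorem exists_lower_interval (H : CoeffBound p c b C₀) (h : GoodWeight p α A)
    (hne : (∃ r, c r ≠ 0) ∨ ∃ i, 1 ≤ i ∧ b i ≠ 0) {K : ℕ}
    (hK : 1 ≤ K) (hKa : ∀ m n, K ≤ m → m ≤ n → logIncr p α n ≤ logIncr p α m) :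
    ∃ γ : ℝ, 1 < γ ∧ γ < 2 ∧ ∀ᶠ j : ℕ in atTop, ∃ u v : ℝ, dyad p j / 4 ≤ u ∧
      v ≤ 26 / 100 * dyad p j ∧ Real.exp (-γ ^ j) ≤ v - u ∧
      ∀ s : ℂ, u ≤ s.re → s.re ≤ v → |s.im| ≤ Real.pi →
        Real.exp (-γ ^ j) ≤ ‖laur c b (2 ^ j) s‖ := by
  obtain ⟨β₁, hβ₁, hβ₁2, hle⟩ := H.norm_laur_le h hK
  obtain ⟨β, hβ, hβ32, hβ2⟩ : ∃ β, β₁ ≤ β ∧ 3 / 2 ≤ β ∧ β < 2 :=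
    ⟨max β₁ (3 / 2), le_max_left _ _, le_max_right _ _, max_lt hβ₁2 (by norm_num)⟩
  have hβ1 : 1 < β := by linarith
  have hd1 : ∀ᶠ j : ℕ in atTop, dyad p j < 1 := h.dyad_tendsto.eventually (gt_mem_nhds one_pos)
  refine ⟨(β + 2) / 2, by linarith, by linarith, ?_⟩
  filter_upwards [hle, H.eventually_not_smallAt h hne hK hKa hβ₁ hβ hβ32 hβ2 hle, hd1, h.dyad_ge,
    h.le_logIncr_of_le_dyad hKa, eventually_linear_mul_pow_le hβ1.le
      (show β < (β + 2) / 2 by linarith) 200] with j hle hns hd1 hdge hsl hdom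
  set δ := dyad p j with hδ
  have h2j : (0 : ℝ) < 2 ^ j := by positivity
  have hδ0 : 0 < δ := lt_of_lt_of_le (by positivity) hdge
  have hδinv : 1 ≤ δ * 2 ^ j := by rwa [div_le_iff₀ h2j] at hdge
  have hβj : 1 ≤ β ^ j := one_le_pow₀ hβ1.le
  have hβ₁j : β₁ ^ j ≤ β ^ j := by gcongr
  have hβ₁j1 : 1 ≤ β₁ ^ j := one_le_pow₀ hβ₁.le
  have hj0 : (0 : ℝ) ≤ j := by positivity
  set m := Real.exp (-β ^ j) with hm
  set M := Real.exp (β₁ ^ j) with hM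
  set n := ⌈4 * β ^ j⌉₊ + 1 with hn
  have hnle : (n : ℝ) ≤ 6 * β ^ j := by
    have := Nat.ceil_lt_add_one (show 0 ≤ 4 * β ^ j by positivity)
    rw [hn]; push_cast; linarith
  have hnge : 4 * β ^ j + 1 ≤ n := by
    have := Nat.le_ceil (4 * β ^ j)
    rw [hn]; push_cast; linarith
  have hMm : M < m * (5 / 2) ^ n := by
    have e1 : Real.exp ((n : ℝ) * (1 / 2)) ≤ (5 / 2 : ℝ) ^ n := by
      rw [Real.exp_nat_mul]
      gcongr
      have e0 : Real.exp (1 / 2) * Real.exp (1 / 2) = Real.exp 1 := by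
        rw [← Real.exp_add]; norm_num
      have e3 := Real.exp_one_lt_d9
      nlinarith [Real.exp_pos (1 / 2)]
    calc M < Real.exp (-β ^ j + n * (1 / 2)) := Real.exp_lt_exp.2 (by linarith)
      _ = m * Real.exp ((n : ℝ) * (1 / 2)) := Real.exp_add _ _
      _ ≤ _ := by gcongr
  set Q := ⌈800 / δ⌉₊ + 1 with hQ
  have hQle : (Q : ℝ) ≤ 802 * 2 ^ j := by
    have h1 := Nat.ceil_lt_add_one (show 0 ≤ 800 / δ by positivity)
    have h2 : 800 / δ ≤ 800 * 2 ^ j := by rw [div_le_iff₀ hδ0]; nlinarith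
    have h3 : (1 : ℝ) ≤ 2 ^ j := one_le_pow₀ (by norm_num)
    rw [hQ]; push_cast; linarith
  have hz : ∀ k : ℕ, k < Q → ∃ Z : Finset ℂ, Z.card ≤ n ∧
      ∀ w ∈ closedBall ((δ / 4 : ℝ) + (-4 + k * (δ / 100) : ℝ) * Complex.I : ℂ) (2 / 5 * (δ / 20)),
        ∀ D, 0 < D → D ≤ 2 * (δ / 20) → (∀ u ∈ Z, D ≤ ‖w - u‖) →
          m * (m / (2 * M)) ^ 6 * (D / (2 * (δ / 20))) ^ n ≤ ‖laur c b (2 ^ j) w‖ := by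
    intro k hk
    set x : ℝ := -4 + k * (δ / 100) with hx
    have hxle : |x| ≤ 5 := by
      have h1 := Nat.ceil_lt_add_one (show 0 ≤ 800 / δ by positivity)
      have h2 : (k : ℝ) ≤ ⌈800 / δ⌉₊ := by exact_mod_cast (by omega)
      have h3 : (k : ℝ) * (δ / 100) ≤ (800 / δ + 1) * (δ / 100) := by gcongr; linarith
      have h4 : (800 / δ + 1) * (δ / 100) = 8 + δ / 100 := by field_simp; ring
      have h5 : 0 ≤ (k : ℝ) * (δ / 100) := by positivity
      rw [abs_le]; constructor <;> linarith
    have h1 := hns x hxle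
    unfold SmallAt at h1
    push Not at h1
    obtain ⟨w₁, hw₁, hw₁'⟩ := h1
    have hreg : ∀ s ∈ closedBall ((δ / 4 : ℝ) + x * Complex.I : ℂ) (4 * (δ / 20)),
        δ / 20 ≤ s.re ∧ s.re ≤ 45 / 100 * δ := fun s hs => by
      have := abs_le.1 (re_im_of_mem_closedBall hs).1
      constructor <;> linarith [this.1, this.2]
    refine exists_finset_norm_ge (r := δ / 20) (w₁ := w₁) (by positivity)
      (isOpen_lt continuous_const Complex.continuous_re) (fun s hs => ?_) ?_ n _ M m
      (H.differentiableOn_laur h _) (Real.exp_pos _) (fun s hs => ?_) hw₁'.le hMm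
    · change 0 < s.re
      linarith [(hreg s hs).1]
    · rw [mem_closedBall, dist_eq_norm] at hw₁
      refine hw₁.trans (by linarith)
    · have := hreg s hs
      exact hle _ s this.1 (by linarith) hsl.1 fun i hi hi2 => hsl.2 _ (by linarith) i hi hi2.le
  choose! Z hZc hZ using hz
  set ZR : Finset ℝ := (Finset.range Q).biUnion fun k => (Z k).image Complex.re with hZR
  have hZRc : ZR.card ≤ Q * n := by
    refine Finset.card_biUnion_le.trans ((Finset.sum_le_card_nsmul _ _ n fun k hk =>
      Finset.card_image_le.trans (hZc k (Finset.mem_range.1 hk))).trans ?_)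
    simp
  obtain ⟨u, hu1, hu2, hu3⟩ := exists_gap (a := δ / 4) (H := δ / 100) (by positivity) ZR hZRc
  set D := δ / 100 / (3 * (((Q * n : ℕ) : ℝ) + 1)) with hD
  have hD0 : 0 < D := by positivity
  have hDle : D ≤ δ / 100 := div_le_self (by positivity) (by
    have : (0 : ℝ) ≤ ((Q * n : ℕ) : ℝ) := by positivity
    linarith)
  have hDge : Real.exp (-(15 + 4 * j)) ≤ D := by
    have e1 : (1445400 : ℝ) ≤ Real.exp 15 := by
      have : (2.7 : ℝ) ^ 15 ≤ Real.exp 15 := by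
        rw [show (15 : ℝ) = (15 : ℕ) * 1 by norm_num, Real.exp_nat_mul]
        gcongr
        linarith [Real.exp_one_gt_d9]
      refine le_trans ?_ this
      norm_num
    have e2 : 3 * (((Q * n : ℕ) : ℝ) + 1) ≤ 14454 * (2 ^ j * 2 ^ j) := by
      have h3 : (1 : ℝ) ≤ 2 ^ j := one_le_pow₀ (by norm_num)
      have h4 : β ^ j ≤ 2 ^ j := by gcongr
      have h5 : (Q : ℝ) * n ≤ (802 * 2 ^ j) * (6 * 2 ^ j) := by
        gcongr
        linarith
      push_cast
      nlinarith
    rw [Real.exp_neg, hD, inv_eq_one_div, div_le_div_iff₀ (Real.exp_pos _) (by positivity)]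
    have e3 := two_pow_le_exp j
    have e4 : Real.exp (15 + 4 * j) =
        Real.exp 15 * (Real.exp j * Real.exp j * Real.exp j * Real.exp j) := by
      simp only [← Real.exp_add]; congr 1; ring
    rw [e4]
    calc 1 * (3 * (((Q * n : ℕ) : ℝ) + 1)) ≤ 14454 * (2 ^ j * 2 ^ j) := by linarith
      _ ≤ 14454 * (2 ^ j * 2 ^ j) * (δ * 2 ^ j) := le_mul_of_one_le_right (by positivity) hδinv
      _ = δ / 100 * (1445400 * (2 ^ j * 2 ^ j * 2 ^ j * 1)) := by ring
      _ ≤ δ / 100 * (Real.exp 15 * (Real.exp j * Real.exp j * Real.exp j * Real.exp j)) := by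
        gcongr
        exact Real.one_le_exp hj0
  have hfin : 109 * ((j : ℝ) + 1) * β ^ j ≤ ((β + 2) / 2) ^ j := by
    refine le_trans ?_ hdom
    gcongr
    norm_num
  refine ⟨u, u + D, hu1, by linarith, ?_, ?_⟩
  · rw [add_sub_cancel_left]
    refine le_trans (Real.exp_le_exp.2 (neg_le_neg (le_trans ?_ hfin))) hDge
    calc 15 + 4 * (j : ℝ) ≤ 109 * ((j : ℝ) + 1) * 1 := by linarith
      _ ≤ _ := by gcongr
  · intro s hs1 hs2 hs3
    set k := ⌊(s.im + 4) / (δ / 100)⌋₊ with hk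
    have hpi := Real.pi_lt_four
    have him := abs_le.1 hs3
    have hnn : 0 ≤ (s.im + 4) / (δ / 100) := div_nonneg (by linarith) (by positivity)
    have k1 := Nat.floor_le hnn
    have k2 := Nat.lt_floor_add_one ((s.im + 4) / (δ / 100))
    rw [← hk] at k1 k2
    rw [le_div_iff₀ (by positivity)] at k1
    rw [div_lt_iff₀ (by positivity)] at k2
    have hkQ : k < Q := by
      have : (k : ℝ) ≤ 800 / δ := by rw [le_div_iff₀ hδ0]; linarith
      have := this.trans (Nat.le_ceil _)
      have : k ≤ ⌈800 / δ⌉₊ := by exact_mod_cast this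
      omega
    have h1 := hZ k hkQ s ?_ D hD0 (by linarith) ?_
    · refine le_trans ?_ h1
      have e1 : Real.exp (-(15 + 4 * j)) ≤ D / (2 * (δ / 20)) := by
        refine hDge.trans ?_
        rw [le_div_iff₀ (by positivity)]
        exact mul_le_of_le_one_right hD0.le (by linarith)
      have e2 : Real.exp (-(1 + 2 * β ^ j)) ≤ m / (2 * M) := by
        rw [le_div_iff₀ (by positivity), hm, hM]
        calc _ ≤ Real.exp (-(1 + 2 * β ^ j)) * (Real.exp 1 * Real.exp (β₁ ^ j)) := by
              gcongr; linarith [Real.add_one_le_exp (1 : ℝ)]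
          _ = Real.exp (-(1 + 2 * β ^ j) + (1 + β₁ ^ j)) := by simp only [Real.exp_add]
          _ ≤ _ := Real.exp_le_exp.2 (by linarith)
      calc Real.exp (-((β + 2) / 2) ^ j) ≤
          Real.exp (-β ^ j + (6 * (-(1 + 2 * β ^ j)) + n * (-(15 + 4 * j)))) := by
            refine Real.exp_le_exp.2 ?_
            have : (n : ℝ) * (15 + 4 * j) ≤ 6 * β ^ j * (15 + 4 * j) := by gcongr
            nlinarith [mul_nonneg hj0 (by linarith : (0 : ℝ) ≤ β ^ j)]
        _ = m * (Real.exp (-(1 + 2 * β ^ j)) ^ 6 * Real.exp (-(15 + 4 * j)) ^ n) := by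
            rw [Real.exp_add, Real.exp_add, ← Real.exp_nat_mul, ← Real.exp_nat_mul]
            norm_num [hm]
        _ ≤ m * ((m / (2 * M)) ^ 6 * (D / (2 * (δ / 20))) ^ n) := by gcongr
        _ = _ := by ring
    · refine mem_closedBall_of_re_im ?_
      have a1 : |s.re - δ / 4| ≤ δ / 100 := by rw [abs_le]; constructor <;> linarith
      have a2 : |s.im - (-4 + k * (δ / 100))| ≤ δ / 100 := by
        rw [abs_le]; constructor <;> linarith
      linarith
    · intro z hz
      have h2 := hu3 s.re ⟨hs1, hs2⟩ z.re (by
        rw [hZR, Finset.mem_biUnion]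
        exact ⟨k, Finset.mem_range.2 hkQ, Finset.mem_image_of_mem _ hz⟩)
      refine h2.trans ?_
      simpa using Complex.abs_re_le_norm (s - z)

theorem _root_.GoodWeight.exists_logIncr_le (h : GoodWeight p α A) {y : ℝ} (hy : 0 < y) (m : ℕ) :
    ∃ n, m ≤ n ∧ logIncr p α n ≤ y := by
  by_contra! hcon
  obtain ⟨n, hn1, hn2, hn3⟩ := ((h.lim.eventually (gt_mem_nhds (show (0 : ℝ) < y / 2 by positivity))).and
    ((eventually_ge_atTop (max m 1 + 1)).and
      (tendsto_natCast_atTop_atTop.eventually_ge_atTop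
        ((2 * ((max m 1 : ℕ) * y + |p (max m 1)|)) / y)))).exists
  have hm : max m 1 ≤ n := by omega
  have h1 := slope_le (p := p) (α := α) (y := y) hm
    fun i hi _ => (hcon i ((le_max_left _ _).trans hi)).le
  have hm0 : (0 : ℝ) < (max m 1 : ℕ) := by exact_mod_cast (by omega)
  have hn0 : (0 : ℝ) < n := by exact_mod_cast (by omega)
  have hlog : Real.log (max m 1 : ℕ) ≤ Real.log n :=
    Real.log_le_log hm0 (by exact_mod_cast hm)
  have hα := h.one_lt
  rw [div_lt_iff₀ hn0] at hn1
  rw [div_le_iff₀ hy] at hn3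
  have h2 := neg_abs_le (p (max m 1))
  nlinarith

theorem exists_good_interval (H : CoeffBound p c b C₀) (h : GoodWeight p α A)
    (hne : (∃ r, c r ≠ 0) ∨ ∃ i, 1 ≤ i ∧ b i ≠ 0) {K : ℕ}
    (hK : 1 ≤ K) (hKa : ∀ m n, K ≤ m → m ≤ n → logIncr p α n ≤ logIncr p α m) :
    ∃ γ : ℝ, 1 < γ ∧ γ < 2 ∧ ∀ᶠ j : ℕ in atTop, ∃ u v : ℝ, dyad p j / 4 ≤ u ∧
      v ≤ 26 / 100 * dyad p j ∧ Real.exp (-γ ^ j) ≤ v - u ∧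
      ∀ y ∈ Icc u v, C₀ * ∑' r : ℕ, Real.exp (max (p r) 0 / 200) * Real.exp (-(r * y)) ≤
          Real.exp (γ ^ j) ∧
        ∃ N, K ≤ N ∧ (∀ i, K ≤ i → i < N → y ≤ logIncr p α i) ∧
          (∀ i, N ≤ i → logIncr p α i ≤ y) ∧
          ∀ x ∈ Icc (-Real.pi) Real.pi, Real.exp (-γ ^ j) ≤ ‖laur c b N (y + x * Complex.I)‖ := by
  obtain ⟨β, hβ1, hβ2, h1⟩ := h.tsum_exp_div_le C₀
  obtain ⟨β', hβ'1, hβ'2, h2⟩ := H.exists_lower_interval h hne hK hKa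
  set B := max β β' with hB
  have hB1 : 1 < B := lt_max_of_lt_left hβ1
  have hB2 : B < 2 := max_lt hβ2 hβ'2
  have hd1 : ∀ᶠ j : ℕ in atTop, dyad p j < 1 := h.dyad_tendsto.eventually (gt_mem_nhds one_pos)
  refine ⟨(B + 2) / 2, by linarith, by linarith, ?_⟩
  filter_upwards [h1, h2, hd1, h.dyad_pos, h.le_logIncr_of_le_dyad hKa,
    H.norm_laur_sub_le h hK (γ := (B + 2) / 2) (by linarith) (by linarith),
    eventually_linear_mul_pow_le hB1.le (show B < (B + 2) / 2 by linarith) 2]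
    with j h1 ⟨u, v, hu, hv, huv, hlow⟩ hd1 hpos hsl hjump hdom
  have hb : β ^ j ≤ B ^ j := by gcongr; exact le_max_left _ _
  have hb' : β' ^ j ≤ B ^ j := by gcongr; exact le_max_right _ _
  have hBj : 1 ≤ B ^ j := one_le_pow₀ hB1.le
  have hj0 : (0 : ℝ) ≤ j := by positivity
  have hdom' : 1 + B ^ j ≤ ((B + 2) / 2) ^ j := by
    nlinarith [mul_nonneg hj0 (by linarith : (0 : ℝ) ≤ B ^ j)]
  refine ⟨u, v, hu, hv, le_trans (Real.exp_le_exp.2 (by linarith)) huv, fun y hy => ⟨?_, ?_⟩⟩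
  · exact (h1 y (by linarith [hy.1]) (by linarith [hy.2])).trans (Real.exp_le_exp.2 (by linarith))
  have hy0 : 0 < y := by linarith [hy.1]
  have hex := h.exists_logIncr_le hy0 (2 ^ j)
  set N := Nat.find hex with hN
  obtain ⟨hN1, hN2⟩ := Nat.find_spec hex
  have hslN : ∀ i, K ≤ i → i < N → y ≤ logIncr p α i := by
    intro i hi hiN
    rcases le_total i (2 ^ j) with hij | hij
    · exact hsl.2 y (by linarith [hy.2]) i hi hij
    · have := Nat.find_min hex hiN
      push Not at this
      exact (this hij).le
  refine ⟨N, hsl.1.trans hN1, hslN, fun i hi => (hKa N i (hsl.1.trans hN1) hi).trans hN2,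
    fun x hx => ?_⟩
  set s : ℂ := y + x * Complex.I with hs
  have hre : s.re = y := by simp [hs]
  have him : s.im = x := by simp [hs]
  have e1 := hlow s (by rw [hre]; exact hy.1) (by rw [hre]; exact hy.2)
    (by rw [him]; exact abs_le.2 hx)
  have e2 := hjump N s (by rw [hre]; exact hy0.le) (by rw [hre]; linarith [hy.2]) hN1
    (by rw [hre]; exact hslN)
  have e3 : ‖laur c b (2 ^ j) s‖ ≤ ‖laur c b N s‖ + ‖laur c b N s - laur c b (2 ^ j) s‖ := by
    have := norm_sub_le (laur c b N s) (laur c b N s - laur c b (2 ^ j) s)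
    rwa [sub_sub_cancel] at this
  have e4 : 2 * Real.exp (-((B + 2) / 2) ^ j) ≤ Real.exp (-β' ^ j) := by
    calc _ ≤ Real.exp 1 * Real.exp (-((B + 2) / 2) ^ j) := by
          gcongr; linarith [Real.add_one_le_exp (1 : ℝ)]
      _ = Real.exp (1 + -((B + 2) / 2) ^ j) := (Real.exp_add _ _).symm
      _ ≤ _ := Real.exp_le_exp.2 (by linarith)
  linarith

end CoeffBound

theorem tsum_le_of_two_bounds {f : ℕ → ℝ} {C α L h : ℝ} (hf : ∀ m, 0 ≤ f m) (hC : 0 ≤ C)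
    (hα : 0 ≤ α) (hL : 0 ≤ L) (hh : 0 < h) (hh1 : h ≤ 1)
    (h1 : ∀ m : ℕ, f m ≤ C * (1 + (m : ℝ)) ^ α) (h2 : ∀ m : ℕ, f m ≤ Real.exp (L - m * h)) :
    Summable f ∧ ∑' m, f m ≤ C * (L / h + 2) ^ (α + 1) + 2 / h := by
  obtain ⟨hs, hsum⟩ := tsum_exp_neg_le hh hh1
  set m₀ := ⌈L / h⌉₊ with hm₀
  have e1 : L ≤ m₀ * h := by
    have := Nat.le_ceil (L / h)
    rwa [div_le_iff₀ hh] at this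
  have e2 : (m₀ : ℝ) ≤ L / h + 2 := by
    have := Nat.ceil_lt_add_one (div_nonneg hL hh.le)
    linarith
  have htail : ∀ k : ℕ, f (k + m₀) ≤ Real.exp (-(k * h)) := fun k => by
    refine (h2 _).trans (Real.exp_le_exp.2 ?_)
    push_cast
    linarith
  have hst : Summable fun k => f (k + m₀) := Summable.of_nonneg_of_le (fun k => hf _) htail hs
  have hsf : Summable f := (summable_nat_add_iff m₀).1 hst
  refine ⟨hsf, ?_⟩
  rw [← hsf.sum_add_tsum_nat_add m₀]
  refine add_le_add ?_ ((hst.tsum_le_tsum htail hs).trans hsum)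
  have hb0 : 0 < L / h + 2 := by positivity
  calc ∑ i ∈ Finset.range m₀, f i ≤ ∑ i ∈ Finset.range m₀, C * (L / h + 2) ^ α := by
        refine Finset.sum_le_sum fun i hi => (h1 i).trans ?_
        have : (1 : ℝ) + i ≤ m₀ := by exact_mod_cast (by have := Finset.mem_range.1 hi; omega)
        exact mul_le_mul_of_nonneg_left
          (Real.rpow_le_rpow (by positivity) (this.trans e2) hα) hC
    _ = m₀ * (C * (L / h + 2) ^ α) := by simp
    _ ≤ (L / h + 2) * (C * (L / h + 2) ^ α) := by gcongr
    _ = _ := by rw [Real.rpow_add_one hb0.ne']; ring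

/-- The relations satisfied by the coefficient sequence of a functional annihilating all
left translates of an element with coefficients `c`, `b`. -/
structure Annih (p : ℕ → ℝ) (c b : ℕ → ℂ) (C₀ : ℝ) (G ε : ℕ → ℂ) : Prop where
  G_zero : G 0 = 0
  G_le : ∀ l, 1 ≤ l → ‖G l‖ ≤ Real.exp (p l)
  ε_le : ∀ m, ‖ε m‖ ≤ C₀ * Real.exp (max (p m) 0 / 200)
  x_le : ∀ (m N : ℕ) (B : ℝ), 0 ≤ B → (∀ i, N < i → Real.exp (p (i + m)) ≤ B * Real.exp (p i)) →
    ‖ε m + ∑ r ∈ Finset.range m, c r * G (m - r) + ∑ i ∈ Finset.Icc 1 N, b i * G (i + m)‖ ≤ C₀ * B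

namespace Annih

variable {p : ℕ → ℝ} {α A : ℝ} {c b G ε : ℕ → ℂ} {C₀ : ℝ}

theorem summable_exp_mul {Λ y₀ : ℝ} {s : ℂ} (hG : ∀ l : ℕ, ‖G l‖ ≤ Real.exp (Λ + l * y₀))
    (hs : y₀ < s.re) : Summable fun l : ℕ => ‖G l * Complex.exp (-(l * s))‖ := by
  have h1 : Summable fun l : ℕ => Real.exp Λ * Real.exp (-(s.re - y₀)) ^ l :=
    (summable_geometric_of_lt_one (Real.exp_pos _).le (by
      rw [Real.exp_lt_one_iff]; linarith)).mul_left _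
  refine Summable.of_nonneg_of_le (fun _ => norm_nonneg _) (fun l => ?_) h1
  rw [norm_mul, Complex.norm_exp, ← Real.exp_nat_mul, ← Real.exp_add]
  calc _ ≤ Real.exp (Λ + l * y₀) * Real.exp (-((l : ℂ) * s)).re := by gcongr; exact hG l
    _ = _ := by
      rw [← Real.exp_add]
      congr 1
      simp
      ring

theorem laur_mul_eq (hG0 : G 0 = 0) {s : ℂ}
    (hG : Summable fun l : ℕ => ‖G l * Complex.exp (-(l * s))‖)
    (hc : Summable fun r : ℕ => ‖c r * Complex.exp (-(r * s))‖) (N : ℕ) :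
    (Summable fun m : ℕ => (∑ r ∈ Finset.range m, c r * G (m - r) +
        ∑ i ∈ Finset.Icc 1 N, b i * G (i + m)) * Complex.exp (-(m * s))) ∧
    (∑' l : ℕ, G l * Complex.exp (-(l * s))) * laur c b N s =
      ∑' m : ℕ, (∑ r ∈ Finset.range m, c r * G (m - r) +
        ∑ i ∈ Finset.Icc 1 N, b i * G (i + m)) * Complex.exp (-(m * s)) +
      ∑ l ∈ Finset.range N, G l * Complex.exp (-(l * s)) *
        ∑ i ∈ Finset.Icc (l + 1) N, b i * Complex.exp (i * s) := by
  have hcauchy : ∀ m : ℕ, ∑ k ∈ Finset.range (m + 1), c k * Complex.exp (-(k * s)) *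
      (G (m - k) * Complex.exp (-((m - k : ℕ) * s))) =
      (∑ r ∈ Finset.range m, c r * G (m - r)) * Complex.exp (-(m * s)) := by
    intro m
    rw [Finset.sum_range_succ, Nat.sub_self, hG0, zero_mul, mul_zero, add_zero, Finset.sum_mul]
    refine Finset.sum_congr rfl fun r hr => ?_
    have hr : r ≤ m := (Finset.mem_range.1 hr).le
    have : Complex.exp (-(m * s)) = Complex.exp (-(r * s)) * Complex.exp (-((m - r : ℕ) * s)) := by
      rw [← Complex.exp_add, Nat.cast_sub hr]
      congr 1
      ring
    rw [this]
    ring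
  have hs1 : Summable fun m : ℕ =>
      (∑ r ∈ Finset.range m, c r * G (m - r)) * Complex.exp (-(m * s)) :=
    (summable_norm_sum_mul_range_of_summable_norm hc hG).of_norm.congr hcauchy
  have hp1 : (∑' l : ℕ, G l * Complex.exp (-(l * s))) * ∑' r : ℕ, c r * Complex.exp (-(r * s)) =
      ∑' m : ℕ, (∑ r ∈ Finset.range m, c r * G (m - r)) * Complex.exp (-(m * s)) := by
    rw [mul_comm, tsum_mul_tsum_eq_tsum_sum_range_of_summable_norm hc hG]
    exact tsum_congr hcauchy
  have hshift : ∀ i : ℕ, (Summable fun m : ℕ => b i * G (i + m) * Complex.exp (-(m * s))) ∧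
      (∑' l : ℕ, G l * Complex.exp (-(l * s))) * (b i * Complex.exp (i * s)) =
        ∑' m : ℕ, b i * G (i + m) * Complex.exp (-(m * s)) +
        ∑ l ∈ Finset.range i, G l * Complex.exp (-(l * s)) * (b i * Complex.exp (i * s)) := by
    intro i
    have e : ∀ m : ℕ, G (m + i) * Complex.exp (-((m + i : ℕ) * s)) * (b i * Complex.exp (i * s)) =
        b i * G (i + m) * Complex.exp (-(m * s)) := fun m => by
      have : Complex.exp (-(m * s)) = Complex.exp (-((m + i : ℕ) * s)) * Complex.exp (i * s) := by
        rw [← Complex.exp_add]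
        congr 1
        push_cast
        ring
      rw [this, add_comm i m]
      ring
    have hs := ((summable_nat_add_iff i).2 hG.of_norm).mul_right (b i * Complex.exp (i * s))
    refine ⟨hs.congr e, ?_⟩
    rw [← hG.of_norm.sum_add_tsum_nat_add i, add_mul, ← tsum_mul_right, Finset.sum_mul, add_comm]
    congr 1
    exact tsum_congr e
  have hs2 : Summable fun m : ℕ => (∑ i ∈ Finset.Icc 1 N, b i * G (i + m)) *
      Complex.exp (-(m * s)) := by
    simp_rw [Finset.sum_mul]
    exact summable_sum fun i _ => (hshift i).1
  refine ⟨?_, ?_⟩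
  · simp_rw [add_mul]
    exact hs1.add hs2
  · simp_rw [add_mul]
    rw [hs1.tsum_add hs2, laur, mul_add, hp1, add_assoc]
    congr 1
    simp_rw [Finset.sum_mul]
    rw [Summable.tsum_finsetSum fun i _ => (hshift i).1, Finset.mul_sum,
      Finset.sum_congr rfl fun i _ => (hshift i).2, Finset.sum_add_distrib]
    congr 1
    simp_rw [Finset.mul_sum]
    refine Finset.sum_comm' fun i l => ?_
    simp
    omega

theorem norm_x_le (Q : Annih p c b C₀ G ε) {y₂ : ℝ} {N m : ℕ}
    (hsl : ∀ i, N ≤ i → logIncr p α i ≤ y₂) (hα : 0 ≤ α) :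
    ‖ε m + ∑ r ∈ Finset.range m, c r * G (m - r) + ∑ i ∈ Finset.Icc 1 N, b i * G (i + m)‖ ≤
      C₀ * ((1 + (m : ℝ)) ^ α * Real.exp (m * y₂)) := by
  refine Q.x_le m N _ (by positivity) fun i hi => ?_
  have h1 := slope_ge (p := p) (α := α) (y := y₂) (Nat.le_add_right i m)
    fun j hj _ => hsl j (by omega)
  have hi0 : (1 : ℝ) ≤ i := by exact_mod_cast (by omega)
  have hm0 : (0 : ℝ) ≤ m := by positivity
  rw [Real.rpow_def_of_pos (by positivity), ← Real.exp_add, ← Real.exp_add]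
  refine Real.exp_le_exp.2 ?_
  have h2 : Real.log (i + m : ℕ) - Real.log i ≤ Real.log (1 + m) := by
    have hi1 : (0 : ℝ) < i := by linarith
    have him : (0 : ℝ) < ((i + m : ℕ) : ℝ) := by push_cast; linarith
    rw [← Real.log_div him.ne' hi1.ne']
    refine Real.log_le_log (div_pos him hi1) ?_
    push_cast
    rw [div_le_iff₀ (by linarith)]
    nlinarith
  have h3 : α * (Real.log (i + m : ℕ) - Real.log i) ≤ α * Real.log (1 + m) := by gcongr
  push_cast at h1 h3
  linarith

set_option maxHeartbeats 1000000 in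
theorem exists_step_const (H : CoeffBound p c b C₀) (h : GoodWeight p α A) {K : ℕ} (hK : 1 ≤ K) :
    ∃ C : ℝ, 1 ≤ C ∧ ∀ G ε : ℕ → ℂ, Annih p c b C₀ G ε → ∀ (B Λ y₀ y₂ : ℝ) (N : ℕ), 0 ≤ B → 0 ≤ Λ →
      0 < y₀ → y₀ < y₂ → y₂ ≤ 1 → K ≤ N → (∀ i, K ≤ i → i < N → y₂ ≤ logIncr p α i) →
      (∀ i, N ≤ i → logIncr p α i ≤ y₂) →
      C₀ * ∑' r : ℕ, Real.exp (max (p r) 0 / 200) * Real.exp (-(r * y₀)) ≤ Real.exp B →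
      (∀ x ∈ Icc (-Real.pi) Real.pi, Real.exp (-B) ≤ ‖laur c b N (y₂ + x * Complex.I)‖) →
      (∀ l : ℕ, ‖G l‖ ≤ Real.exp (Λ + l * y₀)) →
      ∀ l : ℕ, ‖G l‖ ≤ Real.exp (2 * B + C + (α + 1) * Real.log ((2 + Λ + B + C) / (y₂ - y₀)) +
        l * y₂) := by
  obtain ⟨Ct, hCt, htail⟩ := exists_tail_const h.one_lt hK H.pos H.b_le
  have hC₀ := H.pos
  have hα := h.one_lt
  set C' := Ct * Real.exp (-p 1 + 1) with hC'
  have hC'0 : 0 < C' := by positivity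
  set C := C₀ + Ct + C' + 5 with hC
  refine ⟨C, by linarith, ?_⟩
  intro G ε Q B Λ y₀ y₂ N hB hΛ hy₀ hy hy₂ hKN hsl hsl' hB0 hlow hG
  have hexpB : 1 ≤ Real.exp B := Real.one_le_exp hB
  have hexpΛ : 1 ≤ Real.exp Λ := Real.one_le_exp hΛ
  have hexpC : C + 1 ≤ Real.exp C := Real.add_one_le_exp C
  set d := y₂ - y₀ with hd
  have hd0 : 0 < d := by linarith
  have hd1 : d ≤ 1 := by linarith
  set L := Λ + B + C with hL
  have hL0 : 0 ≤ L := by linarith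
  set x : ℕ → ℂ := fun m =>
    ε m + ∑ r ∈ Finset.range m, c r * G (m - r) + ∑ i ∈ Finset.Icc 1 N, b i * G (i + m) with hx
  have hbsum : ∀ y, 0 ≤ y → y ≤ y₂ → ∑ i ∈ Finset.Icc 1 N, ‖b i‖ * Real.exp (i * y) ≤ C' := by
    intro y hy0 hyy
    refine (htail N y hy0 (hyy.trans hy₂) hKN (fun i hi hi' => hyy.trans (hsl i hi hi')) 1
      le_rfl).trans ?_
    simp only [Nat.cast_one, Real.one_rpow, mul_one, one_mul, hC']
    gcongr
    linarith
  -- the series at the lower height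
  have hsum0 := h.summable_exp_div hy₀
  have hεm : ∀ m, ‖ε m‖ * Real.exp (-(m * y₀)) ≤ Real.exp B := fun m => by
    refine le_trans ?_ hB0
    have := hsum0.le_tsum m fun j _ => by positivity
    calc _ ≤ C₀ * Real.exp (max (p m) 0 / 200) * Real.exp (-(m * y₀)) := by
          gcongr; exact Q.ε_le m
      _ = C₀ * (Real.exp (max (p m) 0 / 200) * Real.exp (-(m * y₀))) := by ring
      _ ≤ _ := by gcongr
  have hcm : ∀ m, ∑ r ∈ Finset.range m, ‖c r‖ * Real.exp (-(r * y₀)) ≤ Real.exp B := fun m => by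
    refine le_trans ?_ hB0
    rw [← tsum_mul_left]
    refine le_trans (Finset.sum_le_sum fun r _ => ?_)
      ((hsum0.mul_left C₀).sum_le_tsum (Finset.range m) fun j _ => by positivity)
    rw [← mul_assoc]
    gcongr
    exact H.c_le r
  have hxb : ∀ m, ‖x m‖ ≤ Real.exp (L + m * y₀) := by
    intro m
    have e1 : ‖ε m‖ ≤ Real.exp (Λ + m * y₀) * Real.exp B := by
      have := hεm m
      rw [Real.exp_neg, ← div_eq_mul_inv, div_le_iff₀ (Real.exp_pos _)] at this
      refine this.trans ?_
      rw [mul_comm, Real.exp_add]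
      gcongr
      exact le_mul_of_one_le_left (Real.exp_pos _).le hexpΛ
    have e2 : ‖∑ r ∈ Finset.range m, c r * G (m - r)‖ ≤ Real.exp (Λ + m * y₀) * Real.exp B := by
      refine (norm_sum_le _ _).trans (le_trans ?_ (mul_le_mul_of_nonneg_left (hcm m)
        (Real.exp_pos _).le))
      rw [Finset.mul_sum]
      refine Finset.sum_le_sum fun r hr => ?_
      have hr : r ≤ m := (Finset.mem_range.1 hr).le
      rw [norm_mul, mul_left_comm, ← Real.exp_add]
      refine mul_le_mul_of_nonneg_left ((hG (m - r)).trans (Real.exp_le_exp.2 ?_)) (norm_nonneg _)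
      rw [Nat.cast_sub hr]
      linarith
    have e3 : ‖∑ i ∈ Finset.Icc 1 N, b i * G (i + m)‖ ≤ Real.exp (Λ + m * y₀) * C' := by
      refine (norm_sum_le _ _).trans (le_trans ?_ (mul_le_mul_of_nonneg_left
        (hbsum y₀ hy₀.le hy.le) (Real.exp_pos _).le))
      rw [Finset.mul_sum]
      refine Finset.sum_le_sum fun i hi => ?_
      rw [norm_mul, mul_left_comm, ← Real.exp_add]
      refine mul_le_mul_of_nonneg_left ((hG (i + m)).trans (Real.exp_le_exp.2 ?_)) (norm_nonneg _)
      push_cast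
      linarith
    calc ‖x m‖ ≤ Real.exp (Λ + m * y₀) * (2 * Real.exp B + C') := by
          refine (norm_add_le _ _).trans ?_
          have := norm_add_le (ε m) (∑ r ∈ Finset.range m, c r * G (m - r))
          linarith
      _ ≤ Real.exp (Λ + m * y₀) * (Real.exp B * Real.exp C) := by
          gcongr
          nlinarith
      _ = _ := by
          rw [← Real.exp_add, ← Real.exp_add]
          congr 1
          rw [hL]; ring
  -- the two sums at the upper height
  obtain ⟨hsx, hsx'⟩ := tsum_le_of_two_bounds (f := fun m => ‖x m‖ * Real.exp (-(m * y₂)))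
    (C := C₀) (α := α) (L := L) (h := d) (fun m => by positivity) hC₀.le (by linarith) hL0 hd0 hd1
    (fun m => by
      have := Q.norm_x_le (m := m) (N := N) (α := α) hsl' (by linarith)
      calc ‖x m‖ * Real.exp (-(m * y₂)) ≤
          C₀ * ((1 + (m : ℝ)) ^ α * Real.exp (m * y₂)) * Real.exp (-(m * y₂)) := by gcongr
        _ = C₀ * (1 + (m : ℝ)) ^ α * (Real.exp (m * y₂) * Real.exp (-(m * y₂))) := by ring
        _ = _ := by rw [← Real.exp_add]; simp)
    (fun m => by
      calc ‖x m‖ * Real.exp (-(m * y₂)) ≤ Real.exp (L + m * y₀) * Real.exp (-(m * y₂)) := by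
            gcongr; exact hxb m
        _ = _ := by rw [← Real.exp_add]; congr 1; rw [hd]; ring)
  set τ : ℕ → ℝ := fun l => ∑ i ∈ Finset.Icc (l + 1) N, ‖b i‖ * Real.exp (i * y₂) with hτ
  have hτ0 : ∀ l, 0 ≤ τ l := fun l => Finset.sum_nonneg fun i _ => by positivity
  obtain ⟨hsg, hsg'⟩ := tsum_le_of_two_bounds
    (f := fun l => ‖G l‖ * Real.exp (-(l * y₂)) * τ l)
    (C := Ct) (α := α) (L := L) (h := d) (fun l => mul_nonneg (by positivity) (hτ0 l)) hCt.le
    (by linarith) hL0 hd0 hd1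
    (fun l => by
      rcases Nat.eq_zero_or_pos l with rfl | hl
      · simp [Q.G_zero]; positivity
      have h1 : τ l ≤ Ct * (l : ℝ) ^ α * Real.exp (-p l + l * y₂) :=
        (Finset.sum_le_sum_of_subset_of_nonneg (Finset.Icc_subset_Icc_left (by omega))
          fun _ _ _ => by positivity).trans (htail N y₂ (by linarith) hy₂ hKN hsl l hl)
      calc ‖G l‖ * Real.exp (-(l * y₂)) * τ l ≤ Real.exp (p l) * Real.exp (-(l * y₂)) *
            (Ct * (l : ℝ) ^ α * Real.exp (-p l + l * y₂)) := by
            gcongr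
            exact Q.G_le l hl
        _ = Ct * (l : ℝ) ^ α *
            (Real.exp (p l) * Real.exp (-(l * y₂)) * Real.exp (-p l + l * y₂)) := by ring
        _ = Ct * (l : ℝ) ^ α := by
          rw [← Real.exp_add, ← Real.exp_add, show p l + -(l * y₂) + (-p l + l * y₂) = 0 by ring]
          simp
        _ ≤ _ := by
          have : (l : ℝ) ≤ 1 + l := by linarith
          exact mul_le_mul_of_nonneg_left
            (Real.rpow_le_rpow (by positivity) this (by linarith)) hCt.le)
    (fun l => by
      have h1 : τ l ≤ C' :=
        (Finset.sum_le_sum_of_subset_of_nonneg (Finset.Icc_subset_Icc_left (by omega))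
          fun _ _ _ => by positivity).trans (hbsum y₂ (by linarith) le_rfl)
      calc ‖G l‖ * Real.exp (-(l * y₂)) * τ l ≤
            Real.exp (Λ + l * y₀) * Real.exp (-(l * y₂)) * (Real.exp B * Real.exp C) := by
            gcongr
            · exact hG l
            · nlinarith
        _ = _ := by
          simp only [← Real.exp_add]
          congr 1
          rw [hL, hd]; ring)
  set X := (2 + L) / d with hX
  have hXge : L / d + 2 ≤ X := by
    have e : X = 2 / d + L / d := by rw [hX]; exact add_div _ _ _
    have : 2 ≤ 2 / d := by rw [le_div_iff₀ hd0]; linarith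
    linarith
  have hX2 : 2 / d ≤ X := by rw [hX]; gcongr; linarith
  have hLd : 0 ≤ L / d := by positivity
  have hX1 : 1 ≤ X := by linarith
  have hXX : X ≤ X ^ (α + 1) := by
    conv_lhs => rw [← Real.rpow_one X]
    exact Real.rpow_le_rpow_of_exponent_le hX1 (by linarith)
  have hpowle : (L / d + 2) ^ (α + 1) ≤ X ^ (α + 1) :=
    Real.rpow_le_rpow (by positivity) hXge (by linarith)
  have hbound : ∀ t ∈ Icc (-Real.pi) Real.pi,
      ‖∑' l, G l * Complex.exp (-(l * ((y₂ : ℂ) + t * Complex.I)))‖ ≤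
        Real.exp (2 * B + C + (α + 1) * Real.log ((2 + Λ + B + C) / d)) := by
    intro t ht
    set s : ℂ := y₂ + t * Complex.I with hs
    have hre : s.re = y₂ := by simp [hs]
    have hs0 : 0 < s.re := by rw [hre]; linarith
    have hexpn : ∀ k : ℕ, ‖Complex.exp (-(k * s))‖ = Real.exp (-(k * y₂)) := fun k => by
      rw [Complex.norm_exp]; simp [hre]
    obtain ⟨hsm, hid⟩ := laur_mul_eq (b := b) Q.G_zero
      (summable_exp_mul hG (s := s) (by rw [hre]; exact hy)) (H.summable_norm h hs0) N
    have hx' : ∀ m, (∑ r ∈ Finset.range m, c r * G (m - r) +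
        ∑ i ∈ Finset.Icc 1 N, b i * G (i + m)) * Complex.exp (-(m * s)) =
        x m * Complex.exp (-(m * s)) - ε m * Complex.exp (-(m * s)) := fun m => by
      simp only [hx]; ring
    have hεterm : ∀ m : ℕ, ‖ε m * Complex.exp (-(m * s))‖ ≤
        C₀ * (Real.exp (max (p m) 0 / 200) * Real.exp (-(m * y₀))) := fun m => by
      rw [norm_mul, hexpn, ← mul_assoc]
      gcongr
      exact Q.ε_le m
    have hsumε : Summable fun m => ε m * Complex.exp (-(m * s)) :=
      Summable.of_norm_bounded (hsum0.mul_left C₀) hεterm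
    have hsumx : Summable fun m => ‖x m * Complex.exp (-(m * s))‖ :=
      hsx.congr fun m => by rw [norm_mul, hexpn]
    have t1 : ‖∑' m, x m * Complex.exp (-(m * s))‖ ≤ C₀ * X ^ (α + 1) + X ^ (α + 1) := by
      refine (norm_tsum_le_tsum_norm hsumx).trans ?_
      simp_rw [norm_mul, hexpn]
      refine hsx'.trans (add_le_add ?_ (hX2.trans hXX))
      gcongr
    have t2 : ‖∑' m, ε m * Complex.exp (-(m * s))‖ ≤ Real.exp B := by
      refine le_trans ?_ hB0
      rw [← tsum_mul_left]
      exact tsum_of_norm_bounded (hsum0.mul_left C₀).hasSum hεterm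
    have t3 : ‖∑ l ∈ Finset.range N, G l * Complex.exp (-(l * s)) *
        ∑ i ∈ Finset.Icc (l + 1) N, b i * Complex.exp (i * s)‖ ≤
          Ct * X ^ (α + 1) + X ^ (α + 1) := by
      refine (norm_sum_le _ _).trans (le_trans (Finset.sum_le_sum fun l _ => ?_)
        ((hsg.sum_le_tsum (Finset.range N) fun l _ => mul_nonneg (by positivity) (hτ0 l)).trans
        (hsg'.trans (add_le_add (mul_le_mul_of_nonneg_left hpowle hCt.le) (hX2.trans hXX)))))
      rw [norm_mul, norm_mul, hexpn]
      gcongr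
      have := CoeffBound.norm_sum_le b s (Finset.Icc (l + 1) N)
      rwa [hre] at this
    have hprod : ‖∑' l, G l * Complex.exp (-(l * s))‖ * ‖laur c b N s‖ ≤
        Real.exp B * Real.exp C * X ^ (α + 1) := by
      rw [← norm_mul, hid]
      simp_rw [hx']
      rw [hsumx.of_norm.tsum_sub hsumε]
      refine (norm_add_le _ _).trans ((add_le_add (norm_sub_le _ _) le_rfl).trans ?_)
      have hY1 : 1 ≤ X ^ (α + 1) := hX1.trans hXX
      set Y := X ^ (α + 1)
      calc _ ≤ (C₀ + Ct + 2) * Y + Real.exp B := by linarith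
        _ ≤ (C₀ + Ct + 2) * (Real.exp B * Y) + 1 * (Real.exp B * Y) := by
          rw [one_mul]
          exact add_le_add (mul_le_mul_of_nonneg_left (le_mul_of_one_le_left (by linarith) hexpB)
            (by linarith)) (le_mul_of_one_le_right (Real.exp_pos _).le hY1)
        _ = (C₀ + Ct + 3) * (Real.exp B * Y) := by ring
        _ ≤ Real.exp C * (Real.exp B * Y) := by
          gcongr
          linarith
        _ = _ := by ring
    have hl := hlow t ht
    have hfin : ‖∑' l, G l * Complex.exp (-(l * s))‖ * Real.exp (-B) ≤
        Real.exp B * Real.exp C * X ^ (α + 1) :=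
      (mul_le_mul_of_nonneg_left hl (norm_nonneg _)).trans hprod
    rw [Real.exp_neg, ← div_eq_mul_inv, div_le_iff₀ (Real.exp_pos _)] at hfin
    refine hfin.trans (le_of_eq ?_)
    rw [Real.rpow_def_of_pos (by linarith), ← Real.exp_add, ← Real.exp_add, ← Real.exp_add]
    congr 1
    rw [hX, hL, show 2 + (Λ + B + C) = 2 + Λ + B + C by ring]
    ring
  intro l
  have hsumG : Summable fun l : ℕ => ‖G l‖ * Real.exp (-(l * y₂)) := by
    have := summable_exp_mul hG (s := (y₂ : ℂ)) (by simpa using hy)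
    refine this.congr fun l => ?_
    rw [norm_mul, Complex.norm_exp]
    simp
  have := norm_coeff_le_of_norm_tsum_le hsumG hbound l
  rw [Real.exp_neg, ← div_eq_mul_inv, div_le_iff₀ (Real.exp_pos _), ← Real.exp_add] at this
  exact this

end Annih

theorem log_two_div_le {t D : ℝ} (ht : 0 < t) (htD : t ≤ D) (hD : D ≤ 1) :
    Real.log (1 / (t / 2)) ≤ (2 + Real.log (1 / D)) * (D / t) := by
  have hD0 : 0 < D := ht.trans_le htD
  have hr : 1 ≤ D / t := by rwa [le_div_iff₀ ht, one_mul]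
  have e : 1 / (t / 2) = 2 * (D / t) * (1 / D) := by field_simp
  rw [e, Real.log_mul (by positivity) (by positivity), Real.log_mul (by positivity) (by positivity)]
  have h1 := Real.log_le_sub_one_of_pos (show 0 < D / t by positivity)
  have h2 := Real.log_two_lt_d9
  have h3 : 0 ≤ Real.log (1 / D) := Real.log_nonneg (by rw [le_div_iff₀ hD0]; linarith)
  nlinarith

theorem mul_log_one_add_le {κ x : ℝ} (hκ : 1 ≤ κ) (hx : 0 ≤ x) :
    κ * Real.log (1 + x) ≤ x / 4 + κ * Real.log (4 * κ) := by
  have h1 := Real.log_le_sub_one_of_pos (show 0 < (1 + x) / (4 * κ) by positivity)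
  rw [Real.log_div (by positivity) (by positivity)] at h1
  have h2 : κ * Real.log (1 + x) ≤ κ * (Real.log (4 * κ) + ((1 + x) / (4 * κ) - 1)) := by
    gcongr; linarith
  have h3 : κ * ((1 + x) / (4 * κ)) = (1 + x) / 4 := by field_simp
  linarith

/-- Self-improvement of exponential bounds: a gain of a logarithm at each step forces a bound
independent of the initial one. -/
theorem norm_le_of_selfimprove {G : ℕ → ℂ} {u v a₀ b₀ κ S : ℝ} (huv : u < v) (hD : v - u ≤ 1)
    (ha₀ : 0 ≤ a₀) (hb₀ : 1 ≤ b₀) (hκ : 1 ≤ κ) (hS : 0 ≤ S)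
    (hinit : ∀ l : ℕ, ‖G l‖ ≤ Real.exp (S + l * u))
    (hstep : ∀ Λ y₀ y₂ : ℝ, 0 ≤ Λ → u < y₀ → y₀ < y₂ → y₂ ≤ v →
      (∀ l : ℕ, ‖G l‖ ≤ Real.exp (Λ + l * y₀)) →
      ∀ l : ℕ, ‖G l‖ ≤ Real.exp (a₀ + κ * Real.log ((b₀ + Λ) / (y₂ - y₀)) + l * y₂)) (l : ℕ) :
    ‖G l‖ ≤ Real.exp (2 * (a₀ + κ * Real.log b₀ + κ * Real.log (4 * κ) +
      κ * (2 + Real.log (1 / (v - u)))) + l * v) := by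
  set D := v - u with hDdef
  have hD0 : 0 < D := by linarith
  set a := a₀ + κ * Real.log b₀ + κ * Real.log (4 * κ) + κ * (2 + Real.log (1 / D)) with ha
  have hlb : 0 ≤ Real.log b₀ := Real.log_nonneg hb₀
  have hlk : 0 ≤ Real.log (4 * κ) := Real.log_nonneg (by linarith)
  have hlD : 0 ≤ Real.log (1 / D) := Real.log_nonneg (by rw [le_div_iff₀ hD0]; linarith)
  have ha0 : 0 ≤ a := by positivity
  have key : ∀ S' : ℝ, 0 ≤ S' →
      (∀ y, u < y → y ≤ v → ∀ l : ℕ, ‖G l‖ ≤ Real.exp (S' / (y - u) + l * y)) →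
      ∀ y, u < y → y ≤ v → ∀ l : ℕ, ‖G l‖ ≤ Real.exp ((S' / 2 + D * a) / (y - u) + l * y) := by
    intro S' hS' hP y hy hyv l
    set t := y - u with ht
    have ht0 : 0 < t := by linarith
    have htD : t ≤ D := by linarith
    have hmid : u + t / 2 - u = t / 2 := by ring
    have hP' := hP (u + t / 2) (by linarith) (by linarith)
    rw [hmid] at hP'
    have h := hstep (S' / (t / 2)) (u + t / 2) y (by positivity) (by linarith) (by linarith) hyv hP' l
    refine h.trans (Real.exp_le_exp.2 ?_)
    have e : y - (u + t / 2) = t / 2 := by rw [ht]; ring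
    rw [e]
    set x := S' / (t / 2) with hx
    have hx0 : 0 ≤ x := by positivity
    have h1 : Real.log ((b₀ + x) / (t / 2)) ≤
        Real.log b₀ + Real.log (1 + x) + Real.log (1 / (t / 2)) := by
      rw [← Real.log_mul (by positivity) (by positivity),
        ← Real.log_mul (by positivity) (by positivity)]
      refine Real.log_le_log (by positivity) ?_
      rw [mul_one_div]
      gcongr
      nlinarith
    have h2 := mul_log_one_add_le hκ hx0
    have h3 := log_two_div_le ht0 htD hD
    have hr : 1 ≤ D / t := by rwa [le_div_iff₀ ht0, one_mul]
    have h4 : κ * Real.log ((b₀ + x) / (t / 2)) ≤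
        κ * (Real.log b₀ + Real.log (1 + x) + (2 + Real.log (1 / D)) * (D / t)) := by
      gcongr
      linarith
    have h5 : (S' / 2 + D * a) / t = x / 4 + a * (D / t) := by rw [hx]; field_simp; ring
    rw [h5, ha]
    have h6 : 0 ≤ (a₀ + κ * Real.log b₀ + κ * Real.log (4 * κ)) * (D / t - 1) :=
      mul_nonneg (by positivity) (by linarith)
    nlinarith
  have iter : ∀ n : ℕ, ∀ y, u < y → y ≤ v → ∀ l : ℕ,
      ‖G l‖ ≤ Real.exp ((2 * (D * a) + S / 2 ^ n) / (y - u) + l * y) := by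
    intro n
    induction n with
    | zero =>
      intro y hy hyv l
      refine (hinit l).trans (Real.exp_le_exp.2 ?_)
      have ht0 : 0 < y - u := by linarith
      have : S ≤ (2 * (D * a) + S / 2 ^ 0) / (y - u) := by
        rw [le_div_iff₀ ht0]
        have h1 : S * (y - u) ≤ S * 1 := by gcongr; linarith
        have h2 : 0 ≤ D * a := by positivity
        simp only [pow_zero, div_one]
        linarith
      have : (l : ℝ) * u ≤ l * y := by gcongr
      linarith
    | succ n ih =>
      intro y hy hyv l
      have := key _ (by positivity) ih y hy hyv l
      convert this using 4
      rw [pow_succ]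
      field_simp
      ring
  have hlim : Tendsto (fun n : ℕ => Real.exp ((2 * (D * a) + S / 2 ^ n) / (v - u) + l * v)) atTop
      (𝓝 (Real.exp ((2 * (D * a) + 0) / (v - u) + l * v))) := by
    refine (Real.continuous_exp.tendsto _).comp ?_
    refine Tendsto.add_const _ (Tendsto.div_const (Tendsto.const_add _ ?_) _)
    refine Tendsto.div_atTop tendsto_const_nhds (tendsto_pow_atTop_atTop_of_one_lt (by norm_num))
  have := ge_of_tendsto' hlim fun n => iter n v huv le_rfl l
  rwa [← hDdef, show (2 * (D * a) + 0) / D = 2 * a by field_simp; ring] at this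

namespace Annih

variable {p : ℕ → ℝ} {α A : ℝ} {c b : ℕ → ℂ} {C₀ : ℝ}

set_option maxHeartbeats 1000000 in
/-- Functionals annihilating the left translates of a nonzero element have coefficients much
smaller than the dual weight. -/
theorem exists_norm_le (H : CoeffBound p c b C₀) (h : GoodWeight p α A)
    (hne : (∃ r, c r ≠ 0) ∨ ∃ i, 1 ≤ i ∧ b i ≠ 0) :
    ∃ l₀ : ℕ, ∀ G ε : ℕ → ℂ, Annih p c b C₀ G ε → ∀ l, l₀ ≤ l →
      ‖G l‖ ≤ Real.exp (3 / 5 * p l) := by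
  obtain ⟨K, hK, hKa⟩ := h.logIncr_antitone
  obtain ⟨γ, hγ1, hγ2, hgood⟩ := H.exists_good_interval h hne hK hKa
  obtain ⟨C, hC1, hstep⟩ := exists_step_const H h hK
  obtain ⟨K', hK', havg⟩ := h.antitone_avg
  have hα := h.one_lt
  set κ := α + 1 with hκ
  have hlk : 0 ≤ Real.log (4 * κ) := Real.log_nonneg (by linarith)
  -- the constant controlling the growth exponent
  set C₅ : ℝ := 2 * (2 + C + κ * (2 + C) + κ * Real.log (4 * κ) + κ * 3) with hC₅
  have hC₅0 : 0 ≤ C₅ := by positivity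
  obtain ⟨γ', hγ', hγ'2⟩ := exists_between hγ2
  have hmain : ∀ᶠ j : ℕ in atTop, ∀ G ε : ℕ → ℂ, Annih p c b C₀ G ε → ∀ l : ℕ,
      ‖G l‖ ≤ Real.exp (C₅ * γ ^ j + l * (26 / 100 * dyad p j)) := by
    have hdt := h.dyad_tendsto
    filter_upwards [hgood, h.dyad_pos, hdt.eventually (gt_mem_nhds one_pos)] with j hj hdpos hd1
      G ε Q l
    obtain ⟨u, v, hu, hv, hvu, hI⟩ := hj
    have hu0 : 0 < u := by linarith
    have hv1 : v ≤ 1 := by linarith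
    have huv : u < v := by have := Real.exp_pos (-γ ^ j); linarith
    have hB : 1 ≤ γ ^ j := one_le_pow₀ hγ1.le
    have hinit : ∃ S : ℝ, 0 ≤ S ∧ ∀ l : ℕ, ‖G l‖ ≤ Real.exp (S + l * u) := by
      have hs := h.summable_exp hu0
      set Z := ∑' r : ℕ, Real.exp (max (p r) 0) * Real.exp (-(r * u)) with hZ
      refine ⟨Real.log (max 1 Z), Real.log_nonneg (le_max_left _ _), fun l => ?_⟩
      have hl : Real.exp (max (p l) 0) * Real.exp (-(l * u)) ≤ Z :=
        hs.le_tsum l fun _ _ => by positivity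
      have hG : ‖G l‖ ≤ Real.exp (max (p l) 0) := by
        rcases Nat.eq_zero_or_pos l with rfl | hl'
        · rw [Q.G_zero, norm_zero]; positivity
        · exact (Q.G_le l hl').trans (Real.exp_le_exp.2 (le_max_left _ _))
      rw [Real.exp_add, Real.exp_log (by positivity)]
      have e : Real.exp (max (p l) 0) =
          Real.exp (max (p l) 0) * Real.exp (-(l * u)) * Real.exp (l * u) := by
        rw [mul_assoc, ← Real.exp_add]; simp
      rw [e] at hG
      refine hG.trans ?_
      gcongr
      exact hl.trans (le_max_right _ _)
    obtain ⟨S, hS, hinit⟩ := hinit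
    have hfin := norm_le_of_selfimprove (a₀ := 2 * γ ^ j + C) (b₀ := 2 + γ ^ j + C) (κ := κ) huv
      (by linarith) (by positivity) (by linarith) (by linarith) hS hinit (by
        intro Λ y₀ y₂ hΛ hy₀ hy hy₂ hG l
        obtain ⟨ht0, -⟩ := hI y₀ ⟨hy₀.le, by linarith⟩
        obtain ⟨-, N, hN, hs1, hs2, hlow⟩ := hI y₂ ⟨by linarith, hy₂⟩
        have := hstep G ε Q (γ ^ j) Λ y₀ y₂ N (by positivity) hΛ (by linarith) hy (by linarith) hN
          hs1 hs2 ht0 hlow hG l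
        rwa [show 2 + Λ + γ ^ j + C = 2 + γ ^ j + C + Λ by ring] at this) l
    refine hfin.trans (Real.exp_le_exp.2 (add_le_add ?_ (by gcongr)))
    have hlogD : Real.log (1 / (v - u)) ≤ γ ^ j := by
      rw [Real.log_div one_ne_zero (by linarith), Real.log_one, zero_sub, neg_le]
      rw [← Real.log_exp (-γ ^ j)]
      exact Real.log_le_log (Real.exp_pos _) hvu
    have hlogb : Real.log (2 + γ ^ j + C) ≤ (2 + C) * γ ^ j := by
      have := Real.log_le_sub_one_of_pos (show 0 < 2 + γ ^ j + C by positivity)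
      nlinarith
    have h1 : κ * Real.log (2 + γ ^ j + C) ≤ κ * ((2 + C) * γ ^ j) := by gcongr
    have h2 : κ * (2 + Real.log (1 / (v - u))) ≤ κ * (2 * γ ^ j + γ ^ j) := by
      gcongr; linarith
    have h3 : κ * Real.log (4 * κ) * 1 ≤ κ * Real.log (4 * κ) * γ ^ j := by gcongr
    rw [hC₅]
    nlinarith
  have hrest : ∀ᶠ j : ℕ in atTop, C₅ * γ ^ j ≤ 1 / 8 * p (2 ^ j) ∧ K' ≤ 2 ^ (j - 1) := by
    have h1 := eventually_linear_mul_pow_le (β := γ) (γ := γ') hγ1.le hγ' (8 * C₅)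
    have h2 := h.dyad_lower (hγ1.trans hγ').le hγ'2
    have h3 : ∀ᶠ j : ℕ in atTop, K' ≤ 2 ^ (j - 1) :=
      ((tendsto_pow_atTop_atTop_of_one_lt (by norm_num : 1 < 2)).comp
        (tendsto_sub_atTop_nat 1)).eventually_ge_atTop K'
    filter_upwards [h1, h2, h3] with j h1 h2 h3
    refine ⟨?_, h3⟩
    have : 8 * C₅ * 1 * γ ^ j ≤ 8 * C₅ * ((j : ℝ) + 1) * γ ^ j := by
      gcongr
      linarith [(Nat.cast_nonneg j : (0 : ℝ) ≤ j)]
    linarith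
  obtain ⟨J, hJ⟩ := eventually_atTop.1 (hmain.and (hrest.and h.dyad_pos))
  refine ⟨2 ^ J, fun G ε Q l hl => ?_⟩
  have hl0 : l ≠ 0 := by have := Nat.one_le_two_pow (n := J); omega
  set i := Nat.log 2 l with hidef
  have hi1 : 2 ^ i ≤ l := Nat.pow_log_le_self 2 hl0
  have hi2 : l ≤ 2 ^ (i + 1) := (Nat.lt_pow_succ_log_self (by norm_num) l).le
  have hJi : J ≤ i := (Nat.le_log_iff_pow_le (by norm_num) hl0).2 hl
  obtain ⟨hm, ⟨hr1, hr2⟩, hdp⟩ := hJ (i + 1) (by omega)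
  simp only [Nat.add_sub_cancel] at hr2
  have hlpos : (0 : ℝ) < l := by exact_mod_cast Nat.pos_of_ne_zero hl0
  have hd : (l : ℝ) * dyad p (i + 1) ≤ p l := by
    have := havg l (2 ^ (i + 1)) (hr2.trans hi1) hi2
    rw [le_div_iff₀ hlpos] at this
    unfold dyad
    push_cast at this
    linarith
  have hpl : p (2 ^ (i + 1)) ≤ 2 * p l := by
    have e : p (2 ^ (i + 1)) = 2 * ((2 : ℝ) ^ i * dyad p (i + 1)) := by
      unfold dyad; field_simp; ring
    have : (2 : ℝ) ^ i ≤ l := by exact_mod_cast hi1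
    nlinarith
  refine (hm G ε Q l).trans (Real.exp_le_exp.2 ?_)
  nlinarith

end Annih

theorem GoodWeight.summable_exp_neg {p : ℕ → ℝ} {α A : ℝ} (h : GoodWeight p α A) {δ : ℝ}
    (hδ : 0 < δ) : Summable fun l : ℕ => Real.exp (-(δ * p l)) := by
  obtain ⟨κ, hκ, K, hK, hlow⟩ := h.lower
  have hA := h.A_pos
  have hlog : ∀ᶠ n : ℕ in atTop, (Real.log n) ^ (A + 1) ≤ δ * κ / 2 * (n : ℝ) := by
    have h1 := (isLittleO_log_rpow_rpow_atTop (A + 1) (one_pos : (0 : ℝ) < 1)).comp_tendsto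
      tendsto_natCast_atTop_atTop
    filter_upwards [h1.bound (show 0 < δ * κ / 2 by positivity), eventually_ge_atTop 1] with n hn h1n
    simp only [Function.comp, Real.rpow_one, Real.norm_natCast] at hn
    exact (le_abs_self _).trans hn
  have hs : Summable fun n : ℕ => (1 : ℝ) / (n : ℝ) ^ 2 := Real.summable_one_div_nat_pow.2 (by norm_num)
  refine summable_of_isBigO_nat hs (Asymptotics.IsBigO.of_bound 1 ?_)
  filter_upwards [hlog, eventually_ge_atTop K] with n hn hKn
  have hn3 : (3 : ℝ) ≤ n := by exact_mod_cast hK.trans hKn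
  have hn0 : (0 : ℝ) < n := by linarith
  have hl0 : 0 < Real.log n := Real.log_pos (by linarith)
  have hlA : 0 < (Real.log n) ^ A := Real.rpow_pos_of_pos hl0 _
  have h1 := hlow n hKn
  rw [one_mul, Real.norm_eq_abs, Real.abs_exp, Real.norm_eq_abs, abs_of_pos (by positivity)]
  have e : 1 / (n : ℝ) ^ 2 = Real.exp (-(2 * Real.log n)) := by
    rw [Real.exp_neg, two_mul, Real.exp_add, Real.exp_log hn0, sq, one_div]
  rw [e]
  refine Real.exp_le_exp.2 (neg_le_neg ?_)
  rw [Real.rpow_add_one hl0.ne'] at hn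
  have h2 : 2 * Real.log n * (Real.log n) ^ A ≤ δ * (κ * n) := by linarith
  calc 2 * Real.log n ≤ δ * (κ * n) / (Real.log n) ^ A := (le_div_iff₀ hlA).2 h2
    _ = δ * (κ * n / (Real.log n) ^ A) := by ring
    _ ≤ δ * p n := by gcongr

/-- A bilateral shift on a sum `X × Y`, with the negative half modelled on a weighted `ℓ²`-like
basis `e` with coordinates `cy`; `L` is the left shift, `R` its inverse. -/
structure BiShift {X Y : Type*} [NormedAddCommGroup X] [NormedSpace ℂ X]
    [NormedAddCommGroup Y] [NormedSpace ℂ Y] (p : ℕ → ℝ) (L R : (X × Y) →L[ℂ] (X × Y))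
    (T : X →L[ℂ] X) (φ : X →L[ℂ] ℂ) (cy : ℕ → Y →L[ℂ] ℂ) (e : ℕ → Y) : Prop where
  L_R : ∀ q, L (R q) = q
  R_L : ∀ q, R (L q) = q
  L_left : ∀ x, L (x, 0) = (T x, φ x • e 1)
  L_e : ∀ l, 1 ≤ l → L (0, e l) = (0, e (l + 1))
  cy_one_L : ∀ q, cy 1 (L q).2 = φ q.1
  cy_L : ∀ l, 1 ≤ l → ∀ q, cy (l + 1) (L q).2 = cy l q.2
  T_le : ∃ C : ℝ, 0 < C ∧ ∀ r, ‖T ^ r‖ ≤ C * Real.exp (max (p r) 0 / 200)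
  ext_fst : ∀ x, (∀ r, φ ((T ^ r) x) = 0) → x = 0
  cy_e : ∀ l m, 1 ≤ l → 1 ≤ m → cy l (e m) = if l = m then 1 else 0
  norm_e : ∀ l, 1 ≤ l → ‖e l‖ = Real.exp (p l)
  norm_cy : ∀ l, 1 ≤ l → ∀ u, ‖cy l u‖ ≤ Real.exp (-p l) * ‖u‖
  ext_snd : ∀ u, (∀ l, 1 ≤ l → cy l u = 0) → u = 0
  norm_tail : ∀ u N, ‖u - ∑ i ∈ Finset.Icc 1 N, cy i u • e i‖ ≤ ‖u‖
  tendsto_tail : ∀ u, Tendsto (fun N => ∑ i ∈ Finset.range N, cy (i + 1) u • e (i + 1)) atTop (𝓝 u)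
  norm_L_pow : ∀ (m N : ℕ) (B : ℝ) (t : Y), 0 ≤ B →
    (∀ i, N < i → Real.exp (p (i + m)) ≤ B * Real.exp (p i)) →
    (∀ i, 1 ≤ i → i ≤ N → cy i t = 0) → ‖(L ^ m) (0, t)‖ ≤ B * ‖t‖

namespace BiShift

variable {X Y : Type*} [NormedAddCommGroup X] [NormedSpace ℂ X]
  [NormedAddCommGroup Y] [NormedSpace ℂ Y] {p : ℕ → ℝ} {L R : (X × Y) →L[ℂ] (X × Y)}
  {T : X →L[ℂ] X} {φ : X →L[ℂ] ℂ} {cy : ℕ → Y →L[ℂ] ℂ} {e : ℕ → Y}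

theorem L_pow_R_pow (W : BiShift p L R T φ cy e) (k : ℕ) (q : X × Y) : (L ^ k) ((R ^ k) q) = q := by
  induction k generalizing q with
  | zero => simp
  | succ k ih =>
    rw [pow_succ, pow_succ', mul_apply_eq_comp, mul_apply_eq_comp, W.L_R, ih]

theorem R_pow_L_pow (W : BiShift p L R T φ cy e) (k : ℕ) (q : X × Y) : (R ^ k) ((L ^ k) q) = q := by
  induction k generalizing q with
  | zero => simp
  | succ k ih =>
    rw [pow_succ, pow_succ', mul_apply_eq_comp, mul_apply_eq_comp, W.R_L, ih]

theorem L_pow_left (W : BiShift p L R T φ cy e) (x : X) (m : ℕ) :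
    (L ^ m) (x, 0) = ((T ^ m) x, ∑ r ∈ Finset.range m, φ ((T ^ r) x) • e (m - r)) := by
  induction m with
  | zero => simp
  | succ m ih =>
    rw [pow_succ', mul_apply_eq_comp, ih]
    have h1 : (((T ^ m) x, ∑ r ∈ Finset.range m, φ ((T ^ r) x) • e (m - r)) : X × Y) =
        ((T ^ m) x, 0) + ∑ r ∈ Finset.range m, φ ((T ^ r) x) • ((0 : X), e (m - r)) := by
      ext <;> simp [Prod.fst_sum, Prod.snd_sum]
    have h2 : ∀ r ∈ Finset.range m, φ ((T ^ r) x) • L ((0 : X), e (m - r)) =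
        φ ((T ^ r) x) • ((0 : X), e (m + 1 - r)) := fun r hr => by
      have := Finset.mem_range.1 hr
      rw [W.L_e _ (by omega), show m - r + 1 = m + 1 - r by omega]
    rw [h1, map_add, map_sum, W.L_left]
    simp only [map_smul]
    rw [Finset.sum_congr rfl h2, Finset.sum_range_succ]
    ext
    · simp [Prod.fst_sum, pow_succ']
    · simp [Prod.snd_sum, add_comm]

theorem L_pow_e (W : BiShift p L R T φ cy e) (m : ℕ) {i : ℕ} (hi : 1 ≤ i) :
    (L ^ m) ((0 : X), e i) = (0, e (i + m)) := by
  induction m with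
  | zero => simp
  | succ m ih =>
    rw [pow_succ', mul_apply_eq_comp, ih, W.L_e _ (by omega), add_assoc]

theorem cy_L_pow (W : BiShift p L R T φ cy e) (m : ℕ) {l : ℕ} (hl : 1 ≤ l) (q : X × Y) :
    cy (l + m) ((L ^ m) q).2 = cy l q.2 := by
  induction m with
  | zero => simp
  | succ m ih =>
    rw [pow_succ', mul_apply_eq_comp, ← add_assoc, W.cy_L _ (by omega), ih]

theorem cy_L_pow_self (W : BiShift p L R T φ cy e) {m : ℕ} (hm : 1 ≤ m) (q : X × Y) :
    cy m ((L ^ m) q).2 = φ q.1 := by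
  obtain ⟨k, rfl⟩ : ∃ k, m = k + 1 := ⟨m - 1, by omega⟩
  rw [pow_succ, mul_apply_eq_comp, add_comm, W.cy_L_pow k le_rfl, W.cy_one_L]

theorem cy_R_pow (W : BiShift p L R T φ cy e) (m : ℕ) {l : ℕ} (hl : 1 ≤ l) (q : X × Y) :
    cy l ((R ^ m) q).2 = cy (l + m) q.2 := by
  rw [← W.cy_L_pow m hl, W.L_pow_R_pow]

theorem L_pow_mem {N : Submodule ℂ (X × Y)} (hN : ∀ q ∈ N, L q ∈ N) (m : ℕ) {q : X × Y}
    (hq : q ∈ N) : (L ^ m) q ∈ N := by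
  induction m with
  | zero => simpa
  | succ m ih => rw [pow_succ', mul_apply_eq_comp]; exact hN _ ih

/-- Coefficients of nonzero elements satisfy the standing growth bounds, and functionals
annihilating all left translates give `Annih` sequences. -/
theorem exists_coeffBound (W : BiShift p L R T φ cy e) (f : X × Y) :
    ∃ C₀ : ℝ, CoeffBound p (fun r => φ ((T ^ r) f.1)) (fun i => cy i f.2) C₀ ∧
      ∀ ℓ : (X × Y) →L[ℂ] ℂ, ‖ℓ‖ ≤ 1 → (∀ m, ℓ ((L ^ m) f) = 0) →
        Annih p (fun r => φ ((T ^ r) f.1)) (fun i => cy i f.2) C₀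
          (fun l => if l = 0 then 0 else ℓ (0, e l)) (fun m => ℓ ((T ^ m) f.1, 0)) := by
  obtain ⟨C, hC, hT⟩ := W.T_le
  set C₀ := (‖φ‖ + 1) * C * ‖f‖ + ‖f‖ + 1 with hC₀
  have hf1 : ‖f.1‖ ≤ ‖f‖ := norm_fst_le f
  have hf2 : ‖f.2‖ ≤ ‖f‖ := norm_snd_le f
  have hTf : ∀ r, ‖(T ^ r) f.1‖ ≤ C * ‖f‖ * Real.exp (max (p r) 0 / 200) := fun r => by
    calc ‖(T ^ r) f.1‖ ≤ ‖T ^ r‖ * ‖f.1‖ := ContinuousLinearMap.le_opNorm _ _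
      _ ≤ (C * Real.exp (max (p r) 0 / 200)) * ‖f‖ := by gcongr; exact hT r
      _ = _ := by ring
  have hfC : ‖f‖ ≤ C₀ := by
    have : 0 ≤ (‖φ‖ + 1) * C * ‖f‖ := by positivity
    linarith
  have hCf : C * ‖f‖ ≤ C₀ := by
    have : 0 ≤ ‖φ‖ * (C * ‖f‖) := by positivity
    have := norm_nonneg f
    rw [hC₀]; linarith
  have hφC : ‖φ‖ * (C * ‖f‖) ≤ C₀ := by
    have : 0 ≤ C * ‖f‖ := by positivity
    have := norm_nonneg f
    rw [hC₀]; linarith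
  have hC₀0 : 0 < C₀ := by positivity
  refine ⟨C₀, ⟨hC₀0, fun r => ?_, fun i hi => ?_⟩, fun ℓ hℓ hann => ⟨by simp, fun l hl => ?_,
    fun m => ?_, fun m N B hB hi => ?_⟩⟩
  · calc ‖φ ((T ^ r) f.1)‖ ≤ ‖φ‖ * ‖(T ^ r) f.1‖ := φ.le_opNorm _
      _ ≤ ‖φ‖ * (C * ‖f‖ * Real.exp (max (p r) 0 / 200)) := by gcongr; exact hTf r
      _ = ‖φ‖ * (C * ‖f‖) * Real.exp (max (p r) 0 / 200) := by ring
      _ ≤ _ := by gcongr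
  · refine (W.norm_cy i hi _).trans ?_
    rw [mul_comm]
    gcongr
    exact hf2.trans hfC
  · rw [if_neg (by omega)]
    calc ‖ℓ (0, e l)‖ ≤ ‖ℓ‖ * ‖((0 : X), e l)‖ := ℓ.le_opNorm _
      _ ≤ 1 * ‖((0 : X), e l)‖ := by gcongr
      _ = _ := by rw [one_mul, Prod.norm_mk, norm_zero, max_eq_right (norm_nonneg _), W.norm_e l hl]
  · calc ‖ℓ ((T ^ m) f.1, 0)‖ ≤ ‖ℓ‖ * ‖((T ^ m) f.1, (0 : Y))‖ := ℓ.le_opNorm _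
      _ ≤ 1 * ‖((T ^ m) f.1, (0 : Y))‖ := by gcongr
      _ = ‖(T ^ m) f.1‖ := by
        rw [one_mul, Prod.norm_mk, norm_zero, max_eq_left (norm_nonneg _)]
      _ ≤ _ := (hTf m).trans (by gcongr)
  · set t := f.2 - ∑ i ∈ Finset.Icc 1 N, cy i f.2 • e i with ht
    have hft : f = (f.1, 0) + ∑ i ∈ Finset.Icc 1 N, cy i f.2 • ((0 : X), e i) + (0, t) := by
      ext <;> simp [Prod.fst_sum, Prod.snd_sum, ht]
    have h0 := hann m
    conv_lhs at h0 => rw [hft]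
    have hsum : ∀ i ∈ Finset.Icc 1 N, cy i f.2 • (L ^ m) ((0 : X), e i) =
        cy i f.2 • ((0 : X), e (i + m)) := fun i hi => by
      rw [W.L_pow_e m (Finset.mem_Icc.1 hi).1]
    simp only [map_add (L ^ m), map_sum (L ^ m), map_smul (L ^ m)] at h0
    rw [Finset.sum_congr rfl hsum, W.L_pow_left] at h0
    have hsplit : (((T ^ m) f.1, ∑ r ∈ Finset.range m, φ ((T ^ r) f.1) • e (m - r)) : X × Y) =
        ((T ^ m) f.1, 0) + ∑ r ∈ Finset.range m, φ ((T ^ r) f.1) • ((0 : X), e (m - r)) := by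
      ext <;> simp [Prod.fst_sum, Prod.snd_sum]
    rw [hsplit] at h0
    simp only [map_add, map_sum, map_smul, smul_eq_mul] at h0
    have e1 : ∑ r ∈ Finset.range m, φ ((T ^ r) f.1) * (if m - r = 0 then 0 else ℓ (0, e (m - r))) =
        ∑ r ∈ Finset.range m, φ ((T ^ r) f.1) * ℓ (0, e (m - r)) :=
      Finset.sum_congr rfl fun r hr => by
        have := Finset.mem_range.1 hr
        rw [if_neg (by omega)]
    have e2 : ∑ i ∈ Finset.Icc 1 N, cy i f.2 * (if i + m = 0 then 0 else ℓ (0, e (i + m))) =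
        ∑ i ∈ Finset.Icc 1 N, cy i f.2 * ℓ (0, e (i + m)) :=
      Finset.sum_congr rfl fun i hi => by
        have := Finset.mem_Icc.1 hi
        rw [if_neg (by omega)]
    rw [e1, e2, eq_neg_of_add_eq_zero_left h0, norm_neg]
    have hct : ∀ i, 1 ≤ i → i ≤ N → cy i t = 0 := fun i h1 h2 => by
      rw [ht, map_sub, map_sum]
      have : ∑ j ∈ Finset.Icc 1 N, cy i (cy j f.2 • e j) = cy i f.2 := by
        rw [Finset.sum_eq_single i]
        · simp [W.cy_e i i h1 h1]
        · intro j hj hji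
          simp [W.cy_e i j h1 (Finset.mem_Icc.1 hj).1, hji.symm]
        · intro hn; exact absurd (Finset.mem_Icc.2 ⟨h1, h2⟩) hn
      rw [this, sub_self]
    calc ‖ℓ ((L ^ m) (0, t))‖ ≤ ‖ℓ‖ * ‖(L ^ m) (0, t)‖ := ℓ.le_opNorm _
      _ ≤ 1 * (B * ‖t‖) := by gcongr; exact W.norm_L_pow m N B t hB hi hct
      _ ≤ 1 * (B * C₀) := by gcongr; exact (W.norm_tail _ _).trans (hf2.trans hfC)
      _ = C₀ * B := by ring

end BiShift

theorem exists_norm_sub_lt_of_dual {F : Type*} [NormedAddCommGroup F] [NormedSpace ℂ F]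
    {N : Submodule ℂ F} (hN : IsClosed (N : Set F)) {x : F} {δ : ℝ} (hδ : 0 < δ)
    (h : ∀ ℓ : F →L[ℂ] ℂ, ‖ℓ‖ ≤ 1 → (∀ y ∈ N, ℓ y = 0) → ‖ℓ x‖ ≤ δ) :
    ∃ y ∈ N, ‖x - y‖ < 2 * δ := by
  have : IsClosed (N : Set F) := hN
  have hq : ‖N.mkQ x‖ ≤ δ := by
    obtain ⟨g, hg1, hg2⟩ := exists_dual_vector'' ℂ (N.mkQ x)
    have hb : ∀ y, ‖(g.toLinearMap ∘ₗ N.mkQ) y‖ ≤ 1 * ‖y‖ := fun y => by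
      calc ‖g (N.mkQ y)‖ ≤ ‖g‖ * ‖N.mkQ y‖ := g.le_opNorm _
        _ ≤ 1 * ‖y‖ := by
          gcongr
          exact Submodule.Quotient.norm_mk_le _ _
    have := h ((g.toLinearMap ∘ₗ N.mkQ).mkContinuous 1 hb)
      (LinearMap.mkContinuous_norm_le _ zero_le_one _) (fun y hy => by
        have : N.mkQ y = 0 := by simpa using hy
        simp [this])
    have h2 : ‖g (N.mkQ x)‖ ≤ δ := this
    rw [hg2] at h2
    simpa using h2
  obtain ⟨z, hz, hlt⟩ := Submodule.Quotient.norm_mk_lt (S := N) (N.mkQ x) (ε := δ) hδ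
  refine ⟨x - z, ?_, by rw [sub_sub_cancel]; linarith⟩
  exact (Submodule.Quotient.eq N).1 hz.symm

namespace BiShift

variable {X Y : Type*} [NormedAddCommGroup X] [NormedSpace ℂ X]
  [NormedAddCommGroup Y] [NormedSpace ℂ Y]
  {p : ℕ → ℝ} {α A : ℝ} {L R : (X × Y) →L[ℂ] (X × Y)}
  {T : X →L[ℂ] X} {φ : X →L[ℂ] ℂ} {cy : ℕ → Y →L[ℂ] ℂ} {e : ℕ → Y}

theorem exists_near (W : BiShift p L R T φ cy e) (h : GoodWeight p α A)
    {N : Submodule ℂ (X × Y)} (hNc : IsClosed (N : Set (X × Y))) (hN0 : N ≠ ⊥)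
    (hN : ∀ q ∈ N, L q ∈ N) :
    ∃ l₀ : ℕ, ∀ l, l₀ ≤ l → ∃ q ∈ N, ‖((0 : X), e l) - q‖ ≤ 2 * Real.exp (3 / 5 * p l) := by
  obtain ⟨f, hf, hf0⟩ := Submodule.exists_mem_ne_zero_of_ne_bot hN0
  obtain ⟨C₀, H, hann⟩ := W.exists_coeffBound f
  obtain ⟨l₀, hl₀⟩ := Annih.exists_norm_le H h (by
    by_contra hcon
    push Not at hcon
    refine hf0 (Prod.ext (W.ext_fst _ hcon.1) (W.ext_snd _ hcon.2)))
  refine ⟨l₀ + 1, fun l hl => ?_⟩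
  obtain ⟨q, hq, hlt⟩ := exists_norm_sub_lt_of_dual hNc (x := ((0 : X), e l))
    (Real.exp_pos (3 / 5 * p l)) fun ℓ hℓ hℓN => by
      have := hl₀ _ _ (hann ℓ hℓ fun m => hℓN _ (L_pow_mem hN m hf)) l (by omega)
      rwa [if_neg (by omega)] at this
  exact ⟨q, hq, hlt.le⟩

set_option maxHeartbeats 1000000 in
/-- Modulo finitely many negative coordinates, a nonzero closed left-invariant subspace
exhausts the whole space. -/
theorem exists_add_eq [CompleteSpace X] [CompleteSpace Y] (W : BiShift p L R T φ cy e)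
    (h : GoodWeight p α A)
    {N : Submodule ℂ (X × Y)} (hNc : IsClosed (N : Set (X × Y))) (hN0 : N ≠ ⊥)
    (hN : ∀ q ∈ N, L q ∈ N) :
    ∃ k : ℕ, ∀ q : X × Y, ∃ n ∈ N, ∀ l, k < l → cy l (q - n).2 = 0 := by
  obtain ⟨l₀, hl₀⟩ := W.exists_near h hNc hN0 hN
  choose! w hwN hw using hl₀
  have hsum : Summable fun l : ℕ => 2 * Real.exp (-(2 / 5 * p l)) :=
    (h.summable_exp_neg (by norm_num)).mul_left 2
  obtain ⟨k, hk0, hk⟩ : ∃ k, l₀ ≤ k ∧ ∑' l, 2 * Real.exp (-(2 / 5 * p (l + (k + 1)))) < 1 := by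
    have := (tendsto_sum_nat_add fun l : ℕ => 2 * Real.exp (-(2 / 5 * p l))).comp
      (tendsto_add_atTop_nat 1)
    obtain ⟨k, hk⟩ := ((this.eventually (gt_mem_nhds one_pos)).and (eventually_ge_atTop l₀)).exists
    exact ⟨k, hk.2, hk.1⟩
  have hsk : Summable fun l : ℕ => 2 * Real.exp (-(2 / 5 * p (l + (k + 1)))) :=
    (summable_nat_add_iff (k + 1)).2 hsum
  refine ⟨k, fun q => ?_⟩
  let d : ℕ → (X × Y) := fun l => ((0 : X), e (l + (k + 1))) - w (l + (k + 1))
  let P : ℕ → (X × Y) →L[ℂ] (X × Y) := fun l =>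
    ((cy (l + (k + 1))).comp (ContinuousLinearMap.snd ℂ X Y)).smulRight (d l)
  have hP : ∀ l, ‖P l‖ ≤ 2 * Real.exp (-(2 / 5 * p (l + (k + 1)))) := fun l => by
    refine ContinuousLinearMap.opNorm_le_bound _ (by positivity) fun g => ?_
    have h1 := W.norm_cy (l + (k + 1)) (by omega) g.2
    have h2 := hw (l + (k + 1)) (by omega)
    calc ‖P l g‖ = ‖cy (l + (k + 1)) g.2‖ * ‖d l‖ := by simp [P, norm_smul]
      _ ≤ (Real.exp (-p (l + (k + 1))) * ‖g.2‖) * (2 * Real.exp (3 / 5 * p (l + (k + 1)))) := by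
        gcongr
      _ = 2 * (Real.exp (-p (l + (k + 1))) * Real.exp (3 / 5 * p (l + (k + 1)))) * ‖g.2‖ := by ring
      _ = 2 * Real.exp (-(2 / 5 * p (l + (k + 1)))) * ‖g.2‖ := by
        rw [← Real.exp_add]; ring_nf
      _ ≤ _ := by gcongr; exact norm_snd_le g
  have hPs : Summable fun l => ‖P l‖ := Summable.of_nonneg_of_le (fun _ => norm_nonneg _) hP hsk
  have hPn : ‖∑' l, P l‖ < 1 :=
    ((norm_tsum_le_tsum_norm hPs).trans (hPs.tsum_le_tsum hP hsk)).trans_lt hk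
  obtain ⟨U, hU⟩ := isUnit_one_sub_of_norm_lt_one hPn
  set g : X × Y := (↑U⁻¹ : (X × Y) →L[ℂ] (X × Y)) q with hg
  have hgq : g - (∑' l, P l) g = q := by
    have : ((U : (X × Y) →L[ℂ] (X × Y)) * ↑U⁻¹) q = q := by simp
    rwa [mul_apply_eq_comp, ← hg, hU] at this
  have hPg : HasSum (fun l => P l g) ((∑' l, P l) g) :=
    hPs.of_norm.hasSum.mapL (ContinuousLinearMap.apply ℂ (X × Y) g)
  -- the partial sums of the `N`-part
  let s : ℕ → X × Y := fun n => ∑ l ∈ Finset.range n, cy (l + (k + 1)) g.2 • w (l + (k + 1))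
  have hs : Tendsto s atTop (𝓝 (((0 : X), g.2 - ∑ i ∈ Finset.range k, cy (i + 1) g.2 • e (i + 1)) -
      (∑' l, P l) g)) := by
    have h1 : Tendsto (fun n => ((0 : X), ∑ i ∈ Finset.range (n + k), cy (i + 1) g.2 • e (i + 1) -
        ∑ i ∈ Finset.range k, cy (i + 1) g.2 • e (i + 1))) atTop
        (𝓝 ((0 : X), g.2 - ∑ i ∈ Finset.range k, cy (i + 1) g.2 • e (i + 1))) :=
      tendsto_const_nhds.prodMk_nhds
        (((W.tendsto_tail g.2).comp (tendsto_add_atTop_nat k)).sub_const _)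
    refine (h1.sub hPg.tendsto_sum_nat).congr fun n => ?_
    have h2 : ∑ i ∈ Finset.range (n + k), cy (i + 1) g.2 • e (i + 1) -
        ∑ i ∈ Finset.range k, cy (i + 1) g.2 • e (i + 1) =
        ∑ l ∈ Finset.range n, cy (l + (k + 1)) g.2 • e (l + (k + 1)) := by
      rw [add_comm n k, Finset.sum_range_add, add_sub_cancel_left]
      exact Finset.sum_congr rfl fun l _ => by rw [show k + l + 1 = l + (k + 1) by omega]
    rw [h2]
    have h3 : ((0 : X), ∑ l ∈ Finset.range n, cy (l + (k + 1)) g.2 • e (l + (k + 1))) =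
        ∑ l ∈ Finset.range n, cy (l + (k + 1)) g.2 • ((0 : X), e (l + (k + 1))) := by
      ext <;> simp [Prod.fst_sum, Prod.snd_sum]
    rw [h3, ← Finset.sum_sub_distrib]
    refine Finset.sum_congr rfl fun l _ => ?_
    simp [P, d, smul_sub]
  refine ⟨_, hNc.mem_of_tendsto hs (Eventually.of_forall fun n => N.sum_mem fun l _ =>
    N.smul_mem _ (hwN _ (by omega))), fun l hl => ?_⟩
  have : q - (((0 : X), g.2 - ∑ i ∈ Finset.range k, cy (i + 1) g.2 • e (i + 1)) - (∑' l, P l) g) =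
      (g.1, ∑ i ∈ Finset.range k, cy (i + 1) g.2 • e (i + 1)) := by
    rw [← hgq]
    ext <;> simp
  rw [this]
  simp only [map_sum, map_smul]
  refine Finset.sum_eq_zero fun i hi => ?_
  have := Finset.mem_range.1 hi
  rw [W.cy_e l (i + 1) (by omega) (by omega), if_neg (by omega), smul_zero]

theorem R_pow_snd_eq_zero (W : BiShift p L R T φ cy e) {k : ℕ} {q : X × Y}
    (hq : ∀ l, k < l → cy l q.2 = 0) : ((R ^ k) q).2 = 0 :=
  W.ext_snd _ fun l hl => by rw [W.cy_R_pow k hl]; exact hq _ (by omega)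

theorem R_left (W : BiShift p L R T φ cy e) {q : X × Y} (hq : q.2 = 0) : (R q).2 = 0 := by
  have := W.R_pow_snd_eq_zero (k := 1) (q := q) fun l _ => by rw [hq, map_zero]
  simpa using this

theorem L_pow_left_cy (W : BiShift p L R T φ cy e) {k l : ℕ} (hl : k < l) {q : X × Y}
    (hq : q.2 = 0) : cy l ((L ^ k) q).2 = 0 := by
  obtain ⟨i, rfl⟩ : ∃ i, l = i + k := ⟨l - k, by omega⟩
  rw [W.cy_L_pow k (by omega), hq, map_zero]

/-- The shape of a nonzero closed left-invariant subspace. -/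
theorem exists_analytic [CompleteSpace X] [CompleteSpace Y] (W : BiShift p L R T φ cy e)
    (h : GoodWeight p α A) {N : Submodule ℂ (X × Y)} (hNc : IsClosed (N : Set (X × Y)))
    (hN0 : N ≠ ⊥) (hN : ∀ q ∈ N, L q ∈ N) :
    ∃ k : ℕ,
      (∃ q ∈ N.map ((R ^ k : (X × Y) →L[ℂ] (X × Y)) : (X × Y) →ₗ[ℂ] (X × Y)),
        q ≠ 0 ∧ q.2 = 0)
      ∧ N.map ((R ^ k : (X × Y) →L[ℂ] (X × Y)) : (X × Y) →ₗ[ℂ] (X × Y))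
          ⊔ LinearMap.ker (LinearMap.snd ℂ X Y) = ⊤
      ∧ N = Submodule.topologicalClosure
          (⨆ n : ℕ,
            (N.map ((R ^ k : (X × Y) →L[ℂ] (X × Y)) : (X × Y) →ₗ[ℂ] (X × Y))
                ⊓ LinearMap.ker (LinearMap.snd ℂ X Y)).map
              ((L ^ (k + n) : (X × Y) →L[ℂ] (X × Y)) : (X × Y) →ₗ[ℂ] (X × Y))) := by
  obtain ⟨k, hk⟩ := W.exists_add_eq h hNc hN0 hN
  -- an element of `N` whose last nonzero negative coordinate is at `k + 1`
  obtain ⟨n₀, hn₀, hn₀c⟩ := hk ((0 : X), e (k + 1))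
  have hn₀1 : cy (k + 1) n₀.2 = 1 := by
    have := hn₀c (k + 1) (by omega)
    rw [Prod.snd_sub, map_sub, W.cy_e _ _ (by omega) (by omega), if_pos rfl, sub_eq_zero] at this
    exact this.symm
  have hn₀2 : ∀ l, k + 1 < l → cy l n₀.2 = 0 := fun l hl => by
    have := hn₀c l (by omega)
    rw [Prod.snd_sub, map_sub, W.cy_e _ _ (by omega) (by omega), if_neg (by omega), sub_eq_zero] at this
    exact this.symm
  set K := k + 1 with hK
  set N' := N.map ((R ^ K : (X × Y) →L[ℂ] (X × Y)) : (X × Y) →ₗ[ℂ] (X × Y)) with hN'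
  have memN' : ∀ q, q ∈ N' ↔ (L ^ K) q ∈ N := fun q => by
    rw [hN', Submodule.mem_map]
    constructor
    · rintro ⟨n, hn, rfl⟩
      have : (L ^ K) ((R ^ K) n) = n := W.L_pow_R_pow K n
      rwa [ContinuousLinearMap.coe_coe, this]
    · intro hq
      exact ⟨_, hq, W.R_pow_L_pow K q⟩
  set g := (R ^ K) n₀ with hg
  have hgN : g ∈ N' := (memN' g).2 (by rwa [hg, W.L_pow_R_pow])
  have hg2 : g.2 = 0 := W.R_pow_snd_eq_zero hn₀2
  have hφg : φ g.1 = 1 := by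
    rw [← W.cy_L_pow_self (m := K) (by omega) g, hg, W.L_pow_R_pow, hn₀1]
  have hg0 : g ≠ 0 := fun h0 => by rw [h0] at hφg; simp at hφg
  set E : Submodule ℂ (X × Y) := LinearMap.ker (LinearMap.snd ℂ X Y) with hE
  have memE : ∀ q, q ∈ E ↔ q.2 = 0 := fun q => by rw [hE, LinearMap.mem_ker]; rfl
  refine ⟨K, ⟨g, hgN, hg0, hg2⟩, ?_, ?_⟩
  · rw [eq_top_iff]
    intro q _
    obtain ⟨n, hn, hnc⟩ := hk ((L ^ K) q)
    refine Submodule.mem_sup.2 ⟨(R ^ K) n, (memN' _).2 (by rwa [W.L_pow_R_pow]), q - (R ^ K) n, ?_,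
      add_sub_cancel _ _⟩
    rw [memE]
    have : q - (R ^ K) n = (R ^ K) ((L ^ K) q - n) := by rw [map_sub, W.R_pow_L_pow]
    rw [this]
    exact W.R_pow_snd_eq_zero fun l hl => hnc l (by omega)
  · set M := N' ⊓ E with hM
    set Q : ℕ → Submodule ℂ (X × Y) := fun n =>
      M.map ((L ^ n : (X × Y) →L[ℂ] (X × Y)) : (X × Y) →ₗ[ℂ] (X × Y)) with hQ
    set N₁ := (⨆ n, Q n).topologicalClosure with hN₁
    have hQN₁ : ∀ n q, q ∈ M → (L ^ n) q ∈ N₁ := fun n q hq =>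
      Submodule.le_topologicalClosure _ (Submodule.mem_iSup_of_mem n ⟨q, hq, rfl⟩)
    have hgM : g ∈ M := ⟨hgN, (memE g).2 hg2⟩
    have hN₁0 : N₁ ≠ ⊥ := fun h0 => by
      have := hQN₁ 0 g hgM
      rw [h0] at this
      exact hg0 (by simpa using this)
    have hN₁L : ∀ q ∈ N₁, L q ∈ N₁ := by
      have hsub : ∀ q ∈ ⨆ n, Q n, L q ∈ ⨆ n, Q n := by
        intro q hq
        have : (⨆ n, Q n) ≤ (⨆ n, Q n).comap (L : (X × Y) →ₗ[ℂ] (X × Y)) := by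
          refine iSup_le fun n => ?_
          rintro _ ⟨x, hx, rfl⟩
          refine Submodule.mem_iSup_of_mem (n + 1) ⟨x, hx, ?_⟩
          simp only [ContinuousLinearMap.coe_coe]
          rw [pow_succ', mul_apply_eq_comp]
        exact this hq
      intro q hq
      exact map_mem_closure L.continuous hq hsub
    obtain ⟨k₁, hk₁⟩ := W.exists_add_eq h (Submodule.isClosed_topologicalClosure _) hN₁0 hN₁L
    have hdown : ∀ j : ℕ, ∀ q : X × Y, (∀ l, j < l → cy l q.2 = 0) →
        ∃ n ∈ N₁, (q - n).2 = 0 := by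
      intro j
      induction j with
      | zero => exact fun q hq => ⟨0, N₁.zero_mem, by
          rw [sub_zero]; exact W.ext_snd _ fun l hl => hq l hl⟩
      | succ j ih =>
        intro q hq
        obtain ⟨n, hn, hqn⟩ := ih (q - cy (j + 1) q.2 • (L ^ (j + 1)) g) fun l hl => by
          rw [Prod.snd_sub, Prod.smul_snd, map_sub, map_smul]
          rcases Nat.lt_or_ge (j + 1) l with h1 | h1
          · rw [hq l h1, W.L_pow_left_cy h1 hg2, smul_zero, sub_zero]
          · obtain rfl : l = j + 1 := by omega
            rw [W.cy_L_pow_self (by omega), hφg, smul_eq_mul, mul_one, sub_self]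
        refine ⟨cy (j + 1) q.2 • (L ^ (j + 1)) g + n,
          N₁.add_mem (N₁.smul_mem _ (hQN₁ _ _ hgM)) hn, ?_⟩
        rwa [← sub_sub]
    have hN₁N' : ∀ q ∈ N₁, (L ^ K) q ∈ N := by
      have hsub : ∀ q ∈ ⨆ n, Q n, (L ^ K) q ∈ N := by
        intro q hq
        have : (⨆ n, Q n) ≤ N.comap ((L ^ K : (X × Y) →L[ℂ] (X × Y)) : (X × Y) →ₗ[ℂ] (X × Y)) := by
          refine iSup_le fun n => ?_
          rintro _ ⟨x, hx, rfl⟩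
          have hx1 : (L ^ K) x ∈ N := (memN' x).1 hx.1
          have := L_pow_mem hN n hx1
          rw [← mul_apply_eq_comp, ← pow_add, add_comm, pow_add, mul_apply_eq_comp] at this
          exact this
        exact this hq
      intro q hq
      have := map_mem_closure (L ^ K).continuous hq hsub
      rwa [hNc.closure_eq] at this
    have hN'N₁ : ∀ q ∈ N', q ∈ N₁ := by
      intro q hq
      obtain ⟨n, hn, hnc⟩ := hk₁ q
      obtain ⟨n', hn', hnc'⟩ := hdown k₁ _ hnc
      have hsum : n + n' ∈ N₁ := N₁.add_mem hn hn'
      rw [sub_sub] at hnc'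
      have hM' : q - (n + n') ∈ M := ⟨N'.sub_mem hq ((memN' _).2 (hN₁N' _ hsum)), (memE _).2 hnc'⟩
      have := hQN₁ 0 _ hM'
      rw [pow_zero, one_apply_eq_self] at this
      have := N₁.add_mem this hsum
      rwa [sub_add_cancel] at this
    apply le_antisymm
    · intro q hq
      have h1 : (R ^ K) q ∈ N₁ := hN'N₁ _ ((memN' _).2 (by rwa [W.L_pow_R_pow]))
      have hsub : ∀ x ∈ ⨆ n, Q n, (L ^ K) x ∈ ⨆ n, M.map
          ((L ^ (K + n) : (X × Y) →L[ℂ] (X × Y)) : (X × Y) →ₗ[ℂ] (X × Y)) := by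
        intro x hx
        have : (⨆ n, Q n) ≤ (⨆ n, M.map
          ((L ^ (K + n) : (X × Y) →L[ℂ] (X × Y)) : (X × Y) →ₗ[ℂ] (X × Y))).comap
          ((L ^ K : (X × Y) →L[ℂ] (X × Y)) : (X × Y) →ₗ[ℂ] (X × Y)) := by
          refine iSup_le fun n => ?_
          rintro _ ⟨x, hx, rfl⟩
          refine Submodule.mem_iSup_of_mem n ⟨x, hx, ?_⟩
          simp only [ContinuousLinearMap.coe_coe]
          rw [pow_add, mul_apply_eq_comp]
        exact this hx
      have := map_mem_closure (L ^ K).continuous h1 hsub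
      rwa [W.L_pow_R_pow] at this
    · refine Submodule.topologicalClosure_minimal _ (iSup_le fun n => ?_) hNc
      rintro _ ⟨x, hx, rfl⟩
      have hx1 : (L ^ K) x ∈ N := (memN' x).1 hx.1
      have := L_pow_mem hN n hx1
      rwa [← mul_apply_eq_comp, ← pow_add, add_comm] at this

/-- Resolvent of the right shift on a left-invariant subspace. -/
theorem exists_resolvent [CompleteSpace X] [CompleteSpace Y] (W : BiShift p L R T φ cy e)
    (h : GoodWeight p α A) {N : Submodule ℂ (X × Y)} (hNc : IsClosed (N : Set (X × Y)))
    (hN : ∀ q ∈ N, L q ∈ N) {q : X × Y} (hq : q ∈ N) (hq2 : q.2 = 0) {lam : ℂ} (hlam : ‖lam‖ < 1) :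
    ∃ g ∈ N, R g - lam • g = q := by
  obtain ⟨C, hC, hT⟩ := W.T_le
  obtain ⟨ρ, hρl, hρ1⟩ := exists_between (max_lt hlam one_pos)
  have hρ0 : 0 < ρ := (le_max_right _ _).trans_lt hρl
  have hlρ : ‖lam‖ ≤ ρ := ((le_max_left _ _).trans_lt hρl).le
  set y := -Real.log ρ with hy
  have hy0 : 0 < y := by have := Real.log_neg hρ0 hρ1; linarith
  have hexp : ∀ r : ℕ, Real.exp (-(r * y)) = ρ ^ r := fun r => by
    rw [hy, mul_neg, neg_neg, Real.exp_nat_mul, Real.exp_log hρ0]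
  have hs := h.summable_exp hy0
  simp only [hexp] at hs
  set a : ℕ → ℝ := fun r => Real.exp (max (p r) 0) * ρ ^ r with ha
  have ha0 : ∀ r, 0 ≤ a r := fun r => by positivity
  have hTr : ∀ r, ‖(T ^ r) q.1‖ * ρ ^ r ≤ C * ‖q.1‖ * a r := fun r => by
    have h1 : Real.exp (max (p r) 0 / 200) ≤ Real.exp (max (p r) 0) := by
      have := le_max_right (p r) 0
      exact Real.exp_le_exp.2 (by linarith)
    calc ‖(T ^ r) q.1‖ * ρ ^ r ≤ (‖T ^ r‖ * ‖q.1‖) * ρ ^ r := by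
          gcongr; exact ContinuousLinearMap.le_opNorm _ _
      _ ≤ (C * Real.exp (max (p r) 0)) * ‖q.1‖ * ρ ^ r := by
          gcongr; exact (hT r).trans (by gcongr)
      _ = _ := by rw [ha]; ring
  have hconv : Summable fun n => ∑ r ∈ Finset.range (n + 1), a r * a (n - r) := by
    have hn : Summable fun r => ‖a r‖ := hs.norm
    exact (summable_norm_sum_mul_range_of_summable_norm hn hn).of_norm
  have hmaj : ∀ n, ‖lam ^ n • (L ^ n) q‖ ≤ C * ‖q.1‖ * a n +
      ‖φ‖ * (C * ‖q.1‖) * ∑ r ∈ Finset.range (n + 1), a r * a (n - r) := fun n => by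
    have hqe : q = (q.1, 0) := Prod.ext rfl hq2
    have h2 : ∀ r ∈ Finset.range n, ‖φ ((T ^ r) q.1) • e (n - r)‖ * ρ ^ n ≤
        ‖φ‖ * (C * ‖q.1‖) * (a r * a (n - r)) := fun r hr => by
      have hrn := Finset.mem_range.1 hr
      rw [norm_smul, W.norm_e _ (by omega)]
      have e1 : ρ ^ n = ρ ^ r * ρ ^ (n - r) := by rw [← pow_add]; congr 1; omega
      rw [e1]
      calc ‖φ ((T ^ r) q.1)‖ * Real.exp (p (n - r)) * (ρ ^ r * ρ ^ (n - r))
          ≤ (‖φ‖ * ‖(T ^ r) q.1‖) * Real.exp (max (p (n - r)) 0) * (ρ ^ r * ρ ^ (n - r)) := by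
            gcongr
            · exact φ.le_opNorm _
            · exact le_max_left _ _
        _ = ‖φ‖ * (‖(T ^ r) q.1‖ * ρ ^ r) * a (n - r) := by rw [ha]; ring
        _ ≤ ‖φ‖ * (C * ‖q.1‖ * a r) * a (n - r) := by
            exact mul_le_mul_of_nonneg_right
              (mul_le_mul_of_nonneg_left (hTr r) (norm_nonneg _)) (ha0 _)
        _ = _ := by ring
    have h3 : ‖(L ^ n) q‖ ≤ ‖(T ^ n) q.1‖ + ∑ r ∈ Finset.range n, ‖φ ((T ^ r) q.1) • e (n - r)‖ := by
      conv_lhs => rw [hqe]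
      rw [W.L_pow_left, Prod.norm_mk]
      refine (max_le_add_of_nonneg (norm_nonneg _) (norm_nonneg _)).trans ?_
      gcongr
      exact norm_sum_le _ _
    rw [norm_smul, norm_pow, mul_comm]
    calc ‖(L ^ n) q‖ * ‖lam‖ ^ n ≤
          (‖(T ^ n) q.1‖ + ∑ r ∈ Finset.range n, ‖φ ((T ^ r) q.1) • e (n - r)‖) * ρ ^ n := by gcongr
      _ = ‖(T ^ n) q.1‖ * ρ ^ n + ∑ r ∈ Finset.range n, ‖φ ((T ^ r) q.1) • e (n - r)‖ * ρ ^ n := by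
          rw [add_mul, Finset.sum_mul]
      _ ≤ C * ‖q.1‖ * a n + ∑ r ∈ Finset.range n, ‖φ‖ * (C * ‖q.1‖) * (a r * a (n - r)) :=
          add_le_add (hTr n) (Finset.sum_le_sum h2)
      _ ≤ _ := by
          rw [← Finset.mul_sum]
          gcongr
          exact Nat.le_succ n
  have hsum : Summable fun n => lam ^ n • (L ^ n) q :=
    Summable.of_norm_bounded ((hs.mul_left _).add (hconv.mul_left _)) hmaj
  set s := ∑' n, lam ^ n • (L ^ n) q with hsdef
  have hsN : s ∈ N := hNc.mem_of_tendsto hsum.hasSum.tendsto_sum_nat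
    (Eventually.of_forall fun n => N.sum_mem fun i _ => N.smul_mem _ (L_pow_mem hN i hq))
  refine ⟨L s, hN _ hsN, ?_⟩
  rw [W.R_L]
  have hLs : lam • L s = ∑' n, lam ^ (n + 1) • (L ^ (n + 1)) q := by
    rw [hsdef, L.map_tsum hsum, ← (hsum.mapL L).tsum_const_smul lam]
    refine tsum_congr fun n => ?_
    rw [map_smul, smul_smul, ← pow_succ', pow_succ' L, mul_apply_eq_comp]
  rw [hLs, hsdef, hsum.tsum_eq_zero_add]
  simp

end BiShift

theorem zero_mem_unitBall : (0 : ℂ) ∈ ball (0 : ℂ) 1 := mem_ball_self one_pos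

theorem unitBall_mem_nhds {z : ℂ} (hz : z ∈ ball (0 : ℂ) 1) : ball (0 : ℂ) 1 ∈ 𝓝 z :=
  isOpen_ball.mem_nhds hz

namespace HolDisc

variable {f : ℂ → ℂ}

theorem analyticAt (hf : f ∈ HolDisc) {z : ℂ} (hz : z ∈ ball (0 : ℂ) 1) : AnalyticAt ℂ f z :=
  hf.1.analyticAt (unitBall_mem_nhds hz)

theorem contDiffAt (hf : f ∈ HolDisc) {n : ℕ} : ContDiffAt ℂ n f 0 :=
  (analyticAt hf zero_mem_unitBall).contDiffAt

end HolDisc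

theorem fdivB_zero_mul {f : ℂ → ℂ} {z : ℂ} (hz : z ∈ ball (0 : ℂ) 1) :
    f z = f 0 + z * fdivB 0 f z := by
  unfold fdivB
  rw [if_pos hz]
  split_ifs with h
  · rw [h]; simp
  · rw [sub_zero, mul_div_cancel₀ _ h]; ring

/-- `fdivB lam f` is characterized by `(z - lam) g(z) = f(z) - f(lam)`. -/
theorem eq_fdivB {f g : ℂ → ℂ} {lam : ℂ} (hg : g ∈ HolDisc) (hlam : lam ∈ ball (0 : ℂ) 1)
    (h : ∀ z ∈ ball (0 : ℂ) 1, f z = f lam + (z - lam) * g z) : g = fdivB lam f := by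
  funext z
  unfold fdivB
  by_cases hz : z ∈ ball (0 : ℂ) 1
  · rw [if_pos hz]
    split_ifs with hzl
    · subst hzl
      have h1 : f =ᶠ[𝓝 z] fun w => f z + (w - z) * g w :=
        eventually_of_mem (unitBall_mem_nhds hlam) h
      rw [h1.deriv_eq]
      have hd := (HolDisc.analyticAt hg hlam).differentiableAt.hasDerivAt
      have := (((hasDerivAt_id z).sub_const z).mul hd).const_add (f z)
      simpa using this.deriv.symm
    · rw [h z hz, add_sub_cancel_left, mul_div_cancel_left₀ _ (sub_ne_zero.2 hzl)]
  · rw [if_neg hz, hg.2 z hz]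

theorem oneD_mem : oneD ∈ HolDisc := by
  refine ⟨(differentiableOn_const 1).congr fun z hz => ?_, fun z hz => ?_⟩
  · exact if_pos hz
  · exact if_neg hz

theorem oneD_apply {z : ℂ} (hz : z ∈ ball (0 : ℂ) 1) : oneD z = 1 := if_pos hz

theorem tCoeff_congr {f g : ℂ → ℂ} (h : f =ᶠ[𝓝 0] g) (n : ℕ) : tCoeff n f = tCoeff n g := by
  rw [tCoeff, tCoeff, h.iteratedDeriv_eq]

theorem tCoeff_zero (f : ℂ → ℂ) : tCoeff 0 f = f 0 := by simp [tCoeff]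

theorem tCoeff_one (f : ℂ → ℂ) : tCoeff 1 f = deriv f 0 := by simp [tCoeff]

theorem tCoeff_mul_id {h : ℂ → ℂ} (hh : AnalyticAt ℂ h 0) (n : ℕ) :
    tCoeff (n + 1) (fun z => z * h z) = tCoeff n h := by
  have h1 : iteratedDeriv (n + 1) (fun z => z * h z) 0 = (n + 1) * iteratedDeriv n h 0 := by
    have := iteratedDerivWithin_mul (n := n + 1) (𝕜 := ℂ) (s := univ) (x := 0) (mem_univ _)
      uniqueDiffOn_univ (f := fun z : ℂ => z) (g := h) (by fun_prop)
      (hh.contDiffAt (n := (n + 1 : ℕ))).contDiffWithinAt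
    simp only [iteratedDerivWithin_univ] at this
    refine this.trans ?_
    rw [Finset.sum_eq_single 1]
    · simp
    · intro i _ hi
      rcases i with _ | _ | i
      · simp
      · exact absurd rfl hi
      · have : iteratedDeriv (i + 1 + 1) (fun z : ℂ => z) 0 = 0 := by
          rw [iteratedDeriv_succ']
          simp [iteratedDeriv_succ']
        rw [this]; simp
    · simp
  rw [tCoeff, tCoeff, h1, Nat.factorial_succ]
  have : (n.factorial : ℂ) ≠ 0 := Nat.cast_ne_zero.2 n.factorial_ne_zero
  have h2 : ((n : ℂ) + 1) ≠ 0 := Nat.cast_add_one_ne_zero n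
  push_cast
  field_simp

theorem tCoeff_add {f g : ℂ → ℂ} (hf : f ∈ HolDisc) (hg : g ∈ HolDisc) (n : ℕ) :
    tCoeff n (f + g) = tCoeff n f + tCoeff n g := by
  rw [tCoeff, iteratedDeriv_add (HolDisc.contDiffAt hf) (HolDisc.contDiffAt hg), add_div]
  rfl

theorem tCoeff_smul (c : ℂ) (f : ℂ → ℂ) (n : ℕ) : tCoeff n (c • f) = c * tCoeff n f := by
  rw [tCoeff, iteratedDeriv_const_smul_field, smul_eq_mul, mul_div_assoc]
  rfl

theorem tCoeff_const (a : ℂ) (n : ℕ) : tCoeff (n + 1) (fun _ => a) = 0 := by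
  simp [tCoeff, iteratedDeriv_succ']

theorem tCoeff_pow (l m : ℕ) : tCoeff m (fun z => z ^ l) = if m = l then 1 else 0 := by
  induction l generalizing m with
  | zero =>
    rcases m with _ | m
    · simp [tCoeff_zero]
    · simpa using tCoeff_const 1 m
  | succ l ih =>
    rcases m with _ | m
    · simp [tCoeff_zero]
    · have := tCoeff_mul_id (h := fun z : ℂ => z ^ l) (by fun_prop) m
      simp only [← pow_succ'] at this
      rw [this, ih]
      simp

/-- Monomials in the disc model. -/
def monoD (l : ℕ) : ℂ → ℂ := fun z => z ^ l * oneD z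

theorem monoD_mem (l : ℕ) : monoD l ∈ HolDisc :=
  ⟨(differentiableOn_id.pow l).mul oneD_mem.1, fun z hz => by simp [monoD, oneD_mem.2 z hz]⟩

theorem tCoeff_monoD (l m : ℕ) : tCoeff m (monoD l) = if m = l then 1 else 0 := by
  rw [← tCoeff_pow]
  refine tCoeff_congr ?_ m
  filter_upwards [unitBall_mem_nhds zero_mem_unitBall] with z hz
  simp [monoD, oneD_apply hz]

theorem negShiftF_tCoeff {k : ℂ → ℂ} (h0 : negShiftF k ∈ HolDisc) {l : ℕ}
    (hl : 1 ≤ l) : tCoeff l (negShiftF k) = tCoeff (l + 1) k := by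
  have hg : AnalyticAt ℂ (fun z => negShiftF k z + deriv k 0) 0 :=
    (HolDisc.analyticAt h0 zero_mem_unitBall).add analyticAt_const
  obtain ⟨n, rfl⟩ : ∃ n, l = n + 1 := ⟨l - 1, by omega⟩
  have h1 : k =ᶠ[𝓝 0] (fun _ => k 0) + fun z => z * (negShiftF k z + deriv k 0) := by
    filter_upwards [unitBall_mem_nhds zero_mem_unitBall] with z hz
    rw [Pi.add_apply, fdivB_zero_mul hz (f := k)]
    simp [negShiftF, oneD_apply hz]
  have split : ∀ (a : ℂ) (g : ℂ → ℂ), AnalyticAt ℂ g 0 → ∀ m,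
      tCoeff (m + 1) ((fun _ => a) + g) = tCoeff (m + 1) g := fun a g hg m => by
    rw [tCoeff, iteratedDeriv_add contDiffAt_const hg.contDiffAt, add_div]
    have := tCoeff_const a m
    rw [tCoeff] at this
    rw [this, zero_add]; rfl
  rw [tCoeff_congr h1,
    split (k 0) (fun z => z * (negShiftF k z + deriv k 0)) (analyticAt_id.mul hg), tCoeff_mul_id hg]
  have h2 : (fun z => negShiftF k z + deriv k 0) = (fun _ => deriv k 0) + negShiftF k := by
    funext z; simp [add_comm]
  rw [h2, split _ _ (HolDisc.analyticAt h0 zero_mem_unitBall)]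

/-- A function in the disc algebra model all of whose iterated backward shifts vanish at `0`
is zero. -/
theorem eq_zero_of_backward {f : ℕ → ℂ → ℂ} (hf : ∀ r, f r ∈ HolDisc)
    (hs : ∀ r, ∀ z ∈ ball (0 : ℂ) 1, f r z = z * f (r + 1) z) : f 0 = 0 := by
  have hpow : ∀ r, ∀ z ∈ ball (0 : ℂ) 1, f 0 z = z ^ r * f r z := by
    intro r
    induction r with
    | zero => simp
    | succ r ih => intro z hz; rw [ih z hz, hs r z hz, pow_succ, mul_assoc]
  have han := HolDisc.analyticAt (hf 0) zero_mem_unitBall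
  have hord : analyticOrderAt (f 0) 0 = ⊤ := by
    refine ENat.eq_top_iff_forall_ge.2 fun n => ?_
    rw [natCast_le_analyticOrderAt han]
    refine ⟨f n, HolDisc.analyticAt (hf n) zero_mem_unitBall, ?_⟩
    filter_upwards [unitBall_mem_nhds zero_mem_unitBall] with z hz
    simpa using hpow n z hz
  rw [analyticOrderAt_eq_top] at hord
  have hon : AnalyticOnNhd ℂ (f 0) (ball (0 : ℂ) 1) := fun z hz => HolDisc.analyticAt (hf 0) hz
  have := hon.eqOn_zero_of_preconnected_of_eventuallyEq_zero
    (convex_ball (0 : ℂ) 1).isPreconnected zero_mem_unitBall hord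
  funext z
  by_cases hz : z ∈ ball (0 : ℂ) 1
  · exact this hz
  · exact (hf 0).2 z hz

/-- The logarithm of a regular weight satisfying the growth hypotheses is a good weight. -/
theorem goodWeight_log {sv : ℕ → ℝ} (hpos : ∀ n, 1 ≤ n → 0 < sv n)
    (hreg : ∀ ε : ℝ, 0 < ε → ∃ C : ℝ, 0 < C ∧ ∀ m n : ℕ, 1 ≤ n →
      sv n / sv (n + m) ≤ C * (1 + ε) ^ m ∧ sv (n + m) / sv n ≤ C * (1 + ε) ^ m)
    {α : ℝ} (hα : 1 < α) (hi : ∃ N₀ : ℕ, ∀ n, N₀ ≤ n → 1 ≤ n →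
      (sv n / (n : ℝ) ^ α) * (sv (n + 2) / ((n : ℝ) + 2) ^ α)
        ≤ (sv (n + 1) / ((n : ℝ) + 1) ^ α) * (sv (n + 1) / ((n : ℝ) + 1) ^ α))
    {A : ℝ} (hA : 0 < A) (hii : ∃ N₁ : ℕ, ∀ n, N₁ ≤ n → 1 ≤ n →
      Real.log (sv n) * (Real.log n) ^ A / (n : ℝ)
        ≤ Real.log (sv (n + 1)) * (Real.log ((n : ℝ) + 1)) ^ A / ((n : ℝ) + 1))
    (hiii : Tendsto
      (fun N : ℕ => ∑ n ∈ Finset.range N, Real.log (sv (n + 1)) / ((n : ℝ) + 1) ^ 2)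
      atTop atTop) : GoodWeight (fun n => Real.log (sv n)) α A := by
  refine ⟨hα, hA, ?_, ?_, hiii, ?_⟩
  · obtain ⟨N₀, h⟩ := hi
    refine ⟨N₀ + 1, by omega, fun n hn => ?_⟩
    have h1 := h n (by omega) (by omega)
    have hn0 : (0 : ℝ) < n := by exact_mod_cast (by omega : 0 < n)
    have s0 := hpos n (by omega)
    have s1 := hpos (n + 1) (by omega)
    have s2 := hpos (n + 2) (by omega)
    have log_div : ∀ {s x : ℝ}, 0 < s → 0 < x →
        Real.log (s / x ^ α) = Real.log s - α * Real.log x := fun hs hx => by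
      rw [Real.log_div hs.ne' (Real.rpow_pos_of_pos hx _).ne', Real.log_rpow hx]
    have pos : ∀ {s x : ℝ}, 0 < s → 0 < x → 0 < s / x ^ α := fun hs hx =>
      div_pos hs (Real.rpow_pos_of_pos hx _)
    have x1 : (0 : ℝ) < n + 1 := by linarith
    have x2 : (0 : ℝ) < n + 2 := by linarith
    have h2 := Real.log_le_log (mul_pos (pos s0 hn0) (pos s2 x2)) h1
    rw [Real.log_mul (pos s0 hn0).ne' (pos s2 x2).ne', Real.log_mul (pos s1 x1).ne' (pos s1 x1).ne',
      log_div s0 hn0, log_div s1 x1, log_div s2 x2] at h2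
    have e2 : ((n : ℝ) + 1 + 1) = n + 2 := by ring
    simp only [logIncr]
    push_cast
    rw [e2]
    linarith
  · obtain ⟨N₁, h⟩ := hii
    exact ⟨N₁ + 1, by omega, fun n hn => h n (by omega) (by omega)⟩
  · rw [Metric.tendsto_atTop]
    intro δ hδ
    have hε : 0 < Real.exp (δ / 2) - 1 := by
      have := Real.add_one_lt_exp (x := δ / 2) (by positivity)
      linarith
    obtain ⟨C, hC, h⟩ := hreg _ hε
    set D := |Real.log C| + |Real.log (sv 1)| with hD
    obtain ⟨N, hN⟩ := exists_nat_gt (2 * D / δ)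
    refine ⟨N + 2, fun n hn => ?_⟩
    obtain ⟨m, rfl⟩ : ∃ m, n = 1 + m := ⟨n - 1, by omega⟩
    have s1 := hpos 1 le_rfl
    have sm := hpos (1 + m) (by omega)
    have hpw : Real.log (C * (1 + (Real.exp (δ / 2) - 1)) ^ m) = Real.log C + m * (δ / 2) := by
      rw [add_sub_cancel, Real.log_mul hC.ne' (by positivity), Real.log_pow, Real.log_exp]
    obtain ⟨h1, h2⟩ := h m 1 le_rfl
    have h1 := Real.log_le_log (div_pos s1 sm) h1
    have h2 := Real.log_le_log (div_pos sm s1) h2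
    rw [hpw, Real.log_div s1.ne' sm.ne'] at h1
    rw [hpw, Real.log_div sm.ne' s1.ne'] at h2
    have a1 := le_abs_self (Real.log C)
    have a2 := le_abs_self (Real.log (sv 1))
    have a3 := neg_abs_le (Real.log (sv 1))
    have hm : (N : ℝ) ≤ m := by exact_mod_cast (by omega : N ≤ m)
    have hDm : 2 * D < δ * ((1 + m : ℕ) : ℝ) := by
      rw [div_lt_iff₀ hδ] at hN
      push_cast
      nlinarith
    have hpos' : (0 : ℝ) < ((1 + m : ℕ) : ℝ) := by positivity
    rw [Real.dist_eq, sub_zero, abs_div, abs_of_pos hpos', div_lt_iff₀ hpos', abs_lt]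
    push_cast at hDm ⊢
    constructor <;> nlinarith

section WeightedTail

variable {Y : Type*} [NormedAddCommGroup Y] [NormedSpace ℂ Y] {c : ℕ → Y →ₗ[ℂ] ℂ} {s : ℕ → ℝ}

/-- The norm of `Y` is the weighted `ℓ²` norm of the coefficients `c 1, c 2, …`. -/
def IsWeightedTail (c : ℕ → Y →ₗ[ℂ] ℂ) (s : ℕ → ℝ) : Prop :=
  ∀ u, HasSum (fun n => ‖c (n + 1) u‖ ^ 2 * s (n + 1) ^ 2) (‖u‖ ^ 2)

namespace IsWeightedTail

theorem norm_coeff_le (H : IsWeightedTail c s) (hs : ∀ n, 1 ≤ n → 0 < s n) {l : ℕ} (hl : 1 ≤ l)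
    (u : Y) : ‖c l u‖ ≤ (s l)⁻¹ * ‖u‖ := by
  obtain ⟨n, rfl⟩ : ∃ n, l = n + 1 := ⟨l - 1, by omega⟩
  have h1 := le_hasSum (H u) n fun _ _ => by positivity
  rw [← mul_pow] at h1
  have h2 := (pow_le_pow_iff_left₀ (mul_nonneg (norm_nonneg _) (hs _ hl).le) (norm_nonneg _)
    two_ne_zero).1 h1
  rw [inv_mul_eq_div, le_div_iff₀ (hs _ hl)]
  exact h2

theorem norm_le_of_coeff_le (H : IsWeightedTail c s) {u v : Y} {B : ℝ} (hB : 0 ≤ B)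
    (h : ∀ n, ‖c (n + 1) u‖ ^ 2 * s (n + 1) ^ 2 ≤ B ^ 2 * (‖c (n + 1) v‖ ^ 2 * s (n + 1) ^ 2)) :
    ‖u‖ ≤ B * ‖v‖ := by
  have := hasSum_le h (H u) ((H v).mul_left (B ^ 2))
  rw [← mul_pow] at this
  exact (pow_le_pow_iff_left₀ (norm_nonneg _) (by positivity) two_ne_zero).1 this

theorem ext_zero (H : IsWeightedTail c s) {u : Y} (h : ∀ l, 1 ≤ l → c l u = 0) : u = 0 := by
  have h1 := H u
  simp only [h _ (Nat.le_add_left 1 _), norm_zero, ne_eq, OfNat.ofNat_ne_zero, not_false_eq_true,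
    zero_pow, zero_mul] at h1
  simpa using h1.unique hasSum_zero

variable {e : ℕ → Y}

theorem norm_basis (H : IsWeightedTail c s) (hs : ∀ n, 1 ≤ n → 0 < s n)
    (he : ∀ l m, 1 ≤ l → 1 ≤ m → c l (e m) = if l = m then 1 else 0) {l : ℕ} (hl : 1 ≤ l) :
    ‖e l‖ = s l := by
  obtain ⟨n, rfl⟩ : ∃ n, l = n + 1 := ⟨l - 1, by omega⟩
  have h1 : HasSum (fun i => ‖c (i + 1) (e (n + 1))‖ ^ 2 * s (i + 1) ^ 2) (s (n + 1) ^ 2) := by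
    convert hasSum_ite_eq n (s (n + 1) ^ 2) using 2 with i
    rw [he _ _ (by omega) hl]
    by_cases h : i = n <;> simp [h]
  exact (pow_left_inj₀ (norm_nonneg _) (hs _ hl).le two_ne_zero).1 ((H _).unique h1)

theorem coeff_sub_sum (he : ∀ l m, 1 ≤ l → 1 ≤ m → c l (e m) = if l = m then 1 else 0) (u : Y)
    (N l : ℕ) :
    c (l + 1) (u - ∑ i ∈ Finset.range N, c (i + 1) u • e (i + 1)) =
      if l < N then 0 else c (l + 1) u := by
  rw [map_sub, map_sum]
  simp only [map_smul, he _ _ (Nat.le_add_left 1 _) (Nat.le_add_left 1 _), smul_eq_mul,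
    add_left_inj, mul_ite, mul_one, mul_zero, Finset.sum_ite_eq, Finset.mem_range]
  split_ifs <;> simp

theorem norm_sub_sum_le (H : IsWeightedTail c s)
    (he : ∀ l m, 1 ≤ l → 1 ≤ m → c l (e m) = if l = m then 1 else 0) (u : Y) (N : ℕ) :
    ‖u - ∑ i ∈ Finset.range N, c (i + 1) u • e (i + 1)‖ ≤ ‖u‖ := by
  have := H.norm_le_of_coeff_le (u := u - ∑ i ∈ Finset.range N, c (i + 1) u • e (i + 1)) (v := u)
    zero_le_one fun n => by
      rw [coeff_sub_sum he]
      split_ifs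
      · rw [norm_zero, zero_pow two_ne_zero, zero_mul]; positivity
      · simp
  simpa using this

theorem tendsto_sum (H : IsWeightedTail c s)
    (he : ∀ l m, 1 ≤ l → 1 ≤ m → c l (e m) = if l = m then 1 else 0) (u : Y) :
    Tendsto (fun N => ∑ i ∈ Finset.range N, c (i + 1) u • e (i + 1)) atTop (𝓝 u) := by
  set a : ℕ → ℝ := fun n => ‖c (n + 1) u‖ ^ 2 * s (n + 1) ^ 2
  have hn : ∀ N, ‖u - ∑ i ∈ Finset.range N, c (i + 1) u • e (i + 1)‖ ^ 2 =
      ‖u‖ ^ 2 - ∑ i ∈ Finset.range N, a i := fun N => by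
    have h1 : HasSum (fun n => if n ∈ Finset.range N then a n else 0)
        (∑ i ∈ Finset.range N, a i) := by
      have := hasSum_sum_of_ne_finset_zero (L := SummationFilter.unconditional ℕ)
        (f := fun n => if n ∈ Finset.range N then a n else 0) (s := Finset.range N) fun b hb => if_neg hb
      rwa [Finset.sum_congr rfl fun x hx => if_pos hx] at this
    refine (H _).unique ?_
    have h2 := (H u).sub h1
    refine Eq.mp (congrArg (fun f => HasSum f _) (funext fun n => ?_)) h2
    rw [coeff_sub_sum he]
    simp only [Finset.mem_range]
    split_ifs <;> simp [a]
  have h0 : Tendsto (fun N => ‖u - ∑ i ∈ Finset.range N, c (i + 1) u • e (i + 1)‖ ^ 2) atTop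
      (𝓝 0) := by
    simp only [hn]
    rw [← sub_self (‖u‖ ^ 2)]
    exact (H u).tendsto_sum_nat.const_sub (‖u‖ ^ 2)
  rw [tendsto_iff_norm_sub_tendsto_zero]
  have := h0.sqrt
  simpa [Real.sqrt_sq, norm_sub_rev] using this

/-- The forward shift of order `m` has norm controlled by the weight ratios. -/
theorem norm_shift_le (H : IsWeightedTail c s) (hs : ∀ n, 1 ≤ n → 0 < s n) {m N : ℕ} {B : ℝ}
    {t v : Y} (hB : 0 ≤ B) (hw : ∀ i, N < i → s (i + m) ≤ B * s i)
    (ht : ∀ i, 1 ≤ i → i ≤ N → c i t = 0) (hv0 : ∀ i, 1 ≤ i → i ≤ m → c i v = 0)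
    (hv : ∀ i, 1 ≤ i → c (i + m) v = c i t) : ‖v‖ ≤ B * ‖t‖ := by
  have h1 : HasSum (fun n => ‖c (n + m + 1) v‖ ^ 2 * s (n + m + 1) ^ 2) (‖v‖ ^ 2) := by
    refine (hasSum_nat_add_iff (f := fun n => ‖c (n + 1) v‖ ^ 2 * s (n + 1) ^ 2) m).2 ?_
    rw [Finset.sum_eq_zero fun i hi => by
      rw [hv0 _ (by omega) (by have := Finset.mem_range.1 hi; omega)]; simp]
    simpa using H v
  have h2 := hasSum_le (fun n => ?_) h1 ((H t).mul_left (B ^ 2))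
  · rw [← mul_pow] at h2
    exact (pow_le_pow_iff_left₀ (norm_nonneg _) (by positivity) two_ne_zero).1 h2
  · rw [add_right_comm, hv _ (by omega)]
    by_cases hn : n + 1 ≤ N
    · rw [ht _ (by omega) hn]; simp
    · have h3 := hw (n + 1) (by omega)
      have h4 := hs (n + 1 + m) (by omega)
      calc ‖c (n + 1) t‖ ^ 2 * s (n + 1 + m) ^ 2 ≤ ‖c (n + 1) t‖ ^ 2 * (B * s (n + 1)) ^ 2 := by
            gcongr
        _ = _ := by ring

end IsWeightedTail

end WeightedTail

section DiscSpace

variable {X : Type*} [NormedAddCommGroup X] [NormedSpace ℂ X] {ι : X →ₗ[ℂ] (ℂ → ℂ)}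
  {Sb Tb : X →L[ℂ] X}

theorem eq_zero_of_backward_orbit (hinj : Function.Injective ι) (hhol : ∀ f : X, ι f ∈ HolDisc)
    (hTb : ∀ f : X, ι (Tb f) = fdivB 0 (ι f)) {x : X} (h : ∀ r, ι ((Tb ^ r) x) 0 = 0) : x = 0 := by
  have h0 := eq_zero_of_backward (f := fun r => ι ((Tb ^ r) x)) (fun r => hhol _) fun r z hz => by
    have := fdivB_zero_mul (f := ι ((Tb ^ r) x)) hz
    rw [h r, zero_add, ← hTb] at this
    rw [this, pow_succ', mul_apply_eq_comp]
  refine hinj ?_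
  rw [map_zero]
  simpa using h0

theorem map_sub_shift (hhol : ∀ f : X, ι f ∈ HolDisc) (hSb : ∀ f : X, ι (Sb f) = shiftL (ι f))
    (hTb : ∀ f : X, ι (Tb f) = fdivB 0 (ι f)) (x : X) :
    ι (x - Sb (Tb x)) = (ι x 0) • oneD := by
  funext z
  by_cases hz : z ∈ ball (0 : ℂ) 1
  · rw [map_sub, hSb, hTb, Pi.sub_apply, fdivB_zero_mul (f := ι x) hz]
    simp [shiftL, oneD_apply hz]
  · rw [(hhol _).2 z hz, Pi.smul_apply, oneD_mem.2 z hz, smul_zero]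

/-- Evaluation at the origin is continuous. -/
theorem exists_eval_zero [Nontrivial X] (hinj : Function.Injective ι)
    (hhol : ∀ f : X, ι f ∈ HolDisc) (hSb : ∀ f : X, ι (Sb f) = shiftL (ι f))
    (hTb : ∀ f : X, ι (Tb f) = fdivB 0 (ι f)) :
    ∃ φ : X →L[ℂ] ℂ, ∀ x, φ x = ι x 0 := by
  obtain ⟨x, hx⟩ := exists_ne (0 : X)
  obtain ⟨r, hr⟩ : ∃ r, ι ((Tb ^ r) x) 0 ≠ 0 := by
    by_contra! hcon
    exact hx (eq_zero_of_backward_orbit hinj hhol hTb hcon)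
  set w := (Tb ^ r) x
  set e₀ : X := (ι w 0)⁻¹ • (w - Sb (Tb w)) with he
  have h0 : ι e₀ = oneD := by
    rw [he, map_smul, map_sub_shift hhol hSb hTb, smul_smul, inv_mul_cancel₀ hr, one_smul]
  have hne : e₀ ≠ 0 := fun h => by
    have := congrFun h0 0
    rw [h, map_zero, oneD_apply zero_mem_unitBall] at this
    simp at this
  have hsub : ∀ x, x - Sb (Tb x) = (ι x 0) • e₀ := fun x => hinj <| by
    rw [map_sub_shift hhol hSb hTb, map_smul, h0]
  have hpos : 0 < ‖e₀‖ := norm_pos_iff.2 hne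
  refine ⟨((LinearMap.proj 0).comp ι).mkContinuous ((1 + ‖Sb‖ * ‖Tb‖) / ‖e₀‖) fun x => ?_,
    fun x => rfl⟩
  have h1 : ‖ι x 0‖ * ‖e₀‖ ≤ (1 + ‖Sb‖ * ‖Tb‖) * ‖x‖ := by
    rw [← norm_smul, ← hsub]
    calc ‖x - Sb (Tb x)‖ ≤ ‖x‖ + ‖Sb (Tb x)‖ := norm_sub_le _ _
      _ ≤ ‖x‖ + ‖Sb‖ * (‖Tb‖ * ‖x‖) := by
          gcongr
          exact Sb.le_opNorm_of_le (Tb.le_opNorm x)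
      _ = _ := by ring
  rw [div_mul_eq_mul_div, le_div_iff₀ hpos]
  exact h1

end DiscSpace

section Tail

variable {Y : Type*} [NormedAddCommGroup Y] [NormedSpace ℂ Y] {ιY : Y →ₗ[ℂ] (ℂ → ℂ)}

/-- Taylor coefficients as linear functionals. -/
def tailCoeff (ιY : Y →ₗ[ℂ] (ℂ → ℂ)) (hYhol : ∀ u : Y, ιY u ∈ HolDisc ∧ ιY u 0 = 0) (l : ℕ) :
    Y →ₗ[ℂ] ℂ where
  toFun u := tCoeff l (ιY u)
  map_add' u v := by rw [map_add, tCoeff_add (hYhol u).1 (hYhol v).1]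
  map_smul' a u := by rw [map_smul, tCoeff_smul, RingHom.id_apply, smul_eq_mul]

theorem isWeightedTail_tailCoeff {sv : ℕ → ℝ} (hYhol : ∀ u : Y, ιY u ∈ HolDisc ∧ ιY u 0 = 0)
    (hYnorm : ∀ u : Y,
      ‖u‖ = Real.sqrt (∑' n : ℕ, ‖tCoeff (n + 1) (ιY u)‖ ^ 2 * (sv (n + 1)) ^ 2)) :
    IsWeightedTail (tailCoeff ιY hYhol) sv := by
  intro u
  have hs : Summable fun n => ‖tailCoeff ιY hYhol (n + 1) u‖ ^ 2 * sv (n + 1) ^ 2 := by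
    by_contra hcon
    have h1 := hYnorm u
    have h2 : ∑' n : ℕ, ‖tCoeff (n + 1) (ιY u)‖ ^ 2 * (sv (n + 1)) ^ 2 = 0 :=
      tsum_eq_zero_of_not_summable hcon
    rw [h2, Real.sqrt_zero, norm_eq_zero] at h1
    subst h1
    simp at hcon
  convert hs.hasSum using 1
  rw [hYnorm, Real.sq_sqrt (tsum_nonneg fun _ => by positivity)]
  rfl

end Tail

theorem exists_exp_bound {X : Type*} [NormedAddCommGroup X] [NormedSpace ℂ X] {T : X →L[ℂ] X}
    {p : ℕ → ℝ} (hp : ∀ᶠ n in atTop, 0 < p n)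
    (h : ∃ c : ℝ, c < 1 / 200 ∧ ∀ᶠ n : ℕ in atTop, Real.log ‖T ^ n‖ ≤ c * p n) :
    ∃ C : ℝ, 0 < C ∧ ∀ r, ‖T ^ r‖ ≤ C * Real.exp (max (p r) 0 / 200) := by
  obtain ⟨c, hc, h⟩ := h
  obtain ⟨K, hK⟩ := eventually_atTop.1 (hp.and h)
  refine ⟨1 + ∑ n ∈ Finset.range K, ‖T ^ n‖, by positivity, fun r => ?_⟩
  have hsum : 0 ≤ ∑ n ∈ Finset.range K, ‖T ^ n‖ := by positivity
  by_cases hr : r < K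
  · have h1 := Finset.single_le_sum (f := fun n => ‖T ^ n‖) (fun _ _ => norm_nonneg _)
      (Finset.mem_range.2 hr)
    have h2 : 1 ≤ Real.exp (max (p r) 0 / 200) := Real.one_le_exp (by positivity)
    calc ‖T ^ r‖ ≤ (1 + ∑ n ∈ Finset.range K, ‖T ^ n‖) * 1 := by linarith
      _ ≤ _ := by gcongr
  · obtain ⟨h1, h2⟩ := hK r (not_lt.1 hr)
    have h3 : ‖T ^ r‖ ≤ Real.exp (max (p r) 0 / 200) := by
      rcases (norm_nonneg (T ^ r)).eq_or_lt with h0 | h0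
      · rw [← h0]; positivity
      · rw [← Real.log_le_iff_le_exp h0, max_eq_left h1.le]
        nlinarith
    calc ‖T ^ r‖ ≤ 1 * Real.exp (max (p r) 0 / 200) := by rwa [one_mul]
      _ ≤ _ := by gcongr; linarith

/-- The bilateral shift on a space of hyperfunctions is an instance of `BiShift`. -/
theorem exists_biShift
    {X : Type*} [NormedAddCommGroup X] [NormedSpace ℂ X] [Nontrivial X]
    {ι : X →ₗ[ℂ] (ℂ → ℂ)} (hinj : Function.Injective ι) (hhol : ∀ f : X, ι f ∈ HolDisc)
    {Sb Tb : X →L[ℂ] X} (hSb : ∀ f : X, ι (Sb f) = shiftL (ι f))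
    (hTb : ∀ f : X, ι (Tb f) = fdivB 0 (ι f))
    {sv : ℕ → ℝ} (hsvpos : ∀ n, 1 ≤ n → 0 < sv n)
    {Y : Type*} [NormedAddCommGroup Y] [NormedSpace ℂ Y]
    {ιY : Y →ₗ[ℂ] (ℂ → ℂ)}
    (hYhol : ∀ u : Y, ιY u ∈ HolDisc ∧ ιY u 0 = 0)
    (hYnorm : ∀ u : Y,
      ‖u‖ = Real.sqrt (∑' n : ℕ, ‖tCoeff (n + 1) (ιY u)‖ ^ 2 * (sv (n + 1)) ^ 2))
    (hYfull : ∀ k : ℂ → ℂ, k ∈ HolDisc → k 0 = 0 →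
      Summable (fun n : ℕ => ‖tCoeff (n + 1) k‖ ^ 2 * (sv (n + 1)) ^ 2) → ∃ u : Y, ιY u = k)
    {SB SBinv : (X × Y) →L[ℂ] (X × Y)}
    (hSBp : ∀ q : X × Y,
      ι (SB q).1 = (fun z => z * ι q.1 z + deriv (ιY q.2) 0 * oneD z))
    (hSBm : ∀ q : X × Y, ιY (SB q).2 = negShiftF (ιY q.2))
    (hSBinv : ∀ q : X × Y, SBinv (SB q) = q ∧ SB (SBinv q) = q)
    (hT : ∃ C : ℝ, 0 < C ∧ ∀ r, ‖Tb ^ r‖ ≤ C * Real.exp (max (Real.log (sv r)) 0 / 200)) :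
    ∃ (φ : X →L[ℂ] ℂ) (cy : ℕ → Y →L[ℂ] ℂ) (e : ℕ → Y),
      BiShift (fun n => Real.log (sv n)) SBinv SB Tb φ cy e ∧
      ∀ l, 1 ≤ l → ∀ u, cy l u = tCoeff l (ιY u) := by
  obtain ⟨φ, hφ⟩ := exists_eval_zero hinj hhol hSb hTb
  have H := isWeightedTail_tailCoeff hYhol hYnorm
  set c := tailCoeff ιY hYhol with hcdef
  have hcy : ∀ l, ∃ f : Y →L[ℂ] ℂ, 1 ≤ l → ∀ u, f u = c l u := fun l => by
    by_cases hl : 1 ≤ l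
    · exact ⟨(c l).mkContinuous _ (H.norm_coeff_le hsvpos hl), fun _ _ => rfl⟩
    · exact ⟨0, fun h => absurd h hl⟩
  choose cy hcy using hcy
  have he : ∀ l, ∃ u : Y, 1 ≤ l → ιY u = monoD l := fun l => by
    by_cases hl : 1 ≤ l
    · obtain ⟨u, hu⟩ := hYfull (monoD l) (monoD_mem l) (by simp [monoD, show l ≠ 0 by omega]) (by
        refine summable_of_ne_finset_zero (s := {l - 1}) fun n hn => ?_
        rw [tCoeff_monoD, if_neg (by simp at hn; omega)]
        simp)
      exact ⟨u, fun _ => hu⟩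
    · exact ⟨0, fun h => absurd h hl⟩
  choose e he using he
  have hce : ∀ l m, 1 ≤ l → 1 ≤ m → c l (e m) = if l = m then 1 else 0 := fun l m _ hm => by
    change tCoeff l (ιY (e m)) = _
    rw [he m hm, tCoeff_monoD]
  have hexp : ∀ l, 1 ≤ l → Real.exp (Real.log (sv l)) = sv l := fun l hl =>
    Real.exp_log (hsvpos l hl)
  have hL1 : ∀ q, c 1 (SBinv q).2 = ι q.1 0 := fun q => by
    have h1 := congrFun (hSBp (SBinv q)) 0
    rw [(hSBinv q).2, zero_mul, zero_add, oneD_apply zero_mem_unitBall, mul_one, ← tCoeff_one] at h1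
    exact h1.symm
  have hLs : ∀ l, 1 ≤ l → ∀ q, c (l + 1) (SBinv q).2 = c l q.2 := fun l hl q => by
    have h1 := hSBm (SBinv q)
    rw [(hSBinv q).2] at h1
    change tCoeff (l + 1) (ιY (SBinv q).2) = tCoeff l (ιY q.2)
    rw [h1, negShiftF_tCoeff (h1 ▸ (hYhol q.2).1) hl]
  have hLf : ∀ q, (SBinv q).1 = Tb q.1 := fun q => hinj <| by
    rw [hTb]
    have h1 := hSBp (SBinv q)
    rw [(hSBinv q).2] at h1
    refine eq_fdivB (hhol _) zero_mem_unitBall fun z hz => ?_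
    rw [h1]
    simp only [oneD_apply hz, oneD_apply zero_mem_unitBall]
    ring
  have hext : ∀ u v : Y, (∀ l, 1 ≤ l → c l u = c l v) → u = v := fun u v h =>
    sub_eq_zero.1 (H.ext_zero fun l hl => by rw [map_sub, h l hl, sub_self])
  have hpow : ∀ m (t : Y), ((SBinv ^ m) (0, t)).1 = 0 ∧
      (∀ i, 1 ≤ i → i ≤ m → c i ((SBinv ^ m) (0, t)).2 = 0) ∧
      ∀ i, 1 ≤ i → c (i + m) ((SBinv ^ m) (0, t)).2 = c i t := fun m t => by
    induction m with
    | zero => exact ⟨by simp, fun i h1 h2 => by omega, fun i _ => by simp⟩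
    | succ m ih =>
      obtain ⟨i1, i2, i3⟩ := ih
      simp only [pow_succ', mul_apply_eq_comp]
      refine ⟨by rw [hLf, i1, map_zero], fun i h1 h2 => ?_, fun i h1 => ?_⟩
      · obtain ⟨j, rfl⟩ : ∃ j, i = j + 1 := ⟨i - 1, by omega⟩
        rcases Nat.eq_zero_or_pos j with rfl | hj
        · rw [hL1, i1, map_zero]; rfl
        · rw [hLs _ hj, i2 _ hj (by omega)]
      · rw [← add_assoc, hLs _ (by omega), i3 _ h1]
  refine ⟨φ, cy, e, ?_, fun l hl u => hcy l hl u⟩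
  exact
    { L_R := fun q => (hSBinv q).1
      R_L := fun q => (hSBinv q).2
      L_left := fun x => by
        refine Prod.ext (hLf _) (hext _ _ fun l hl => ?_)
        rw [map_smul, hce _ _ hl le_rfl]
        obtain ⟨j, rfl⟩ : ∃ j, l = j + 1 := ⟨l - 1, by omega⟩
        rcases Nat.eq_zero_or_pos j with rfl | hj
        · rw [hL1]; simp [hφ]
        · rw [hLs _ hj, map_zero, if_neg (by omega), smul_zero]
      L_e := fun l hl => by
        refine Prod.ext (by rw [hLf]; simp) (hext _ _ fun i hi => ?_)
        rw [hce _ _ hi (by omega)]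
        obtain ⟨j, rfl⟩ : ∃ j, i = j + 1 := ⟨i - 1, by omega⟩
        rcases Nat.eq_zero_or_pos j with rfl | hj
        · rw [hL1, if_neg (by omega), map_zero]; rfl
        · rw [hLs _ hj, hce _ _ hj hl]; simp
      cy_one_L := fun q => by rw [hcy 1 le_rfl, hL1, hφ]
      cy_L := fun l hl q => by rw [hcy _ (by omega), hcy _ hl, hLs _ hl]
      T_le := hT
      ext_fst := fun x h => eq_zero_of_backward_orbit hinj hhol hTb fun r => by rw [← hφ, h]
      cy_e := fun l m hl hm => by rw [hcy l hl, hce l m hl hm]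
      norm_e := fun l hl => by rw [hexp l hl, H.norm_basis hsvpos hce hl]
      norm_cy := fun l hl u => by
        rw [hcy l hl, Real.exp_neg, hexp l hl]
        exact H.norm_coeff_le hsvpos hl u
      ext_snd := fun u h => H.ext_zero fun l hl => by rw [← hcy l hl, h l hl]
      norm_tail := fun u N => by
        have h1 := H.norm_sub_sum_le hce u N
        have h2 : ∑ i ∈ Finset.Icc 1 N, cy i u • e i =
            ∑ i ∈ Finset.range N, c (i + 1) u • e (i + 1) := by
          rw [Finset.range_eq_Ico, Finset.sum_Ico_add' (fun i => c i u • e i) 0 N 1]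
          refine Finset.sum_congr (by ext; simp) fun i hi => ?_
          rw [hcy _ (Finset.mem_Ico.1 hi).1]
        rwa [h2]
      tendsto_tail := fun u => by
        simp only [hcy _ (Nat.le_add_left 1 _)]
        exact H.tendsto_sum hce u
      norm_L_pow := fun m N B t hB hw ht => by
        obtain ⟨h1, h2, h3⟩ := hpow m t
        rw [Prod.norm_def, h1, norm_zero, max_eq_right (norm_nonneg _)]
        refine H.norm_shift_le (N := N) hsvpos hB (fun i hi => ?_) (fun i h4 h5 => ?_) h2 h3
        · have := hw i hi
          rwa [hexp _ (by omega), hexp _ (by omega)] at this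
        · rw [← hcy i h4, ht i h4 h5] }

/-- (Theorem 8.5) Let `E ∈ 𝓔` and let `σ ∈ 𝒮⁻` (here `sv n` stands for
`σ(-n)`, `n ≥ 1`) satisfy: (i) `(σ(-n)/n^α)` is eventually log-concave for some
`α > 3/2`; (ii) `((log σ(-n))·(log n)^A/n)` is eventually nondecreasing for some `A > 0`;
(iii) `Σ log σ(-n)/n² = +∞`; (iv) `limsup log‖T|Eⁿ‖/log σ(-n) < 1/200`.
Let `F = E ⊕ H²_{0,σ}(ℂ∖𝔻̄)` (the tail `Y` in the reflected model).  Then every nonzero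
closed left-invariant subspace `N` of `F` satisfies, for some `k ≥ 0`: `𝐒ᵏ(N)` is
analytic, `F = 𝐒ᵏ(N) + E`, and `N = [span(∪_{n≥k} 𝐒⁻ⁿ(𝐒ᵏ(N) ∩ E))]⁻`.  In particular a
nontrivial closed bi-invariant `N` has `M := N ∩ E` a closed `z`-invariant subspace of
`E` with the division property and `N = [span(∪_{n≥k} 𝐒⁻ⁿ(M))]⁻` for some `k ≥ 0`. -/
theorem statement19
    {X : Type*} [NormedAddCommGroup X] [NormedSpace ℂ X] [CompleteSpace X] [Nontrivial X]
    (ι : X →ₗ[ℂ] (ℂ → ℂ)) (hinj : Function.Injective ι)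
    (hhol : ∀ f : X, ι f ∈ HolDisc)
    (Sb Tb : X →L[ℂ] X)
    (hSb : ∀ f : X, ι (Sb f) = shiftL (ι f))
    (hTb : ∀ f : X, ι (Tb f) = fdivB 0 (ι f))
    (hSrad : spectralRadius ℂ Sb ≤ 1) (hTrad : spectralRadius ℂ Tb ≤ 1)
    -- the weight σ ∈ 𝒮⁻
    (sv : ℕ → ℝ) (hsvpos : ∀ n, 1 ≤ n → 0 < sv n)
    (hratio : ∃ c C : ℝ, 0 < c ∧ ∀ n, 1 ≤ n → c ≤ sv (n+1) / sv n ∧ sv (n+1) / sv n ≤ C)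
    (hreg : ∀ ε : ℝ, 0 < ε → ∃ C : ℝ, 0 < C ∧ ∀ m n : ℕ, 1 ≤ n →
      sv n / sv (n + m) ≤ C * (1 + ε) ^ m ∧ sv (n + m) / sv n ≤ C * (1 + ε) ^ m)
    -- the tail Y = H²_{0,σ}(ℂ∖𝔻̄), in the reflected model
    {Y : Type*} [NormedAddCommGroup Y] [NormedSpace ℂ Y] [CompleteSpace Y]
    (ιY : Y →ₗ[ℂ] (ℂ → ℂ)) (hYinj : Function.Injective ιY)
    (hYhol : ∀ u : Y, ιY u ∈ HolDisc ∧ ιY u 0 = 0)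
    (hYnorm : ∀ u : Y,
      ‖u‖ = Real.sqrt (∑' n : ℕ, ‖tCoeff (n + 1) (ιY u)‖ ^ 2 * (sv (n + 1)) ^ 2))
    (hYfull : ∀ k : ℂ → ℂ, k ∈ HolDisc → k 0 = 0 →
      Summable (fun n : ℕ => ‖tCoeff (n + 1) k‖ ^ 2 * (sv (n + 1)) ^ 2) → ∃ u : Y, ιY u = k)
    -- the bilateral shift 𝐒 on F = E ⊕ Y and its inverse
    (SB : (X × Y) →L[ℂ] (X × Y))
    (hSBp : ∀ q : X × Y,
      ι (SB q).1 = (fun z => z * ι q.1 z + deriv (ιY q.2) 0 * oneD z))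
    (hSBm : ∀ q : X × Y, ιY (SB q).2 = negShiftF (ιY q.2))
    (SBinv : (X × Y) →L[ℂ] (X × Y))
    (hSBinv : ∀ q : X × Y, SBinv (SB q) = q ∧ SB (SBinv q) = q)
    -- (i) : (σ(-n)/n^α) is eventually log-concave for some α > 3/2
    (hi : ∃ α : ℝ, 3/2 < α ∧ ∃ N₀ : ℕ, ∀ n, N₀ ≤ n → 1 ≤ n →
      (sv n / (n : ℝ) ^ α) * (sv (n + 2) / ((n : ℝ) + 2) ^ α)
        ≤ (sv (n + 1) / ((n : ℝ) + 1) ^ α) * (sv (n + 1) / ((n : ℝ) + 1) ^ α))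
    -- (ii) : ((log σ(-n))·(log n)^A/n) is eventually nondecreasing for some A > 0
    (hii : ∃ A : ℝ, 0 < A ∧ ∃ N₁ : ℕ, ∀ n, N₁ ≤ n → 1 ≤ n →
      Real.log (sv n) * (Real.log n) ^ A / (n : ℝ)
        ≤ Real.log (sv (n + 1)) * (Real.log ((n : ℝ) + 1)) ^ A / ((n : ℝ) + 1))
    -- (iii) : Σ_{n≥1} log σ(-n) / n² = +∞
    (hiii : Filter.Tendsto
      (fun N : ℕ => ∑ n ∈ Finset.range N, Real.log (sv (n + 1)) / ((n : ℝ) + 1) ^ 2)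
      Filter.atTop Filter.atTop)
    -- (iv) : limsup_{n→∞} log ‖T|Eⁿ‖ / log σ(-n) < 1/200
    (hiv : ∃ c : ℝ, c < 1/200 ∧ ∀ᶠ n : ℕ in Filter.atTop,
      Real.log ‖(Tb ^ n : X →L[ℂ] X)‖ ≤ c * Real.log (sv n))
    -- N : nonzero closed left-invariant subspace of F
    (N : Submodule ℂ (X × Y)) (hNc : IsClosed (N : Set (X × Y))) (hN0 : N ≠ ⊥)
    (hNli : ∀ q ∈ N, SBinv q ∈ N) :
    -- main conclusion
    (∃ k : ℕ,
      -- 𝐒ᵏ(N) is analytic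
      (∃ q ∈ N.map ((SB ^ k : (X × Y) →L[ℂ] (X × Y)) : (X × Y) →ₗ[ℂ] (X × Y)),
        q ≠ 0 ∧ q.2 = 0)
      -- F = 𝐒ᵏ(N) + E
      ∧ N.map ((SB ^ k : (X × Y) →L[ℂ] (X × Y)) : (X × Y) →ₗ[ℂ] (X × Y))
          ⊔ LinearMap.ker (LinearMap.snd ℂ X Y) = ⊤
      -- N = [span(∪_{n≥k} 𝐒⁻ⁿ(𝐒ᵏ(N) ∩ E))]⁻
      ∧ N = Submodule.topologicalClosure
          (⨆ n : ℕ,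
            (N.map ((SB ^ k : (X × Y) →L[ℂ] (X × Y)) : (X × Y) →ₗ[ℂ] (X × Y))
                ⊓ LinearMap.ker (LinearMap.snd ℂ X Y)).map
              ((SBinv ^ (k + n) : (X × Y) →L[ℂ] (X × Y)) : (X × Y) →ₗ[ℂ] (X × Y))))
    -- in particular, for N a nontrivial closed bi-invariant subspace
    ∧ ((∀ q ∈ N, SB q ∈ N) → N ≠ ⊤ →
        -- M := N ∩ E is z-invariant
        (∀ q ∈ N ⊓ LinearMap.ker (LinearMap.snd ℂ X Y),
          SB q ∈ N ⊓ LinearMap.ker (LinearMap.snd ℂ X Y))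
        -- M has the division property
        ∧ (∀ q ∈ N, (q : X × Y).2 = 0 → ∀ lam ∈ Metric.ball (0:ℂ) 1, ι q.1 lam = 0 →
            ∃ g ∈ N, (g : X × Y).2 = 0 ∧ ι g.1 = fdivB lam (ι q.1))
        -- N = [span(∪_{n≥k} 𝐒⁻ⁿ(M))]⁻ for some k
        ∧ ∃ k : ℕ, N = Submodule.topologicalClosure
            (⨆ n : ℕ, (N ⊓ LinearMap.ker (LinearMap.snd ℂ X Y)).map
                ((SBinv ^ (k + n) : (X × Y) →L[ℂ] (X × Y)) : (X × Y) →ₗ[ℂ] (X × Y)))) := by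
  obtain ⟨α, hα, hi⟩ := hi
  obtain ⟨A, hA, hii⟩ := hii
  have hW := goodWeight_log hsvpos hreg (by linarith : 1 < α) hi hA hii hiii
  have hp : ∀ᶠ n in atTop, 0 < Real.log (sv n) := by
    obtain ⟨κ, hκ, K, hK, h⟩ := hW.lower
    filter_upwards [eventually_ge_atTop K] with n hn
    have hn1 : (1 : ℝ) < n := by exact_mod_cast (by omega : 1 < n)
    have := Real.log_pos hn1
    exact lt_of_lt_of_le (by positivity) (h n hn)
  obtain ⟨φ, cy, e, W, hcy⟩ := exists_biShift hinj hhol hSb hTb hsvpos hYhol hYnorm hYfull hSBp hSBm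
    hSBinv (exists_exp_bound hp hiv)
  have main := W.exists_analytic hW hNc hN0 hNli
  refine ⟨main, fun hNR _ => ⟨fun q hq => ⟨hNR q hq.1, W.R_left hq.2⟩, ?_, ?_⟩⟩
  · intro q hq hq2 lam hlam h0
    obtain ⟨g, hgN, hg⟩ := W.exists_resolvent hW hNc hNli hq hq2 (by simpa using hlam)
    have hRg : SB g = q + lam • g := by rw [← hg]; abel
    have hfst : ∀ z ∈ ball (0 : ℂ) 1,
        ι q.1 z + lam * ι g.1 z = z * ι g.1 z + cy 1 g.2 := fun z hz => by
      have h1 := congrFun (hSBp g) z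
      rw [hRg, oneD_apply hz, mul_one, ← tCoeff_one, ← hcy 1 le_rfl] at h1
      simpa using h1
    have hc1 : cy 1 g.2 = 0 := by
      have h1 := hfst lam hlam
      rw [h0, zero_add] at h1
      simpa using h1
    have hc : ∀ l, cy (l + 1) g.2 = 0 := fun l => by
      induction l with
      | zero => exact hc1
      | succ l ih =>
        have h1 := W.cy_L (l + 1) (by omega) (SB g)
        rw [W.L_R, hRg, Prod.snd_add, hq2, zero_add, Prod.smul_snd, map_smul, ih, smul_zero] at h1
        exact h1
    refine ⟨g, hgN, W.ext_snd _ fun l hl => ?_, eq_fdivB (hhol _) hlam fun z hz => ?_⟩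
    · obtain ⟨j, rfl⟩ : ∃ j, l = j + 1 := ⟨l - 1, by omega⟩
      exact hc j
    · have h1 := hfst z hz
      rw [hc1] at h1
      rw [h0]
      linear_combination h1
  · obtain ⟨k, -, -, hk⟩ := main
    have hmap : N.map ((SB ^ k : (X × Y) →L[ℂ] (X × Y)) : (X × Y) →ₗ[ℂ] (X × Y)) = N := by
      refine le_antisymm ?_ fun q hq => ?_
      · rintro _ ⟨q, hq, rfl⟩
        exact BiShift.L_pow_mem hNR k hq
      · exact ⟨_, BiShift.L_pow_mem hNli k hq, W.R_pow_L_pow k q⟩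
    rw [hmap] at hk
    exact ⟨k, hk⟩
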